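/- arXiv:0711.1348 — 3 statements merged into one kernel-verified Lean document; each statement's English description precedes it below -/
import Mathlib

section
/- Let K be a finite CW complex satisfying the five conditions of the regularity criterion: (1) each f_α(B^{dim e_α}) is a union of open cells; (2) the preimage under each f_α of the open cells of codimension one is dense in the boundary sphere; (3) the closure poset is thin and each open interval (u,v) of rank difference greater than 2 is connected; (4) each f_α restricted to the preimages of the open cells of dimension dim e_α − 1 is injective; (5) for each e_σ ⊆ closure(e_α), f_σ factors as an embedding of balls followed by f_α. Then for each open cell e_τ and each boundary point x of the ball B^{dim e_τ} with f_τ(x) lying in an open cell e_ρ ⊆ closure(e_τ) of codimension 2, there exist two distinct open cells e_{σ_1} ≠ e_{σ_2}, each of dimension dim e_ρ + 1, with x ∈ closure(f_τ^{-1}(e_{σ_1})) and x ∈ closure(f_τ^{-1}(e_{σ_2})). -/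
open Metric Set

/-- A finite CW complex on a Hausdorff space `X`: finitely many disjoint open cells
`cell α` covering `X`, with characteristic maps `f α` defined (continuously) on the closed
unit ball of a Euclidean space of the appropriate dimension, mapping the open ball
homeomorphically onto the open cell and the boundary sphere into a union of
lower-dimensional open cells. -/
structure FiniteCWComplex (X : Type) [TopologicalSpace X] [T2Space X] where
  ι : Type
  finite_ι : Finite ι
  dim : ι → ℕ
  cell : ι → Set X
  f : (α : ι) → EuclideanSpace ℝ (Fin (dim α)) → X
  f_cont : ∀ α, ContinuousOn (f α) (closedBall 0 1)
  cells_disjoint : ∀ α β, α ≠ β → Disjoint (cell α) (cell β)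
  cells_cover : ⋃ α, cell α = univ
  image_interior : ∀ α, f α '' ball 0 1 = cell α
  interior_embedding : ∀ α,
    Topology.IsEmbedding ((ball (0 : EuclideanSpace ℝ (Fin (dim α))) 1).restrict (f α))
  image_closedBall : ∀ α, f α '' closedBall 0 1 = closure (cell α)
  boundary_cells : ∀ α, ∃ s : Set ι, (∀ β ∈ s, dim β < dim α) ∧
    f α '' sphere 0 1 = ⋃ β ∈ s, cell β

variable {X : Type} [TopologicalSpace X] [T2Space X]

/-- The closure poset relation on open cells: `ρ ≤ σ` iff `cell ρ ⊆ closure (cell σ)`. -/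
def cellLE (K : FiniteCWComplex X) (ρ σ : K.ι) : Prop :=
  K.cell ρ ⊆ closure (K.cell σ)

/-- The closure poset relation extended by an adjoined minimal element `0̂` (`none`). -/
def posetLE (K : FiniteCWComplex X) : Option K.ι → Option K.ι → Prop
  | none, _ => True
  | some _, none => False
  | some ρ, some σ => cellLE K ρ σ

/-- The rank function of the closure poset with `0̂` adjoined: a cell of dimension `d` has
rank `d + 1`, and `0̂` has rank `0`. -/
def posetRank (K : FiniteCWComplex X) : Option K.ι → ℕ
  | none => 0
  | some α => K.dim α + 1

/-- Condition 1 of the regularity criterion: each `f α (B^{dim e_α})` is a union of open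
cells. -/
def Cond1 (K : FiniteCWComplex X) : Prop :=
  ∀ α, ∃ s : Set K.ι, K.f α '' closedBall 0 1 = ⋃ β ∈ s, K.cell β

/-- Condition 2 of the regularity criterion: for each `α`, the preimage under `f α` of the
open cells of dimension `dim e_α − 1` is dense in the boundary sphere of the ball. -/
def Cond2 (K : FiniteCWComplex X) : Prop :=
  ∀ α, sphere (0 : EuclideanSpace ℝ (Fin (K.dim α))) 1 ⊆
    closure (sphere 0 1 ∩ K.f α ⁻¹' (⋃ β ∈ {β | K.dim β + 1 = K.dim α}, K.cell β))

/-- Condition 3 of the regularity criterion: the closure poset (with `0̂` adjoined) is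
thin — every closed interval of rank 2 has exactly four elements — and every open
interval `(u,v)` of rank difference greater than 2 is connected (in the comparability
graph of the open interval). -/
def Cond3 (K : FiniteCWComplex X) : Prop :=
  (∀ u v : Option K.ι, posetLE K u v → posetRank K v = posetRank K u + 2 →
      {z | posetLE K u z ∧ posetLE K z v}.ncard = 4) ∧
  (∀ u v : Option K.ι, posetLE K u v → posetRank K u + 2 < posetRank K v →
      ∀ p ∈ {z | posetLE K u z ∧ posetLE K z v ∧ z ≠ u ∧ z ≠ v},
      ∀ q ∈ {z | posetLE K u z ∧ posetLE K z v ∧ z ≠ u ∧ z ≠ v},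
        Relation.ReflTransGen
          (fun a b => a ∈ {z | posetLE K u z ∧ posetLE K z v ∧ z ≠ u ∧ z ≠ v} ∧
            b ∈ {z | posetLE K u z ∧ posetLE K z v ∧ z ≠ u ∧ z ≠ v} ∧
            (posetLE K a b ∨ posetLE K b a)) p q)

/-- Condition 4 of the regularity criterion: each `f α`, restricted to the preimages of
the open cells of dimension `dim e_α − 1`, is injective. -/
def Cond4 (K : FiniteCWComplex X) : Prop :=
  ∀ α, InjOn (K.f α)
    (closedBall 0 1 ∩ K.f α ⁻¹' (⋃ β ∈ {β | K.dim β + 1 = K.dim α}, K.cell β))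

/-- Condition 5 of the regularity criterion: whenever `cell σ ⊆ closure (cell α)`, the
characteristic map `f σ` factors as an embedding of balls `B^{dim e_σ} → B^{dim e_α}`
followed by `f α`. -/
def Cond5 (K : FiniteCWComplex X) : Prop :=
  ∀ σ α, cellLE K σ α →
    ∃ g : EuclideanSpace ℝ (Fin (K.dim σ)) → EuclideanSpace ℝ (Fin (K.dim α)),
      ContinuousOn g (closedBall 0 1) ∧ InjOn g (closedBall 0 1) ∧
      g '' closedBall 0 1 ⊆ closedBall 0 1 ∧
      ∀ x ∈ closedBall (0 : EuclideanSpace ℝ (Fin (K.dim σ))) 1, K.f σ x = K.f α (g x)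

/-- Regularity of a finite CW complex with respect to its characteristic maps: each
attaching map restricts to a homeomorphism from the boundary sphere onto its image
(a union of lower-dimensional open cells, by `boundary_cells`); since the sphere is
compact and `X` is Hausdorff, this is equivalent to injectivity on the sphere. -/
def IsRegularCW (K : FiniteCWComplex X) : Prop :=
  ∀ α, InjOn (K.f α) (sphere (0 : EuclideanSpace ℝ (Fin (K.dim α))) 1)

theorem det_interp {E : Type*} [NormedAddCommGroup E] [NormedSpace ℝ E] [FiniteDimensional ℝ E]
    (v : ℕ → ℝ) (hv : Function.Injective v) :
    ∃ c : ℕ → ℝ, ∑ i ∈ Finset.range (Module.finrank ℝ E + 1), c i = 1 ∧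
      ∀ A : E →L[ℝ] E, (1 + A).det =
        ∑ i ∈ Finset.range (Module.finrank ℝ E + 1), c i * (1 + v i • A).det := by
  classical
  set s := Finset.range (Module.finrank ℝ E + 1) with hs
  refine ⟨fun i => (Lagrange.basis s v i).eval 1, ?_, ?_⟩
  · rw [← Polynomial.eval_finsetSum, Lagrange.sum_basis hv.injOn (by simp [hs])]
    simp
  · intro A
    let b := Module.finBasis ℝ E
    let M := LinearMap.toMatrix b b (A : E →ₗ[ℝ] E)
    let q : Polynomial ℝ := ((Polynomial.X : Polynomial ℝ) • M.map (Polynomial.C (R := ℝ)) +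
      (1 : Matrix (Fin (Module.finrank ℝ E)) (Fin (Module.finrank ℝ E)) ℝ).map (Polynomial.C (R := ℝ))).det
    have hq : ∀ t : ℝ, q.eval t = (1 + t • A).det := by
      intro t
      have : (1 + t • A).det = (1 + t • M).det := by
        show LinearMap.det ((1 + t • A : E →L[ℝ] E) : E →ₗ[ℝ] E) = _
        rw [← LinearMap.det_toMatrix b]
        congr 1
        have : ((1 + t • A : E →L[ℝ] E) : E →ₗ[ℝ] E) = 1 + t • (A : E →ₗ[ℝ] E) := rfl
        rw [this, map_add, map_smul, LinearMap.toMatrix_one]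
      rw [this]
      show Polynomial.eval t (Matrix.det _) = _
      rw [← Polynomial.coe_evalRingHom, RingHom.map_det]
      congr 1
      ext i j
      by_cases h : i = j <;>
      (simp [h]; ring)
    have hd : q.degree < (s.card : WithBot ℕ) := by
      have := Polynomial.natDegree_det_X_add_C_le M 1
      refine lt_of_le_of_lt Polynomial.degree_le_natDegree ?_
      rw [hs, Finset.card_range]
      simp only [Fintype.card_fin] at this
      exact_mod_cast Nat.lt_succ_of_le this
    have h := Lagrange.eq_interpolate (s := s) (v := v) hv.injOn hd
    have h1 := hq 1
    rw [one_smul] at h1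
    rw [← h1, h, Lagrange.interpolate_apply, Polynomial.eval_finsetSum]
    refine Finset.sum_congr rfl fun i _ => ?_
    rw [Polynomial.eval_mul, Polynomial.eval_C, hq, mul_comm]

theorem no_smooth_retraction {E : Type*} [NormedAddCommGroup E] [InnerProductSpace ℝ E]
    [FiniteDimensional ℝ E] (r : E → E) (hr : ContDiff ℝ 1 r) (R : ℝ) (hR : 0 < R)
    (hn : ∀ w, ‖r w‖ = R) (hid : ∀ w, ‖w‖ = R → r w = w) : False := by
  classical
  let _ : MeasurableSpace E := borel E
  have _ : BorelSpace E := ⟨rfl⟩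
  let μ : MeasureTheory.Measure E := MeasureTheory.Measure.addHaar
  have hdr : Differentiable ℝ r := hr.differentiable (by simp)
  have hcr : Continuous (fderiv ℝ r) := hr.continuous_fderiv (by simp)
  let A : E → E →L[ℝ] E := fun w => fderiv ℝ r w - 1
  have hA : Continuous A := hcr.sub continuous_const
  have hfd : ∀ w, HasFDerivAt (fun w => r w - w) (A w) w := fun w =>
    (hdr w).hasFDerivAt.sub (hasFDerivAt_id w)
  have hdet0 : ∀ w, (1 + A w).det = 0 := by
    intro w
    have e : 1 + A w = fderiv ℝ r w := by simp [A]
    rw [e]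
    by_contra hne
    have hsurj : Function.Surjective (fderiv ℝ r w) := by
      have hu : IsUnit (fderiv ℝ r w : E →ₗ[ℝ] E) :=
        (LinearMap.isUnit_iff_isUnit_det _).2 (isUnit_iff_ne_zero.2 hne)
      have := (Module.End.isUnit_iff _).1 hu
      exact this.surjective
    obtain ⟨u, hu⟩ := hsurj (r w)
    have h1 := (hdr w).hasFDerivAt.norm_sq
    have h2 : HasFDerivAt (fun x => ‖r x‖ ^ 2) (0 : E →L[ℝ] ℝ) w := by
      simp only [hn]
      exact hasFDerivAt_const _ _
    have h3 := congrArg (fun L : E →L[ℝ] ℝ => L u) (h1.unique h2)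
    simp [hu, hn] at h3
    exact hR.ne' h3
  obtain ⟨C, hC⟩ := (isCompact_closedBall (0 : E) R).exists_bound_of_continuousOn hA.continuousOn
  have hL : LipschitzOnWith C.toNNReal (fun w => r w - w) (closedBall (0 : E) R) := by
    refine Convex.lipschitzOnWith_of_nnnorm_fderiv_le (𝕜 := ℝ)
      (fun x _ => (hfd x).differentiableAt) (fun x hx => ?_) (convex_closedBall _ _)
    rw [(hfd x).fderiv]
    exact NNReal.le_toNNReal_of_coe_le (hC x hx)
  set L := C.toNNReal with hLdef
  let h : E → E := fun w => if ‖w‖ ≤ R then r w - w else 0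
  have hin : ∀ w, ‖w‖ ≤ R → h w = r w - w := fun w hw => if_pos hw
  have hout : ∀ w, R ≤ ‖w‖ → h w = 0 := by
    intro w hw
    rcases hw.eq_or_lt with e | e
    · rw [hin w e.symm.le, hid w e.symm, sub_self]
    · exact if_neg (not_le.2 e)
  have hmix : ∀ u v, ‖u‖ ≤ R → R ≤ ‖v‖ → ‖h u - h v‖ ≤ L * ‖u - v‖ := by
    intro u v hu hv
    have hcont : ContinuousOn (fun s : ℝ => ‖u + s • (v - u)‖) (Icc 0 1) := by fun_prop
    obtain ⟨s, hs, hsR⟩ := intermediate_value_Icc zero_le_one hcont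
      (show R ∈ Icc _ _ by simpa using ⟨hu, hv⟩)
    simp only at hsR
    rw [hout v hv, ← hout (u + s • (v - u)) hsR.ge, hin u hu, hin _ hsR.le]
    have := hL.norm_sub_le (x := u) (y := u + s • (v - u)) (by simpa using hu) (by simpa using hsR.le)
    refine this.trans ?_
    gcongr
    rw [show u - (u + s • (v - u)) = s • (u - v) by rw [smul_sub, smul_sub]; abel, norm_smul,
      Real.norm_of_nonneg hs.1]
    exact mul_le_of_le_one_left (norm_nonneg _) hs.2
  have hLip : ∀ u v, ‖h u - h v‖ ≤ L * ‖u - v‖ := by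
    intro u v
    rcases le_total ‖u‖ R with hu | hu <;> rcases le_total ‖v‖ R with hv | hv
    · rw [hin u hu, hin v hv]
      exact hL.norm_sub_le (by simpa using hu) (by simpa using hv)
    · exact hmix u v hu hv
    · rw [norm_sub_rev, norm_sub_rev u]; exact hmix v u hv hu
    · rw [hout u hu, hout v hv]; simp; positivity
  have hpos : ∀ᶠ t : ℝ in nhds 0, ∀ w ∈ closedBall (0 : E) R, 0 < (1 + t • A w).det := by
    refine (isCompact_closedBall (0 : E) R).eventually_forall_of_forall_eventually ?_
    intro w _
    have hc : Continuous fun z : ℝ × E => (1 + z.1 • A z.2).det :=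
      ContinuousLinearMap.continuous_det.comp
        (continuous_const.add (continuous_fst.smul (hA.comp continuous_snd)))
    refine hc.continuousAt.eventually (lt_mem_nhds ?_)
    simp only [zero_smul, add_zero]
    have : ContinuousLinearMap.det (1 : E →L[ℝ] E) = 1 := LinearMap.det_id
    rw [this]; exact one_pos
  obtain ⟨ε, hε, hεp⟩ := Metric.eventually_nhds_iff.1 hpos
  let η := min (ε / 2) (1 / (2 * (L + 1)))
  have hη : 0 < η := lt_min (by positivity) (by positivity)
  have hηε : η < ε := (min_le_left _ _).trans_lt (by linarith)
  have hηL : η * L < 1 := by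
    have : η ≤ 1 / (2 * (L + 1)) := min_le_right _ _
    have hLn : (0 : ℝ) ≤ L := L.2
    calc η * L ≤ 1 / (2 * (L + 1)) * L := by gcongr
      _ < 1 := by rw [one_div, inv_mul_lt_iff₀ (by positivity)]; linarith
  have key : ∀ t, 0 < t → t ≤ η →
      ∫ w in ball (0 : E) R, (1 + t • A w).det ∂μ = μ.real (ball (0 : E) R) := by
    intro t ht htη
    let g : E → E := fun w => w + t • h w
    have hapx : ApproximatesLinearOn g
        ((ContinuousLinearEquiv.refl ℝ E : E ≃L[ℝ] E) : E →L[ℝ] E) univ (t.toNNReal * L) := by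
      intro u _ v _
      have e : g u - g v - (u - v) = t • (h u - h v) := by simp only [g, smul_sub]; abel
      simp only [ContinuousLinearEquiv.coe_coe, ContinuousLinearEquiv.refl_apply, e, norm_smul]
      rw [NNReal.coe_mul, Real.coe_toNNReal t ht.le, Real.norm_of_nonneg ht.le, mul_assoc]
      exact mul_le_mul_of_nonneg_left (hLip u v) ht.le
    have hc : Subsingleton E ∨ t.toNNReal * L <
        ‖((ContinuousLinearEquiv.refl ℝ E : E ≃L[ℝ] E).symm : E →L[ℝ] E)‖₊⁻¹ := by
      rcases subsingleton_or_nontrivial E with hE | hE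
      · exact Or.inl hE
      · right
        have : ‖((ContinuousLinearEquiv.refl ℝ E : E ≃L[ℝ] E).symm : E →L[ℝ] E)‖₊ = 1 := by
          ext; exact ContinuousLinearMap.norm_id
        rw [this, inv_one, ← NNReal.coe_lt_coe, NNReal.coe_mul, Real.coe_toNNReal t ht.le]
        refine lt_of_le_of_lt ?_ hηL
        exact mul_le_mul_of_nonneg_right htη L.2
    have hinj : Function.Injective g := by
      have := hapx.injOn hc
      exact injOn_univ.1 this
    have hsur : Function.Surjective g := hapx.surjective hc
    have hgout : ∀ w, R ≤ ‖w‖ → g w = w := fun w hw => by simp [g, hout w hw]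
    have himg : g '' ball (0 : E) R = ball (0 : E) R := by
      ext z
      constructor
      · rintro ⟨w, hw, rfl⟩
        by_contra hz
        rw [mem_ball_zero_iff, not_lt] at hz
        have := hinj (hgout _ hz)
        rw [this] at hz
        exact absurd (mem_ball_zero_iff.1 hw) (not_lt.2 hz)
      · intro hz
        obtain ⟨w, rfl⟩ := hsur z
        refine ⟨w, ?_, rfl⟩
        by_contra hw
        rw [mem_ball_zero_iff, not_lt] at hw
        rw [hgout w hw, mem_ball_zero_iff] at hz
        exact absurd hz (not_lt.2 hw)
    have hder : ∀ w ∈ ball (0 : E) R, HasFDerivWithinAt g (1 + t • A w) (ball (0 : E) R) w := by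
      intro w hw
      have h1 : HasFDerivAt (fun w => w + t • (r w - w)) (1 + t • A w) w :=
        (hasFDerivAt_id w).add ((hfd w).const_smul t)
      refine HasFDerivWithinAt.congr' h1.hasFDerivWithinAt (fun v hv => ?_) hw
      simp only [g]
      rw [hin v (mem_ball_zero_iff.1 hv).le]
    have hcv := MeasureTheory.integral_image_eq_integral_abs_det_fderiv_smul μ
      isOpen_ball.measurableSet hder hinj.injOn (fun _ => (1 : ℝ))
    rw [himg] at hcv
    simp only [MeasureTheory.integral_const, smul_eq_mul, mul_one,
      MeasureTheory.measureReal_restrict_apply_univ] at hcv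
    rw [hcv]
    refine MeasureTheory.setIntegral_congr_fun isOpen_ball.measurableSet fun w hw => ?_
    show (1 + t • A w).det = |(1 + t • A w).det|
    rw [abs_of_pos]
    refine hεp ?_ w (ball_subset_closedBall hw)
    rw [Real.dist_eq, sub_zero, abs_of_pos ht]
    exact htη.trans_lt hηε
  let v : ℕ → ℝ := fun i => η / (i + 1)
  have hv : Function.Injective v := by
    intro i j hij
    have hij' : η / ((i : ℝ) + 1) = η / ((j : ℝ) + 1) := hij
    rw [div_eq_div_iff (by positivity) (by positivity)] at hij'
    have := mul_left_cancel₀ hη.ne' hij'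
    have h2 : (i : ℝ) = j := by linarith
    exact_mod_cast h2
  obtain ⟨c, hc1, hc⟩ := det_interp (E := E) v hv
  have hint : ∀ i, MeasureTheory.IntegrableOn (fun w => (1 + v i • A w).det) (ball (0 : E) R) μ := by
    intro i
    have hcont : Continuous fun w : E => (1 + v i • A w).det :=
      ContinuousLinearMap.continuous_det.comp
        (g := fun f : E →L[ℝ] E => f.det) (f := fun w => 1 + v i • A w) (by fun_prop)
    exact (hcont.continuousOn.integrableOn_compact (isCompact_closedBall (0 : E) R)).mono_set
      ball_subset_closedBall
  have hfin : ∫ w in ball (0 : E) R, (1 + A w).det ∂μ = μ.real (ball (0 : E) R) := by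
    rw [show (fun w => (1 + A w).det) = _ from funext fun w => hc (A w)]
    rw [MeasureTheory.integral_finsetSum _ (fun i _ => (hint i).const_mul _)]
    simp only [MeasureTheory.integral_const_mul]
    rw [Finset.sum_congr rfl (fun i _ => by
      rw [key (v i) (by positivity) (div_le_self hη.le (by simp))])]
    rw [← Finset.sum_mul, hc1, one_mul]
  simp only [hdet0, MeasureTheory.integral_zero] at hfin
  have hp : 0 < μ.real (ball (0 : E) R) :=
    ENNReal.toReal_pos (measure_ball_pos μ _ hR).ne' MeasureTheory.measure_ball_lt_top.ne
  exact hp.ne hfin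

theorem no_extension {E : Type*} [NormedAddCommGroup E] [InnerProductSpace ℝ E]
    [FiniteDimensional ℝ E] (F : E → E) (δ : ℝ) (hδ : 0 < δ)
    (hF : ContinuousOn F (closedBall 0 δ)) (h0 : ∀ w ∈ closedBall (0 : E) δ, F w ≠ 0)
    (hid : ∀ w ∈ sphere (0 : E) δ, F w = w) : False := by
  classical
  let G : E → E := fun w => if ‖w‖ ≤ δ then F w else w
  have hG : Continuous G := by
    refine continuous_if_le continuous_norm continuous_const ?_ continuous_id.continuousOn ?_
    · convert hF using 1
      ext; simp
    · intro w hw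
      exact hid w (by simpa using hw)
  obtain ⟨c, hc, hcF⟩ : ∃ c > 0, ∀ w ∈ closedBall (0 : E) δ, c ≤ ‖F w‖ := by
    obtain ⟨w, hw, hmin⟩ := (isCompact_closedBall (0 : E) δ).exists_isMinOn
      ⟨0, by simp [hδ.le]⟩ hF.norm
    exact ⟨‖F w‖, norm_pos_iff.2 (h0 w hw), fun z hz => hmin hz⟩
  obtain ⟨H, hH, hd, heq, -⟩ := hG.exists_contDiff_approx_and_eqOn 1 (ε := fun _ => min c δ)
    continuous_const (fun _ => lt_min hc hδ) (S := (ball (0 : E) (2 * δ))ᶜ)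
    (U := (closedBall (0 : E) δ)ᶜ) isOpen_ball.isClosed_compl
    ((isClosed_closedBall.isOpen_compl).mem_nhdsSet.2 (compl_subset_compl.2
      (closedBall_subset_ball (by linarith))))
    (contDiffOn_id.congr (fun w hw => by
      simp only [mem_compl_iff, mem_closedBall_zero_iff] at hw
      simp [G, hw]))
  have hG0 : ∀ w, min c δ ≤ ‖G w‖ := by
    intro w
    by_cases hw : ‖w‖ ≤ δ
    · simp only [G, if_pos hw]
      exact (min_le_left _ _).trans (hcF w (by simpa using hw))
    · simp only [G, if_neg hw]
      exact (min_le_right _ _).trans (not_le.1 hw).le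
  have hH0 : ∀ w, H w ≠ 0 := by
    intro w hw
    have := hd w
    rw [hw, dist_zero_left] at this
    exact absurd (hG0 w) (not_le.2 this)
  refine no_smooth_retraction (fun w => ((2 * δ) * ‖H w‖⁻¹) • H w) ?_ (2 * δ) (by positivity) ?_ ?_
  · have hH1 : ContDiff ℝ 1 H := hH
    exact (contDiff_const.mul ((hH1.norm ℝ hH0).inv (fun w => norm_ne_zero_iff.2 (hH0 w)))).smul hH1
  · intro w
    have : ‖H w‖ ≠ 0 := norm_ne_zero_iff.2 (hH0 w)
    rw [norm_smul, norm_mul, norm_inv, norm_norm, mul_assoc, inv_mul_cancel₀ this, mul_one,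
      Real.norm_of_nonneg (by positivity)]
  · intro w hw
    have : H w = w := by
      rw [heq (by simp [hw])]
      simp only [G]
      rw [if_neg (by linarith)]
    simp only [this, hw]
    rw [mul_inv_cancel₀ (by positivity), one_smul]

theorem boundary_not_interior {W V : Type*} [NormedAddCommGroup W] [InnerProductSpace ℝ W]
    [FiniteDimensional ℝ W] [NormedAddCommGroup V] [InnerProductSpace ℝ V]
    [FiniteDimensional ℝ V] (g : W → V) (hg : ContinuousOn g (closedBall 0 1))
    (hinj : InjOn g (closedBall 0 1)) (hgs : ∀ w ∈ closedBall (0 : W) 1, g w ∈ sphere (0 : V) 1)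
    (y : W) (hy : y ∈ sphere (0 : W) 1)
    (O : Set V) (hO : IsOpen O) (hyO : g y ∈ O)
    (hsub : ∀ z ∈ O, z ∈ sphere (0 : V) 1 → z ∈ g '' closedBall 0 1) : False := by
  classical
  have hyB : y ∈ closedBall (0 : W) 1 := sphere_subset_closedBall hy
  set x := g y with hxdef
  have hx1 : ‖x‖ = 1 := by simpa using hgs y hyB
  have hy1 : ‖y‖ = 1 := by simpa using hy
  have hxx : inner ℝ x x = (1 : ℝ) := by rw [real_inner_self_eq_norm_sq, hx1]; norm_num
  obtain ⟨ε, hε, hεg⟩ : ∃ ε > 0, ∀ w ∈ closedBall (0 : W) 1, dist w y < ε →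
      0 < inner ℝ x (g w) := by
    have hc : ContinuousOn (fun w => inner ℝ x (g w)) (closedBall (0 : W) 1) :=
      continuousOn_const.inner hg
    have := (hc y hyB).eventually (lt_mem_nhds (show (0 : ℝ) < inner ℝ x (g y) by
      rw [← hxdef, hxx]; norm_num))
    obtain ⟨ε, hε, h⟩ := Metric.mem_nhdsWithin_iff.1 this
    exact ⟨ε, hε, fun w hw hd => h ⟨hd, hw⟩⟩
  have hcpt : IsCompact (g '' (closedBall (0 : W) 1 \ ball y ε)) :=
    ((isCompact_closedBall (0 : W) 1).diff isOpen_ball).image_of_continuousOn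
      (hg.mono sdiff_subset)
  have hxn : x ∉ g '' (closedBall (0 : W) 1 \ ball y ε) := by
    rintro ⟨w, ⟨hw, hwb⟩, he⟩
    rw [hinj hw hyB he] at hwb
    exact hwb (mem_ball_self hε)
  let P := (ℝ ∙ x)ᗮ
  let φ : P → V := fun w => Real.sqrt (1 - ‖w‖ ^ 2) • x + (w : V)
  have hφc : Continuous φ := by fun_prop
  have hφ0 : φ 0 = x := by simp [φ]
  have hφs : ∀ w : P, ‖w‖ ≤ 1 → φ w ∈ sphere (0 : V) 1 := by
    intro w hw
    have ho : inner ℝ x (w : V) = 0 := Submodule.mem_orthogonal_singleton_iff_inner_right.1 w.2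
    have h1 : 0 ≤ 1 - ‖w‖ ^ 2 := by nlinarith [norm_nonneg w]
    have h2 : ‖φ w‖ ^ 2 = 1 := by
      simp only [φ]
      rw [norm_add_sq_real, norm_smul, inner_smul_left, ho, mul_pow, Real.norm_eq_abs, sq_abs,
        Real.sq_sqrt h1, hx1, Submodule.coe_norm]
      ring
    rw [mem_sphere_zero_iff_norm]
    have := norm_nonneg (φ w)
    nlinarith
  have hnb : φ ⁻¹' (O ∩ (g '' (closedBall (0 : W) 1 \ ball y ε))ᶜ) ∈ nhds (0 : P) := by
    refine hφc.continuousAt.preimage_mem_nhds ?_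
    rw [hφ0]
    exact (hO.inter hcpt.isClosed.isOpen_compl).mem_nhds ⟨hyO, hxn⟩
  obtain ⟨δ₀, hδ₀, hδsub⟩ := Metric.nhds_basis_closedBall.mem_iff.1 hnb
  let δ := min δ₀ (1 / 2)
  have hδ : 0 < δ := lt_min hδ₀ (by norm_num)
  have hex : ∀ w : P, w ∈ closedBall (0 : P) δ → ∃ k : W, k ∈ closedBall (0 : W) 1 ∧
      dist k y < ε ∧ g k = φ w := by
    intro w hw
    have hw' := mem_closedBall_zero_iff.1 hw
    obtain ⟨h1, h2⟩ := hδsub (closedBall_subset_closedBall (min_le_left _ _) hw)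
    have h3 := hφs w (hw'.trans ((min_le_right _ _).trans (by norm_num)))
    obtain ⟨k, hk, hke⟩ := hsub _ h1 h3
    refine ⟨k, hk, ?_, hke⟩
    by_contra hn
    exact h2 ⟨k, ⟨hk, fun hb => hn hb⟩, hke⟩
  choose! k hkB hkε hkg using hex
  have hkc : ContinuousOn k (closedBall (0 : P) δ) := by
    have : CompactSpace (closedBall (0 : W) 1) :=
      isCompact_iff_compactSpace.1 (isCompact_closedBall (0 : W) 1)
    have hemb : Topology.IsClosedEmbedding ((closedBall (0 : W) 1).domRestrict g) :=
      (continuousOn_iff_continuous_domRestrict.1 hg).isClosedEmbedding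
        (injOn_iff_injective.1 hinj)
    let k' : closedBall (0 : P) δ → closedBall (0 : W) 1 := fun w => ⟨k w, hkB w w.2⟩
    have hk' : Continuous k' := by
      rw [hemb.isInducing.continuous_iff]
      refine (hφc.comp continuous_subtype_val).congr fun w => ?_
      exact (hkg w w.2).symm
    rw [continuousOn_iff_continuous_domRestrict]
    exact continuous_subtype_val.comp hk'
  obtain ⟨k₀, hk₀B, hk₀ε, hk₀y⟩ : ∃ k₀ : W, k₀ ∈ closedBall (0 : W) 1 ∧ dist k₀ y < ε ∧
      k₀ ≠ y := by
    let s := min (ε / 2) 1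
    have hs : 0 < s := lt_min (by positivity) one_pos
    have hs1 : s ≤ 1 := min_le_right _ _
    have hse : s < ε := (min_le_left _ _).trans_lt (by linarith)
    refine ⟨(1 - s) • y, ?_, ?_, ?_⟩
    · rw [mem_closedBall_zero_iff, norm_smul, hy1, mul_one, Real.norm_of_nonneg (by linarith)]
      linarith
    · rw [dist_eq_norm, show (1 - s) • y - y = (-s) • y by rw [sub_smul, one_smul, neg_smul]; abel,
        norm_smul, hy1, mul_one, norm_neg, Real.norm_of_nonneg hs.le]
      exact hse
    · intro he
      have h1 := congrArg norm he
      rw [norm_smul, hy1, mul_one, Real.norm_of_nonneg (by linarith)] at h1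
      linarith
  let T : P → ℝ := fun w => (δ - ‖w‖) / δ
  let K : P → W := fun w => (1 - T w) • k w + T w • k₀
  have hT : ∀ w ∈ closedBall (0 : P) δ, 0 ≤ T w ∧ T w ≤ 1 := by
    intro w hw
    have hw' := mem_closedBall_zero_iff.1 hw
    refine ⟨div_nonneg (by linarith) hδ.le, (div_le_one hδ).2 (by linarith [norm_nonneg w])⟩
  have hKB : ∀ w ∈ closedBall (0 : P) δ, K w ∈ closedBall (0 : W) 1 ∩ ball y ε := by
    intro w hw
    obtain ⟨h0, h1⟩ := hT w hw
    exact ((convex_closedBall (0 : W) 1).inter (convex_ball y ε)) ⟨hkB w hw, hkε w hw⟩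
      ⟨hk₀B, hk₀ε⟩ (by linarith) h0 (by ring)
  have hKc : ContinuousOn K (closedBall (0 : P) δ) := by
    have hTc : Continuous T := by fun_prop
    exact ((continuous_const.sub hTc).continuousOn.smul hkc).add
      (hTc.continuousOn.smul continuousOn_const)
  have hKy : ∀ w ∈ closedBall (0 : P) δ, K w ≠ y := by
    intro w hw he
    obtain ⟨h0, h1⟩ := hT w hw
    have hkx : k w = y → w = 0 := by
      intro hk
      have h3 := hkg w hw
      rw [hk, ← hxdef] at h3
      have ho : inner ℝ x (w : V) = 0 := Submodule.mem_orthogonal_singleton_iff_inner_right.1 w.2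
      have h4 := congrArg (fun v => inner ℝ (w : V) v) h3
      simp only [φ, inner_add_right, inner_smul_right, real_inner_comm x (w : V),
        ho, mul_zero, zero_add] at h4
      have := inner_self_eq_zero.1 h4.symm
      exact_mod_cast this
    by_cases hkk : k w = k₀
    · apply hk₀y
      rw [← he]
      simp only [K]
      rw [hkk, ← add_smul, sub_add_cancel, one_smul]
    rcases h0.eq_or_lt with hT0 | hT0
    · have hKk : K w = k w := by simp [K, ← hT0]
      have hw0 := hkx (hKk.symm.trans he)
      have : T w = 1 := by
        simp only [T]
        rw [hw0, norm_zero, sub_zero, div_self hδ.ne']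
      linarith
    rcases h1.eq_or_lt with hT1 | hT1
    · apply hk₀y
      rw [← he]
      simp [K, hT1]
    · have hlt := combo_mem_ball_of_ne (hkB w hw) hk₀B hkk (sub_pos.2 hT1) hT0 (by ring)
      have hlt' : K w ∈ ball (0 : W) 1 := hlt
      rw [he, mem_ball_zero_iff, hy1] at hlt'
      exact lt_irrefl _ hlt'
  let F : P → P := fun w => P.orthogonalProjectionOnto (g (K w))
  refine no_extension F δ hδ ?_ ?_ ?_
  · exact P.orthogonalProjectionOnto.continuous.comp_continuousOn
      (hg.comp hKc fun w hw => (hKB w hw).1)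
  · intro w hw h0
    have hmem : g (K w) ∈ Pᗮ := by
      rwa [← Submodule.orthogonalProjectionOnto_eq_zero_iff]
    rw [Submodule.orthogonal_orthogonal] at hmem
    obtain ⟨c, hc⟩ := Submodule.mem_span_singleton.1 hmem
    have hp := hεg (K w) (hKB w hw).1 (hKB w hw).2
    have hn := mem_sphere_zero_iff_norm.1 (hgs (K w) (hKB w hw).1)
    rw [← hc, inner_smul_right, hxx, mul_one] at hp
    rw [← hc, norm_smul, hx1, mul_one, Real.norm_of_nonneg hp.le] at hn
    rw [hn, one_smul] at hc
    exact hKy w hw (hinj (hKB w hw).1 hyB hc.symm)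
  · intro w hw
    have hT0 : T w = 0 := by
      simp only [T]
      rw [mem_sphere_zero_iff_norm.1 hw, sub_self, zero_div]
    have hKk : K w = k w := by simp [K, hT0]
    simp only [F]
    rw [hKk, hkg w (sphere_subset_closedBall hw)]
    simp only [φ]
    rw [map_add, map_smul, Submodule.orthogonalProjectionOnto_mem_subspace_eq_self]
    have : P.orthogonalProjectionOnto x = 0 := by
      rw [Submodule.orthogonalProjectionOnto_eq_zero_iff, Submodule.orthogonal_orthogonal]
      exact Submodule.mem_span_singleton_self x
    rw [this, smul_zero, zero_add]

/-- If a finite CW complex satisfies the five conditions of the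
regularity criterion, then for each cell `τ` and each boundary point `x` of its ball whose
image lies in a cell `ρ ⊆ closure (cell τ)` of codimension 2, there are two distinct cells
of dimension `dim ρ + 1` whose preimage closures both contain `x`. -/
theorem two_codim_one_cells (K : FiniteCWComplex X)
    (h1 : Cond1 K) (h2 : Cond2 K) (h3 : Cond3 K) (h4 : Cond4 K) (h5 : Cond5 K)
    (τ ρ : K.ι) (x : EuclideanSpace ℝ (Fin (K.dim τ)))
    (hx : x ∈ sphere (0 : EuclideanSpace ℝ (Fin (K.dim τ))) 1)
    (hfx : K.f τ x ∈ K.cell ρ)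
    (hρτ : cellLE K ρ τ)
    (hdim : K.dim τ = K.dim ρ + 2) :
    ∃ σ₁ σ₂ : K.ι, σ₁ ≠ σ₂ ∧ K.dim σ₁ = K.dim ρ + 1 ∧ K.dim σ₂ = K.dim ρ + 1 ∧
      x ∈ closure (closedBall 0 1 ∩ K.f τ ⁻¹' K.cell σ₁) ∧
      x ∈ closure (closedBall 0 1 ∩ K.f τ ⁻¹' K.cell σ₂) := by
  classical
  have hfin : Finite K.ι := K.finite_ι
  have hxB : x ∈ closedBall (0 : EuclideanSpace ℝ (Fin (K.dim τ))) 1 := sphere_subset_closedBall hx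
  have hcell : ∀ {p : X} {α β : K.ι}, p ∈ K.cell α → p ∈ K.cell β → α = β := by
    intro p α β ha hb
    by_contra hne
    exact (K.cells_disjoint α β hne).le_bot ⟨ha, hb⟩
  let D : K.ι → Set (EuclideanSpace ℝ (Fin (K.dim τ))) := fun β =>
    closedBall 0 1 ∩ K.f τ ⁻¹' K.cell β
  let I : Set K.ι := {β | K.dim β + 1 = K.dim τ}
  have hdense : ∀ z ∈ sphere (0 : EuclideanSpace ℝ (Fin (K.dim τ))) 1,
      ∃ β ∈ I, z ∈ closure (D β) := by
    intro z hz
    have h := h2 τ hz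
    have hsub : sphere (0 : EuclideanSpace ℝ (Fin (K.dim τ))) 1 ∩
        K.f τ ⁻¹' (⋃ β ∈ {β | K.dim β + 1 = K.dim τ}, K.cell β) ⊆ ⋃ β ∈ I, D β := by
      rintro w ⟨hw, hw'⟩
      simp only [mem_preimage, mem_iUnion] at hw' ⊢
      obtain ⟨β, hβ, hw'⟩ := hw'
      exact ⟨β, hβ, sphere_subset_closedBall hw, hw'⟩
    have h' := closure_mono hsub h
    rw [(toFinite I).closure_biUnion] at h'
    simpa using h'
  obtain ⟨σ, hσI, hσ⟩ := hdense x hx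
  by_contra hcon
  have honly : ∀ β ∈ I, β ≠ σ → x ∉ closure (D β) := by
    intro β hβ hne hxβ
    have e1 : K.dim β + 1 = K.dim τ := hβ
    have e2 : K.dim σ + 1 = K.dim τ := hσI
    exact hcon ⟨σ, β, hne.symm, by omega, by omega, hσ, hxβ⟩
  have e2 : K.dim σ + 1 = K.dim τ := hσI
  have hle : cellLE K σ τ := by
    obtain ⟨z, hzB, hz⟩ := closure_nonempty_iff.1 ⟨x, hσ⟩
    obtain ⟨s, hs⟩ := h1 τ
    have hz' : K.f τ z ∈ ⋃ β ∈ s, K.cell β := hs ▸ mem_image_of_mem _ hzB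
    simp only [mem_iUnion] at hz'
    obtain ⟨β, hβ, hzβ⟩ := hz'
    rw [hcell hzβ hz] at hβ
    show K.cell σ ⊆ closure (K.cell τ)
    rw [← K.image_closedBall, hs]
    exact subset_biUnion_of_mem (u := K.cell) hβ
  obtain ⟨g, hgc, hginj, hgB, hgf⟩ := h5 σ τ hle
  have hDg : D σ ⊆ g '' closedBall 0 1 := by
    rintro z ⟨hzB, hz⟩
    have hz1 : K.f τ z ∈ K.cell σ := hz
    have hz2 := hz1
    rw [← K.image_interior σ] at hz2
    obtain ⟨u, hu, hfu⟩ := hz2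
    have huB := ball_subset_closedBall hu
    rw [hgf u huB] at hfu
    refine ⟨u, huB, ?_⟩
    refine h4 τ ⟨hgB (mem_image_of_mem _ huB), ?_⟩ ⟨hzB, ?_⟩ hfu
    · simp only [mem_preimage, mem_iUnion]
      exact ⟨σ, hσI, hfu ▸ hz1⟩
    · simp only [mem_preimage, mem_iUnion]
      exact ⟨σ, hσI, hz1⟩
  have hclosed : IsClosed (g '' closedBall 0 1) :=
    ((isCompact_closedBall _ _).image_of_continuousOn hgc).isClosed
  have hcl : closure (D σ) ⊆ g '' closedBall 0 1 := closure_minimal hDg hclosed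
  obtain ⟨y, hyB, hyx⟩ := hcl hσ
  have hy : y ∈ sphere (0 : EuclideanSpace ℝ (Fin (K.dim σ))) 1 := by
    rw [mem_sphere_zero_iff_norm]
    refine le_antisymm (by simpa using hyB) ?_
    by_contra hlt
    have h : K.f σ y ∈ K.cell σ := by
      rw [← K.image_interior σ]
      exact mem_image_of_mem _ (by simpa using hlt)
    rw [hgf y hyB, hyx] at h
    have := hcell h hfx
    rw [this] at e2
    omega
  have hgs : ∀ w ∈ closedBall (0 : EuclideanSpace ℝ (Fin (K.dim σ))) 1,
      g w ∈ sphere (0 : EuclideanSpace ℝ (Fin (K.dim τ))) 1 := by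
    intro w hw
    rw [mem_sphere_zero_iff_norm]
    refine le_antisymm (by simpa using hgB (mem_image_of_mem _ hw)) ?_
    by_contra hlt
    have h : K.f τ (g w) ∈ K.cell τ := by
      rw [← K.image_interior τ]
      exact mem_image_of_mem _ (by simpa using hlt)
    rw [← hgf w hw] at h
    by_cases hwb : w ∈ ball (0 : EuclideanSpace ℝ (Fin (K.dim σ))) 1
    · have h' : K.f σ w ∈ K.cell σ := by
        rw [← K.image_interior σ]
        exact mem_image_of_mem _ hwb
      have := hcell h h'
      rw [this] at e2
      omega
    · have hws : w ∈ sphere (0 : EuclideanSpace ℝ (Fin (K.dim σ))) 1 := by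
        rw [mem_sphere_zero_iff_norm]
        exact le_antisymm (by simpa using hw) (by simpa using hwb)
      obtain ⟨s, hs, hs'⟩ := K.boundary_cells σ
      have h' : K.f σ w ∈ ⋃ β ∈ s, K.cell β := hs' ▸ mem_image_of_mem _ hws
      simp only [mem_iUnion] at h'
      obtain ⟨β, hβ, h'⟩ := h'
      have h3 := hs β hβ
      have := hcell h h'
      rw [← this] at h3
      omega
  refine boundary_not_interior g hgc hginj hgs y hy
    (⋃ β ∈ I \ {σ}, closure (D β))ᶜ ?_ ?_ ?_
  · exact ((toFinite _).isClosed_biUnion fun β _ => isClosed_closure).isOpen_compl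
  · rw [hyx]
    simp only [mem_compl_iff, mem_iUnion, not_exists]
    intro β hβ
    exact honly β hβ.1 hβ.2
  · intro z hz hzs
    obtain ⟨β, hβ, hzβ⟩ := hdense z hzs
    by_cases hb : β = σ
    · exact hcl (hb ▸ hzβ)
    · exfalso
      apply hz
      simp only [mem_iUnion]
      exact ⟨β, ⟨hβ, hb⟩, hzβ⟩
end

section
/- Let K be a finite CW complex with characteristic maps f_α. Then K is regular with respect to these maps (each f_α restricts to a homeomorphism from the boundary sphere onto a union of lower-dimensional open cells) if and only if: (1) each f_α(B^{dim e_α}) is a union of open cells; (2) for each f_α the preimage of the open cells of dimension dim e_α − 1 is dense in the boundary of B^{dim e_α}; (3) the closure poset of K is thin and each open interval (u,v) with rank difference greater than 2 is connected; (4) each f_α restricted to the preimages of the open cells of dimension dim e_α − 1 is injective; (5) for each e_σ ⊆ closure(e_α), f_σ factors as an embedding B^{dim e_σ} → B^{dim e_α} followed by f_α. -/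
open Metric Set

variable {X : Type} [TopologicalSpace X] [T2Space X]

section NoRetract
variable {E : Type} [NormedAddCommGroup E] [InnerProductSpace ℝ E] [FiniteDimensional ℝ E]

/-- A Lipschitz perturbation of the identity with constant `< 1` is bijective. -/
lemma nr_bij {h : E → E} {c : NNReal} (hc : c < 1) (hh : LipschitzWith c h) :
    Function.Bijective (fun x => x + h x) := by
  constructor
  · intro x y hxy
    have h1 : x - y = h y - h x := by
      have : x + h x = y + h y := hxy
      rw [sub_eq_sub_iff_add_eq_add, this, add_comm]
    have h2 := hh.dist_le_mul y x
    rw [dist_eq_norm, dist_eq_norm, ← h1, norm_sub_rev y x] at h2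
    have hc' : (c : ℝ) < 1 := by exact_mod_cast hc
    have h3 : ‖x - y‖ ≤ 0 := by
      by_contra hcon
      push Not at hcon
      nlinarith
    exact sub_eq_zero.1 (norm_le_zero_iff.1 h3)
  · intro y
    have hl : LipschitzWith c (fun x => y - h x) := by
      refine LipschitzWith.of_dist_le_mul fun a b => ?_
      have := hh.dist_le_mul a b
      rwa [dist_sub_left]
    have hcw : ContractingWith c (fun x => y - h x) := ⟨hc, hl⟩
    refine ⟨hcw.fixedPoint, ?_⟩
    have h3 : y - h hcw.fixedPoint = hcw.fixedPoint := hcw.fixedPoint_isFixedPt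
    show hcw.fixedPoint + h hcw.fixedPoint = y
    nth_rewrite 1 [← h3]
    abel

lemma nr_interp (M : E →L[ℝ] E) (s : Finset ℕ) (v : ℕ → ℝ) (hv : InjOn v s)
    (hs : Module.finrank ℝ E < s.card) :
    (1 + M).det = ∑ i ∈ s, (1 + v i • M).det * (Lagrange.basis s v i).eval 1 := by
  classical
  let b := Module.finBasis ℝ E
  let A := LinearMap.toMatrix b b (M : E →ₗ[ℝ] E)
  let f : Polynomial ℝ := ((Polynomial.X : Polynomial ℝ) • A.map Polynomial.C +
    (1 : Matrix (Fin (Module.finrank ℝ E)) (Fin (Module.finrank ℝ E)) ℝ).map Polynomial.C).det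
  have hf : ∀ t : ℝ, f.eval t = (1 + t • M).det := by
    intro t
    have h1 : f.eval t = (Polynomial.evalRingHom t) f := rfl
    rw [h1, RingHom.map_det]
    rw [ContinuousLinearMap.det, ← LinearMap.det_toMatrix b]
    congr 1
    have : ((1 + t • M : E →L[ℝ] E) : E →ₗ[ℝ] E) = LinearMap.id + t • (M : E →ₗ[ℝ] E) := rfl
    rw [this, map_add (LinearMap.toMatrix b b), map_smul (LinearMap.toMatrix b b), LinearMap.toMatrix_id]
    ext i j
    by_cases hij : i = j <;> simp [A, hij, add_comm] <;> ring
  have hdeg : f.degree < s.card := by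
    refine lt_of_le_of_lt Polynomial.degree_le_natDegree ?_
    have := Polynomial.natDegree_det_X_add_C_le A
      (1 : Matrix (Fin (Module.finrank ℝ E)) (Fin (Module.finrank ℝ E)) ℝ)
    rw [Fintype.card_fin] at this
    exact_mod_cast lt_of_le_of_lt this hs
  have h2 := Lagrange.eq_interpolate hv hdeg
  have h3 : f.eval 1 = (1 + M).det := by rw [hf]; simp
  rw [← h3, h2, Lagrange.interpolate_apply, Polynomial.eval_finsetSum]
  refine Finset.sum_congr rfl fun i _ => ?_
  rw [Polynomial.eval_mul, Polynomial.eval_C, hf]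

lemma nr_fderiv_bound (r : E → E) (hr : ContDiff ℝ 1 r)
    (hrad : ∀ x, (1/2 : ℝ) ≤ ‖x‖ → r x = ‖x‖⁻¹ • x) :
    ∃ C : NNReal, ∀ x, ‖fderiv ℝ r x‖₊ ≤ C := by
  have hcont : Continuous (fderiv ℝ r) := hr.continuous_fderiv (by norm_num)
  obtain ⟨C, hC⟩ := (isCompact_closedBall (0:E) 1).exists_bound_of_continuousOn hcont.continuousOn
  have hC0 : 0 ≤ C := le_trans (norm_nonneg _) (hC 0 (by simp))
  refine ⟨Real.toNNReal C, fun x => ?_⟩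
  rw [← NNReal.coe_le_coe, Real.coe_toNNReal C hC0]
  show ‖fderiv ℝ r x‖ ≤ C
  by_cases hx : ‖x‖ ≤ 1
  · exact hC x (by simpa using hx)
  push Not at hx
  have hd : Differentiable ℝ r := hr.differentiable (by norm_num)
  set c : ℝ := ‖x‖⁻¹ with hc
  have hxp : 0 < ‖x‖ := by linarith
  have hcp : 0 < c := inv_pos.2 hxp
  have heq : r =ᶠ[nhds x] fun z => r (c • z) := by
    have hmem : {z : E | ‖x‖ / 2 < ‖z‖} ∈ nhds x :=
      (isOpen_lt continuous_const continuous_norm).mem_nhds (by simp only [mem_ofPred_eq]; linarith)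
    filter_upwards [hmem] with z hz
    have hz' : ‖x‖/2 < ‖z‖ := hz
    rw [hrad z (by linarith), hrad (c • z)]
    · rw [norm_smul, Real.norm_of_nonneg hcp.le, mul_inv, smul_smul]
      congr 1
      field_simp
    · rw [norm_smul, Real.norm_of_nonneg hcp.le, hc, inv_mul_eq_div, le_div_iff₀ hxp]
      linarith
  have h1 : HasFDerivAt (fun z => r (c • z)) ((fderiv ℝ r (c • x)).comp (c • ContinuousLinearMap.id ℝ E)) x := by
    refine HasFDerivAt.comp (g := r) x (hd (c • x)).hasFDerivAt ?_
    exact (hasFDerivAt_id x).const_smul c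
  rw [heq.fderiv_eq, h1.fderiv]
  have h2 : (fderiv ℝ r (c • x)).comp (c • ContinuousLinearMap.id ℝ E) = c • fderiv ℝ r (c • x) := by
    ext z; simp
  rw [h2, norm_smul, Real.norm_of_nonneg hcp.le]
  have h3 : ‖fderiv ℝ r (c • x)‖ ≤ C := by
    apply hC
    simp only [mem_closedBall, dist_zero_right, norm_smul, Real.norm_of_nonneg hcp.le]
    rw [hc, inv_mul_cancel₀ hxp.ne']
  have hc1 : c ≤ 1 := inv_le_one_of_one_le₀ hx.le
  nlinarith [norm_nonneg (fderiv ℝ r (c • x))]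

lemma nr_smooth [MeasurableSpace E] [BorelSpace E] (r : E → E) (hr : ContDiff ℝ 1 r) (h1 : ∀ x, ‖r x‖ = 1)
    (hrad : ∀ x, (1/2 : ℝ) ≤ ‖x‖ → r x = ‖x‖⁻¹ • x) : False := by
  obtain ⟨C, hC⟩ := nr_fderiv_bound r hr hrad
  have hd : Differentiable ℝ r := hr.differentiable (by norm_num)
  have hcont : Continuous (fderiv ℝ r) := hr.continuous_fderiv (by norm_num)
  let g : E → E := fun x => r x - x
  let g' : E → E →L[ℝ] E := fun x => fderiv ℝ r x - 1
  have hg' : ∀ x, HasFDerivAt g (g' x) x := fun x => (hd x).hasFDerivAt.sub (hasFDerivAt_id x)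
  have hg'c : Continuous g' := hcont.sub continuous_const
  have hg'b : ∀ x, ‖g' x‖ ≤ C + 1 := by
    intro x
    refine (norm_sub_le _ _).trans (add_le_add ?_ ContinuousLinearMap.norm_id_le)
    exact_mod_cast hC x
  have hgl : LipschitzWith (C+1) g := by
    refine lipschitzWith_of_nnnorm_fderiv_le (𝕜 := ℝ) (fun x => (hg' x).differentiableAt) fun x => ?_
    rw [(hg' x).fderiv, ← NNReal.coe_le_coe]
    exact hg'b x
  -- positivity of det near identity
  obtain ⟨ε, hε, hdet⟩ : ∃ ε > 0, ∀ A : E →L[ℝ] E, ‖A‖ < ε → 0 < (1 + A).det := by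
    have hc : Continuous (fun A : E →L[ℝ] E => (1 + A).det) :=
      ContinuousLinearMap.continuous_det.comp (continuous_const.add continuous_id)
    have h0 : (fun A : E →L[ℝ] E => (1 + A).det) 0 = 1 := by
      simp only [add_zero]
      exact LinearMap.det_id
    have hop := hc.isOpen_preimage _ (isOpen_Ioi (a := (0:ℝ)))
    obtain ⟨ε, hε, hb⟩ := Metric.isOpen_iff.1 hop 0 (by
      show (0:ℝ) < (fun A : E →L[ℝ] E => (1 + A).det) 0
      rw [h0]; norm_num)
    exact ⟨ε, hε, fun A hA => hb (by simpa using hA)⟩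
  set B := closedBall (0:E) 1
  have hC1 : (0:ℝ) < C + 1 := by positivity
  let t0 : ℝ := min (1/2) (min (1/2) (ε/2) / (C+1))
  have ht0 : 0 < t0 := by positivity
  have key : ∀ t, 0 < t → t ≤ t0 → ∫ x in B, (1 + t • g' x).det = ∫ x in B, (1:ℝ) := by
    intro t ht htt
    have ht1 : t ≤ 1/2 := htt.trans (min_le_left _ _)
    have ht2 : t * (C+1) ≤ min (1/2) (ε/2) := by
      rw [← le_div_iff₀ hC1]; exact htt.trans (min_le_right _ _)
    let f : E → E := fun x => x + t • g x
    have hbij : Function.Bijective f := by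
      have hL : LipschitzWith (Real.toNNReal t * (C+1)) (fun x => t • g x) := by
        refine LipschitzWith.of_dist_le_mul fun a b => ?_
        rw [dist_smul₀, Real.norm_of_nonneg ht.le]
        have := hgl.dist_le_mul a b
        push_cast at this ⊢
        rw [Real.coe_toNNReal t ht.le, mul_assoc]
        exact mul_le_mul_of_nonneg_left this ht.le
      refine nr_bij ?_ hL
      rw [← NNReal.coe_lt_coe]
      push_cast
      rw [Real.coe_toNNReal t ht.le]
      have := ht2.trans (min_le_left _ _)
      show t * (C+1) < 1
      linarith
    have hfeq : ∀ x, f x = (1-t) • x + t • r x := by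
      intro x
      simp only [f, g, smul_sub, sub_smul, one_smul]; abel
    have himg : f '' B = B := by
      ext y; constructor
      · rintro ⟨x, hx, rfl⟩
        have hx' : ‖x‖ ≤ 1 := by simpa [B] using hx
        have : ‖f x‖ ≤ 1 := by
          rw [hfeq]
          refine (norm_add_le _ _).trans ?_
          rw [norm_smul, norm_smul, h1, Real.norm_of_nonneg ht.le,
            Real.norm_of_nonneg (by linarith : (0:ℝ) ≤ 1 - t)]
          nlinarith
        simpa [B] using this
      · intro hy
        have hy' : ‖y‖ ≤ 1 := by simpa [B] using hy
        obtain ⟨x, hx⟩ := hbij.2 y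
        refine ⟨x, ?_, hx⟩
        by_contra hxB
        have hxn : 1 < ‖x‖ := by simpa [B] using hxB
        have : f x = ((1-t) + t * ‖x‖⁻¹) • x := by
          rw [hfeq, hrad x (by linarith), smul_smul, add_smul]
        rw [← hx, this, norm_smul, Real.norm_of_nonneg, add_mul, mul_assoc,
          inv_mul_cancel₀ (by linarith)] at hy'
        · nlinarith
        · have : 0 < ‖x‖⁻¹ := by positivity
          nlinarith
    have hff : ∀ x, HasFDerivAt f (1 + t • g' x) x := fun x =>
      (hasFDerivAt_id x).add ((hg' x).const_smul t)
    have hcv := MeasureTheory.integral_image_eq_integral_abs_det_fderiv_smul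
      (MeasureTheory.volume) (isClosed_closedBall (x := (0:E)) (ε := 1)).measurableSet
      (fun x _ => (hff x).hasFDerivWithinAt) hbij.1.injOn (fun _ => (1:ℝ))
    rw [show closedBall (0:E) 1 = B from rfl, himg] at hcv
    rw [hcv]
    congr 1
    ext x
    rw [abs_of_pos, smul_eq_mul, mul_one]
    apply hdet
    rw [norm_smul, Real.norm_of_nonneg ht.le]
    have := hg'b x
    have := ht2.trans (min_le_right _ _)
    nlinarith
  let m := Module.finrank ℝ E
  let s := Finset.range (m+1)
  let v : ℕ → ℝ := fun i => t0 * (i+1) / (m+1)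
  have hm1 : (0:ℝ) < m + 1 := by positivity
  have hvi : InjOn v s := by
    intro i _ j _ hij
    have : t0 * (i+1) / (m+1) = t0 * (j+1) / (m+1) := hij
    field_simp at this
    exact_mod_cast (by linarith : (i:ℝ) = j)
  have hsum : ∑ i ∈ s, (Lagrange.basis s v i).eval 1 = 1 := by
    rw [← Polynomial.eval_finsetSum, Lagrange.sum_basis hvi ⟨0, by simp [s]⟩]; simp
  have hI1 : ∫ x in B, (1 + g' x).det = ∫ x in B, (1:ℝ) := by
    have : ∀ x, (1 + g' x).det = ∑ i ∈ s, (1 + v i • g' x).det * (Lagrange.basis s v i).eval 1 :=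
      fun x => nr_interp (g' x) s v hvi (by simp [s, m])
    simp_rw [this]
    rw [MeasureTheory.integral_finsetSum]
    · simp_rw [MeasureTheory.integral_mul_const]
      rw [Finset.sum_congr rfl (g := fun i => (∫ x in B, (1:ℝ)) * (Lagrange.basis s v i).eval 1)]
      · rw [← Finset.mul_sum, hsum, mul_one]
      · intro i hi
        have hi' : i ≤ m := by simpa [s, Nat.lt_succ_iff] using hi
        have hi'' : (i:ℝ) ≤ m := by exact_mod_cast hi'
        rw [key (v i) (by positivity)]
        show t0 * (i+1) / (m+1) ≤ t0
        rw [div_le_iff₀ hm1]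
        nlinarith
    · intro i _
      refine ContinuousOn.integrableOn_compact (isCompact_closedBall 0 1) ?_
      refine Continuous.continuousOn ?_
      exact (ContinuousLinearMap.continuous_det.comp
        (continuous_const.add (hg'c.const_smul (v i)))).mul continuous_const
  have hI0 : ∀ x, (1 + g' x).det = 0 := by
    intro x
    have : 1 + g' x = fderiv ℝ r x := by simp [g']
    rw [this]
    by_contra hne
    have hsurj : Function.Surjective (fderiv ℝ r x) := by
      have hu : IsUnit ((fderiv ℝ r x : E →ₗ[ℝ] E)) := by
        rw [LinearMap.isUnit_iff_isUnit_det]; exact isUnit_iff_ne_zero.2 hne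
      exact ((Module.End.isUnit_iff _).1 hu).2
    obtain ⟨w, hw⟩ := hsurj (r x)
    have hc : HasFDerivAt (fun y => inner ℝ (r y) (r y)) _ x :=
      (hd x).hasFDerivAt.inner ℝ (hd x).hasFDerivAt
    have hconst : (fun y => inner ℝ (r y) (r y)) = fun _ => (1:ℝ) := by
      ext y; rw [real_inner_self_eq_norm_sq, h1]; norm_num
    rw [hconst] at hc
    have h0 := hc.unique (hasFDerivAt_const (1:ℝ) x)
    have h00 := congrArg (fun l => l w) h0
    simp [hw, h1] at h00
  simp_rw [hI0] at hI1
  simp only [MeasureTheory.integral_zero, MeasureTheory.integral_const, smul_eq_mul, mul_one] at hI1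
  have hpos : 0 < MeasureTheory.volume.real (closedBall (0:E) 1) := by
    rw [MeasureTheory.measureReal_def]
    refine ENNReal.toReal_pos (measure_closedBall_pos _ _ one_pos).ne' ?_
    exact (isCompact_closedBall (0:E) 1).measure_lt_top.ne
  rw [MeasureTheory.measureReal_restrict_apply_univ] at hI1
  linarith

end NoRetract

section Top
variable {E : Type} [NormedAddCommGroup E] [InnerProductSpace ℝ E] [FiniteDimensional ℝ E]

/-- No-retraction theorem, in the form: a continuous map which is the identity near infinity
has a zero. -/
lemma nr_cont (G : E → E) (hG : Continuous G) (R : ℝ) (hR : ∀ x, R ≤ ‖x‖ → G x = x) :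
    ∃ x, G x = 0 := by
  borelize E
  by_contra hne
  push Not at hne
  wlog hR1 : 1 ≤ R generalizing R
  · exact this (max R 1) (fun x hx => hR x ((le_max_left _ _).trans hx)) (le_max_right _ _)
  obtain ⟨δ, hδ, hGδ⟩ : ∃ δ > 0, ∀ x, δ ≤ ‖G x‖ := by
    obtain ⟨x0, -, hx0⟩ := (isCompact_closedBall (0:E) R).exists_isMinOn
      ⟨0, by simp; linarith⟩ (hG.norm.continuousOn)
    refine ⟨min 1 ‖G x0‖, lt_min one_pos (norm_pos_iff.2 (hne x0)), fun x => ?_⟩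
    by_cases hx : ‖x‖ ≤ R
    · exact (min_le_right _ _).trans (hx0 (by simpa using hx))
    · push Not at hx
      rw [hR x hx.le]
      exact (min_le_left _ _).trans (by linarith)
  obtain ⟨g, hg1, hg2, hg3⟩ := Continuous.exists_contDiff_approx (f := fun x => G x - x) 1
    (hG.sub continuous_id) (ε := fun _ => δ/2) continuous_const (fun _ => by positivity)
  let G' : E → E := fun x => (2*R) • x + g ((2*R) • x)
  have hG'0 : ∀ x, G' x ≠ 0 := by
    intro x hx
    have h1 := hg2 ((2*R) • x)
    have h2 := hGδ ((2*R) • x)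
    have h3 : g ((2*R) • x) = - ((2*R) • x) := by
      rw [eq_neg_iff_add_eq_zero, add_comm]; exact hx
    rw [h3, dist_eq_norm] at h1
    have h4 : -((2 * R) • x) - (G ((2 * R) • x) - (2 * R) • x) = - G ((2*R) • x) := by abel
    rw [h4, norm_neg] at h1
    linarith
  have hG'r : ∀ x, (1/2:ℝ) ≤ ‖x‖ → G' x = (2*R) • x := by
    intro x hx
    have : g ((2*R) • x) = 0 := by
      by_contra h
      have h1 := hg3 h
      apply h1
      show G _ - _ = 0
      rw [hR, sub_self]
      rw [norm_smul, Real.norm_of_nonneg (by linarith)]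
      nlinarith
    simp only [G', this, add_zero]
  have hG'd : ContDiff ℝ 1 G' := by
    have h1 : ContDiff ℝ 1 (fun x : E => (2*R) • x) := contDiff_const_smul _
    exact h1.add ((show ContDiff ℝ 1 g from hg1).comp h1)
  refine nr_smooth (fun x => ‖G' x‖⁻¹ • G' x) ?_ ?_ ?_
  · exact ((hG'd.norm ℝ hG'0).inv (fun x => (norm_pos_iff.2 (hG'0 x)).ne')).smul hG'd
  · intro x
    rw [norm_smul, norm_inv, norm_norm, inv_mul_cancel₀ (norm_pos_iff.2 (hG'0 x)).ne']
  · intro x hx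
    rw [hG'r x hx, norm_smul, Real.norm_of_nonneg (by linarith), smul_smul, mul_inv]
    congr 1
    field_simp

/-- Radial projection onto the closed unit ball. -/
lemma exists_radial : ∃ p : E → E, Continuous p ∧ (∀ x, ‖p x‖ ≤ 1) ∧ (∀ x, ‖x‖ ≤ 1 → p x = x) := by
  refine ⟨fun x => (max 1 ‖x‖)⁻¹ • x, ?_, ?_, ?_⟩
  · refine Continuous.smul (Continuous.inv₀ (continuous_const.max continuous_norm) ?_) continuous_id
    intro x
    exact (lt_of_lt_of_le one_pos (le_max_left _ _)).ne'
  · intro x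
    have hp : 0 < max 1 ‖x‖ := lt_of_lt_of_le one_pos (le_max_left _ _)
    rw [norm_smul, norm_inv, Real.norm_of_nonneg hp.le, inv_mul_eq_div, div_le_one hp]
    exact le_max_right _ _
  · intro x hx
    simp [max_eq_left hx]

lemma nr_stab (h : E → E) (hc : ContinuousOn h (closedBall 0 1))
    (hh : ∀ x ∈ closedBall (0:E) 1, ‖h x - x‖ ≤ 1) : ∃ x ∈ closedBall (0:E) 1, h x = 0 := by
  obtain ⟨p, hpc, hp1, hpi⟩ := exists_radial (E := E)
  have hpm : ∀ x, p x ∈ closedBall (0:E) 1 := fun x => by simpa using hp1 x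
  have hhp : Continuous fun x => h (p x) := hc.comp_continuous hpc hpm
  let μ : ℝ → ℝ := fun r => max 0 (min 1 (2 - r))
  have hμc : Continuous μ := by fun_prop
  obtain ⟨x, hx⟩ := nr_cont (fun x => x + μ ‖x‖ • (h (p x) - p x))
    (continuous_id.add ((hμc.comp continuous_norm).smul (hhp.sub hpc))) 2 (by
      intro x hx
      have : μ ‖x‖ = 0 := by
        simp only [μ]
        rw [max_eq_left]
        exact (min_le_right _ _).trans (by linarith)
      simp [this])
  have hμ1 : ∀ r, μ r ≤ 1 := fun r => max_le zero_le_one (min_le_left _ _)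
  have hμ0 : ∀ r, 0 ≤ μ r := fun r => le_max_left _ _
  by_cases hx1 : ‖x‖ ≤ 1
  · refine ⟨x, by simpa using hx1, ?_⟩
    have : μ ‖x‖ = 1 := by
      simp only [μ]
      rw [min_eq_left (by linarith), max_eq_right zero_le_one]
    rw [this, hpi x hx1, one_smul] at hx
    simpa using hx
  · exfalso
    push Not at hx1
    have h1 : x = - (μ ‖x‖ • (h (p x) - p x)) := by rwa [eq_neg_iff_add_eq_zero]
    have h2 : ‖x‖ ≤ 1 := by
      rw [h1, norm_neg, norm_smul, Real.norm_of_nonneg (hμ0 _)]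
      have := hh (p x) (hpm x)
      have := hμ1 ‖x‖
      have := hμ0 ‖x‖
      nlinarith [norm_nonneg (h (p x) - p x)]
    linarith

/-- Tietze extension along an injective map on a compact set. -/
lemma tietze_factor {X Y : Type} [TopologicalSpace X] [TopologicalSpace Y] [T2Space Y] [NormalSpace Y]
    {F : Type} [NormedAddCommGroup F] [NormedSpace ℝ F] [FiniteDimensional ℝ F]
    {K : Set X} (hK : IsCompact K) {e : X → Y} (hec : ContinuousOn e K) (hei : InjOn e K)
    {l : X → F} (hl : ContinuousOn l K) :
    ∃ g : Y → F, Continuous g ∧ ∀ x ∈ K, g (e x) = l x := by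
  have : TietzeExtension F := TietzeExtension.of_tvs ℝ
  have : CompactSpace K := isCompact_iff_compactSpace.1 hK
  have he : Topology.IsClosedEmbedding (fun x : K => e x) :=
    (continuousOn_iff_continuous_domRestrict.1 hec).isClosedEmbedding
      (fun a b hab => Subtype.ext (hei a.2 b.2 hab))
  obtain ⟨g, hg⟩ := ContinuousMap.exists_extension' he
    ⟨fun x : K => l x, continuousOn_iff_continuous_domRestrict.1 hl⟩
  exact ⟨g, g.continuous, fun x hx => congrFun hg ⟨x, hx⟩⟩

lemma tietze_glue {X : Type} [TopologicalSpace X] [NormalSpace X]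
    {F : Type} [NormedAddCommGroup F] [NormedSpace ℝ F] [FiniteDimensional ℝ F]
    {Y₁ Y₂ : Set X} (h1 : IsClosed Y₁) (h2 : IsClosed Y₂) {f g : X → F}
    (hf : Continuous f) (hg : Continuous g) (hfg : ∀ x ∈ Y₁, x ∈ Y₂ → f x = g x) :
    ∃ H : X → F, Continuous H ∧ (∀ x ∈ Y₁, H x = f x) ∧ (∀ x ∈ Y₂, H x = g x) := by
  classical
  have : TietzeExtension F := TietzeExtension.of_tvs ℝ
  have e1 : EqOn (Y₁.piecewise f g) f Y₁ := Set.piecewise_eqOn Y₁ f g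
  have e2 : EqOn (Y₁.piecewise f g) g Y₂ := by
    intro x hx
    by_cases hx1 : x ∈ Y₁
    · rw [e1 hx1, hfg x hx1 hx]
    · exact Set.piecewise_eq_of_notMem Y₁ f g hx1
  have hc : ContinuousOn (Y₁.piecewise f g) (Y₁ ∪ Y₂) :=
    (hf.continuousOn.congr e1).union_of_isClosed (hg.continuousOn.congr e2) h1 h2
  obtain ⟨H, hH⟩ := ContinuousMap.exists_restrict_eq (h1.union h2)
    (⟨_, continuousOn_iff_continuous_domRestrict.1 hc⟩ : C(↥(Y₁ ∪ Y₂), F))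
  have hH' : ∀ x ∈ Y₁ ∪ Y₂, H x = Y₁.piecewise f g x := fun x hx =>
    congrArg (fun k : C(↥(Y₁ ∪ Y₂), F) => k ⟨x, hx⟩) hH
  exact ⟨H, H.continuous, fun x hx => (hH' x (Or.inl hx)).trans (e1 hx),
    fun x hx => (hH' x (Or.inr hx)).trans (e2 hx)⟩

/-- Perturbing a map so that it avoids zero on a null set. -/
lemma avoid_zero [MeasurableSpace E] [BorelSpace E] (F : E → E) (hF : Continuous F) (A Z : Set E)
    (hA : IsCompact A) (hFA : ∀ x ∈ A, F x ≠ 0) (hZ : MeasureTheory.volume Z = 0)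
    (η : ℝ) (hη : 0 < η) :
    ∃ F' : E → E, Continuous F' ∧ (∀ x ∈ A, F' x = F x) ∧ (∀ x, ‖F' x - F x‖ ≤ η) ∧
      ∀ x ∈ Z, F' x ≠ 0 := by
  obtain ⟨δ, hδ, hFδ⟩ : ∃ δ > 0, ∀ x ∈ A, 2 * δ ≤ ‖F x‖ := by
    rcases A.eq_empty_or_nonempty with h | h
    · exact ⟨1, one_pos, by simp [h]⟩
    · obtain ⟨x0, hx0, hm⟩ := hA.exists_isMinOn h hF.norm.continuousOn
      have := norm_pos_iff.2 (hFA x0 hx0)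
      exact ⟨‖F x0‖/2, by linarith, fun x hx => by have h5 : ‖F x0‖ ≤ ‖F x‖ := hm hx; linarith⟩
  set κ := min δ η / 2 with hκ
  have hκp : 0 < κ := by positivity
  obtain ⟨P, hP1, hP2, -⟩ := Continuous.exists_contDiff_approx 1 hF (ε := fun _ => κ)
    continuous_const (fun _ => hκp)
  have hnull : MeasureTheory.volume (P '' Z) = 0 :=
    MeasureTheory.addHaar_image_eq_zero_of_differentiableOn_of_addHaar_eq_zero _
      ((show ContDiff ℝ 1 P from hP1).differentiable (by norm_num)).differentiableOn hZ
  obtain ⟨v, hv1, hv2⟩ : ∃ v : E, ‖v‖ < κ ∧ v ∉ P '' Z := by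
    by_contra hcon
    push Not at hcon
    have hsub : ball (0:E) κ ⊆ P '' Z := fun v hv => hcon v (by simpa using hv)
    have := MeasureTheory.measure_mono_null hsub hnull
    exact (measure_ball_pos MeasureTheory.volume (0:E) hκp).ne' this
  let P' : E → E := fun x => P x - v
  have hP'c : Continuous P' := hP1.continuous.sub continuous_const
  have hP'F : ∀ x, ‖P' x - F x‖ < min δ η := by
    intro x
    have h1 := hP2 x
    rw [dist_eq_norm] at h1
    have : P' x - F x = (P x - F x) - v := by simp only [P']; abel
    rw [this]
    have := norm_sub_le (P x - F x) v
    linarith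
  have hP'0 : ∀ x ∈ Z, P' x ≠ 0 := by
    intro x hx h0
    exact hv2 ⟨x, hx, sub_eq_zero.1 h0⟩
  let μ : ℝ → ℝ := fun r => max 0 (min 1 (2 - r/δ))
  have hμc : Continuous μ := by fun_prop
  have hμ1 : ∀ r, μ r ≤ 1 := fun r => max_le zero_le_one (min_le_left _ _)
  have hμ0 : ∀ r, 0 ≤ μ r := fun r => le_max_left _ _
  have hbd : ∀ x, ‖μ ‖F x‖ • (P' x - F x)‖ ≤ ‖P' x - F x‖ := by
    intro x
    rw [norm_smul, Real.norm_of_nonneg (hμ0 _)]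
    exact mul_le_of_le_one_left (norm_nonneg _) (hμ1 _)
  refine ⟨fun x => F x + μ ‖F x‖ • (P' x - F x),
    hF.add ((hμc.comp hF.norm).smul (hP'c.sub hF)), ?_, ?_, ?_⟩
  · intro x hx
    have : μ ‖F x‖ = 0 := by
      simp only [μ]
      rw [max_eq_left]
      refine (min_le_right _ _).trans ?_
      have := hFδ x hx
      rw [sub_nonpos, le_div_iff₀ hδ]
      exact this
    simp [this]
  · intro x
    simp only [add_sub_cancel_left]
    exact (hbd x).trans ((hP'F x).le.trans (min_le_right _ _))
  · intro x hx h0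
    simp only at h0
    by_cases hxd : ‖F x‖ ≤ δ
    · have : μ ‖F x‖ = 1 := by
        simp only [μ]
        have : ‖F x‖/δ ≤ 1 := (div_le_one hδ).2 hxd
        rw [min_eq_left (by linarith), max_eq_right zero_le_one]
      rw [this, one_smul, add_sub_cancel] at h0
      exact hP'0 x hx h0
    · push Not at hxd
      have h1 : F x = -(μ ‖F x‖ • (P' x - F x)) := by rwa [eq_neg_iff_add_eq_zero]
      have h2 := hbd x
      rw [← norm_neg, ← h1] at h2
      have := (hP'F x).trans_le (min_le_left _ _)
      linarith

lemma inv_domain_core (f : E → E) (hf : ContinuousOn f (closedBall 0 1))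
    (hi : InjOn f (closedBall 0 1)) : f 0 ∈ interior (f '' closedBall 0 1) := by
  borelize E
  have h0 : (0:E) ∈ closedBall (0:E) 1 := by simp
  obtain ⟨G, hGc, hG⟩ := tietze_factor (isCompact_closedBall (0:E) 1) hf hi
    (l := fun x => x) continuousOn_id
  by_contra hcon
  obtain ⟨ε, hε, hGε⟩ : ∃ ε > 0, ∀ y, ‖y - f 0‖ ≤ 2 * ε → ‖G y‖ ≤ 1/10 := by
    have h1 : ContinuousAt G (f 0) := hGc.continuousAt
    rw [Metric.continuousAt_iff] at h1
    obtain ⟨d, hd, h2⟩ := h1 (1/10) (by norm_num)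
    refine ⟨d/4, by linarith, fun y hy => ?_⟩
    have := h2 (x := y) (by rw [dist_eq_norm]; linarith)
    rw [hG 0 h0, dist_zero_right] at this
    exact this.le
  obtain ⟨c, hc1, hc2⟩ : ∃ c, ‖c - f 0‖ < ε ∧ c ∉ f '' closedBall 0 1 := by
    by_contra hno
    push Not at hno
    apply hcon
    rw [mem_interior_iff_mem_nhds]
    refine Filter.mem_of_superset (ball_mem_nhds _ hε) fun c hc => hno c ?_
    rwa [← dist_eq_norm]
  have hfB : IsCompact (f '' closedBall (0:E) 1) := (isCompact_closedBall 0 1).image_of_continuousOn hf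
  let A : Set E := f '' closedBall 0 1 ∩ {y | ε ≤ ‖y - c‖}
  have hA : IsCompact A := hfB.inter_right
    (isClosed_le continuous_const (continuous_id.sub continuous_const).norm)
  have hGA : ∀ y ∈ A, G y ≠ 0 := by
    rintro y ⟨⟨x, hx, rfl⟩, hy⟩ hG0
    rw [hG x hx] at hG0
    rw [hG0] at hy
    have hy' : ε ≤ ‖f 0 - c‖ := hy
    rw [norm_sub_rev] at hy'
    linarith
  obtain ⟨F', hF'c, hF'A, hF'n, hF'Z⟩ := avoid_zero G hGc A (sphere c ε) hA hGA
    (MeasureTheory.Measure.addHaar_sphere_of_ne_zero _ _ hε.ne') (1/10) (by norm_num)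
  let Φ : E → E := fun y => c + (max 1 (ε / ‖y - c‖)) • (y - c)
  have hΦc : ContinuousOn (fun x => Φ (f x)) (closedBall 0 1) := by
    have hsub : ContinuousOn (fun x => f x - c) (closedBall 0 1) := hf.sub continuousOn_const
    refine continuousOn_const.add (ContinuousOn.smul ?_ hsub)
    refine ContinuousOn.sup continuousOn_const (continuousOn_const.div hsub.norm ?_)
    intro x hx h
    exact hc2 ⟨x, hx, sub_eq_zero.1 (norm_eq_zero.1 h)⟩
  have hΦ1 : ∀ y, ε ≤ ‖y - c‖ → Φ y = y := by
    intro y hy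
    simp only [Φ]
    rw [max_eq_left ((div_le_one (by linarith)).2 hy), one_smul, add_sub_cancel]
  have hΦ2 : ∀ x ∈ closedBall (0:E) 1, ‖f x - c‖ < ε → Φ (f x) ∈ sphere c ε := by
    intro x hx hy
    have hpos : 0 < ‖f x - c‖ := by
      rw [norm_pos_iff, sub_ne_zero]
      intro h; exact hc2 ⟨x, hx, h⟩
    simp only [Φ, mem_sphere, dist_eq_norm, add_sub_cancel_left]
    rw [max_eq_right ((one_le_div hpos).2 hy.le), norm_smul, Real.norm_of_nonneg (by positivity),
      div_mul_cancel₀ _ hpos.ne']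
  have hball : ∀ y, ‖y - c‖ ≤ ε → ‖G y‖ ≤ 1/10 := by
    intro y hy
    apply hGε
    have : y - f 0 = (y - c) + (c - f 0) := by abel
    rw [this]
    exact (norm_add_le _ _).trans (by linarith)
  obtain ⟨x, hx, hx0⟩ := nr_stab (fun x => F' (Φ (f x))) (hF'c.comp_continuousOn hΦc) (by
    intro x hx
    by_cases hy : ε ≤ ‖f x - c‖
    · rw [hΦ1 _ hy, hF'A _ ⟨⟨x, hx, rfl⟩, hy⟩, hG x hx]; simp
    · push Not at hy
      have hs := hΦ2 x hx hy
      have h1 := hF'n (Φ (f x))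
      have h2 := hball (Φ (f x)) (by
        have : dist (Φ (f x)) c = ε := hs
        rw [← dist_eq_norm, this])
      have h3 := hball (f x) hy.le
      rw [hG x hx] at h3
      have : F' (Φ (f x)) - x = (F' (Φ (f x)) - G (Φ (f x))) + G (Φ (f x)) - x := by abel
      rw [this]
      have h4 := norm_sub_le ((F' (Φ (f x)) - G (Φ (f x))) + G (Φ (f x))) x
      have h5 := norm_add_le (F' (Φ (f x)) - G (Φ (f x))) (G (Φ (f x)))
      linarith)
  by_cases hy : ε ≤ ‖f x - c‖
  · rw [hΦ1 _ hy, hF'A _ ⟨⟨x, hx, rfl⟩, hy⟩] at hx0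
    exact hGA _ ⟨⟨x, hx, rfl⟩, hy⟩ hx0
  · push Not at hy
    exact hF'Z _ (hΦ2 x hx hy) hx0

/-- Invariance of domain. -/
lemma inv_domain (f : E → E) (U : Set E) (hU : IsOpen U) (hf : ContinuousOn f U)
    (hi : InjOn f U) : IsOpen (f '' U) := by
  rw [isOpen_iff_mem_nhds]
  rintro _ ⟨x, hx, rfl⟩
  obtain ⟨ρ, hρ, hb⟩ := Metric.nhds_basis_closedBall.mem_iff.1 (hU.mem_nhds hx)
  have hmap : MapsTo (fun z : E => x + ρ • z) (closedBall 0 1) (closedBall x ρ) := by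
    intro z hz
    have : ‖z‖ ≤ 1 := by simpa using hz
    simp only [mem_closedBall, dist_eq_norm, add_sub_cancel_left, norm_smul,
      Real.norm_of_nonneg hρ.le]
    nlinarith
  have h1 := inv_domain_core (fun z => f (x + ρ • z))
    (hf.comp (by fun_prop) (fun z hz => hb (hmap hz))) (by
      intro a ha b hb' hab
      have := hi (hb (hmap ha)) (hb (hmap hb')) hab
      have := add_left_cancel this
      exact smul_right_injective E hρ.ne' this)
  rw [mem_interior_iff_mem_nhds] at h1
  simp only [smul_zero, add_zero] at h1
  refine Filter.mem_of_superset h1 ?_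
  rintro _ ⟨z, hz, rfl⟩
  exact ⟨_, hb (hmap hz), rfl⟩

/-- Local non-separation in codimension at least two. -/
lemma local_nonsep {F : Type} [NormedAddCommGroup F] [NormedSpace ℝ F] [FiniteDimensional ℝ F]
    (hdim : Module.finrank ℝ F + 2 ≤ Module.finrank ℝ E) (c : E) (r : ℝ)
    (A : Set E) (hA : IsCompact A) (j : E → F) (hj : ContinuousOn j A) (hji : InjOn j A)
    (V₁ V₂ : Set E) (hV₁ : IsOpen V₁) (hV₂ : IsOpen V₂) (hV : Disjoint V₁ V₂)
    (hcov : closedBall c r ⊆ A ∪ (V₁ ∪ V₂)) (p q : E) (hp : p ∈ V₁) (hq : q ∈ V₂)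
    (hpb : p ∈ ball c r) (hqb : q ∈ ball c r) (hpA : p ∉ A) (hqA : q ∉ A) : False := by
  borelize E
  obtain ⟨ι, hι⟩ : ∃ ι : F × ℝ →ₗ[ℝ] E, Function.Injective ι := by
    apply Module.Free.exists_linearMap_injective_of_rank_lt
    rw [← Module.finrank_eq_rank, ← Module.finrank_eq_rank, Module.finrank_prod, Module.finrank_self]
    exact_mod_cast (by omega)
  have hιc : Continuous ι := ι.continuous_of_finiteDimensional
  have hιnull : MeasureTheory.volume (range ι) = 0 := by
    have := MeasureTheory.Measure.addHaar_submodule MeasureTheory.volume (LinearMap.range ι) (by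
      intro h
      have h1 := LinearMap.finrank_range_of_inj hι
      rw [h, finrank_top, Module.finrank_prod, Module.finrank_self] at h1
      omega)
    rw [LinearMap.coe_range] at this
    exact this
  obtain ⟨j', hj'c, hj'⟩ := tietze_factor hA continuousOn_id (injOn_id _) hj
  simp only [id] at hj'
  let I : Set ℝ := Icc 0 1
  have hI : IsCompact I := isCompact_Icc
  let D := closedBall c r
  have hD : IsCompact D := isCompact_closedBall c r
  let S := sphere c r
  have hS : IsCompact S := isCompact_sphere c r
  let L : E × ℝ → E := fun z => z.1 - ((1 - z.2) • q + z.2 • p)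
  have hLc : Continuous L := by fun_prop
  have hLS : ∀ x ∈ S, ∀ t ∈ I, L (x, t) ≠ 0 := by
    intro x hx t ht h0
    have h1 : x = (1 - t) • q + t • p := sub_eq_zero.1 h0
    have h2 : x ∈ ball c r := by
      rw [h1]
      exact (convex_ball c r) hqb hpb (by linarith [ht.2]) ht.1 (by ring)
    have h3 : dist x c = r := hx
    have h4 : dist x c < r := h2
    linarith
  let e : E × ℝ → E := fun z => ι (j' z.1, z.2)
  have hec : Continuous e := hιc.comp ((hj'c.comp continuous_fst).prodMk continuous_snd)
  have hei : InjOn e (A ×ˢ I) := by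
    rintro ⟨x, t⟩ hx ⟨y, s⟩ hy hxy
    have h1 := hι hxy
    simp only [Prod.mk.injEq] at h1
    rw [hj' x hx.1, hj' y hy.1] at h1
    exact Prod.ext (hji hx.1 hy.1 h1.1) h1.2
  obtain ⟨F0, hF0c, hF0⟩ := tietze_factor (hA.prod hI) hec.continuousOn hei hLc.continuousOn
  let A' : Set (E × ℝ) := (A ×ˢ I) ∩ {z | z.1 ∈ S ∨ z.2 = 0 ∨ z.2 = 1}
  have hA' : IsCompact A' := by
    refine (hA.prod hI).inter_right ?_
    refine IsClosed.union (hS.isClosed.preimage continuous_fst) (IsClosed.union ?_ ?_)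
    · exact isClosed_eq continuous_snd continuous_const
    · exact isClosed_eq continuous_snd continuous_const
  obtain ⟨F', hF'c, hF'A, -, hF'Z⟩ := avoid_zero F0 hF0c (e '' A') (e '' (A ×ˢ I))
    (hA'.image hec) (by
      rintro _ ⟨⟨x, t⟩, ⟨hz, hz2⟩, rfl⟩ h0
      rw [hF0 _ hz] at h0
      rcases hz2 with h | h | h
      · exact hLS x h t hz.2 h0
      · simp only at h
        subst h
        simp only [L, sub_zero, one_smul, zero_smul, add_zero] at h0
        exact hqA (sub_eq_zero.1 h0 ▸ hz.1)
      · simp only at h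
        subst h
        simp only [L, sub_self, one_smul, zero_smul, zero_add] at h0
        exact hpA (sub_eq_zero.1 h0 ▸ hz.1))
    (MeasureTheory.measure_mono_null (by rintro _ ⟨z, -, rfl⟩; exact ⟨_, rfl⟩) hιnull) 1 one_pos
  obtain ⟨H, hHc, hH1, hH2⟩ := tietze_glue (Y₁ := A ×ˢ I) (Y₂ := S ×ˢ I ∪ D ×ˢ {0})
    (hA.prod hI).isClosed ((hS.prod hI).isClosed.union (hD.prod isCompact_singleton).isClosed)
    (hF'c.comp hec) hLc (by
      rintro ⟨x, t⟩ hz hz2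
      have hzA' : (x, t) ∈ A' := by
        refine ⟨hz, ?_⟩
        rcases hz2 with h | h
        · exact Or.inl h.1
        · exact Or.inr (Or.inl h.2)
      show F' (e (x, t)) = _
      rw [hF'A _ ⟨_, hzA', rfl⟩, hF0 _ hz])
  let Q := D \ V₂
  have hQ : IsCompact Q := hD.diff hV₂
  let Zr : Set (E × ℝ) := (Q ×ˢ I) ∩ {z | H z = 0}
  have hZr : IsCompact Zr := (hQ.prod hI).inter_right (isClosed_eq hHc continuous_const)
  have hdisj : Disjoint (Prod.fst '' Zr) (A ∪ S) := by
    rw [Set.disjoint_left]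
    rintro _ ⟨⟨x, t⟩, ⟨hz, hz0⟩, rfl⟩ hx
    have hz0' : H (x, t) = 0 := hz0
    rcases hx with hx | hx
    · rw [hH1 _ ⟨hx, hz.2⟩] at hz0'
      exact hF'Z _ ⟨_, ⟨hx, hz.2⟩, rfl⟩ hz0'
    · rw [hH2 _ (Or.inl ⟨hx, hz.2⟩)] at hz0'
      exact hLS x hx t hz.2 hz0'
  obtain ⟨lam, hl0, hl1, hl01⟩ := exists_continuous_zero_one_of_isClosed
    (hZr.image continuous_fst).isClosed (hA.union hS).isClosed hdisj
  let G1 : E → E := fun x => H (x, lam x)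
  have hG1c : Continuous G1 := hHc.comp (continuous_id.prodMk lam.continuous)
  have hG1Q : ∀ x ∈ Q, G1 x ≠ 0 := by
    intro x hx h0
    have h1 : x ∈ Prod.fst '' Zr := ⟨(x, lam x), ⟨⟨hx, hl01 x⟩, h0⟩, rfl⟩
    have h2 : lam x = 0 := hl0 h1
    have h3 : H (x, lam x) = 0 := h0
    rw [h2, hH2 (x, 0) (Or.inr ⟨hx.1, mem_singleton _⟩)] at h3
    simp only [L, sub_zero, one_smul, zero_smul, add_zero] at h3
    exact hx.2 (sub_eq_zero.1 h3 ▸ hq)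
  have hG1AS : ∀ x ∈ A ∪ S, G1 x = x - p := by
    intro x hx
    have h2 : lam x = 1 := hl1 hx
    have h1I : (1:ℝ) ∈ I := ⟨zero_le_one, le_rfl⟩
    have hL1 : L (x, 1) = x - p := by simp [L]
    show H (x, lam x) = x - p
    rw [h2]
    rcases hx with hx | hx
    · rw [hH1 _ ⟨hx, h1I⟩]
      have hzA' : (x, (1:ℝ)) ∈ A' := ⟨⟨hx, h1I⟩, Or.inr (Or.inr rfl)⟩
      show F' (e (x, 1)) = _
      rw [hF'A _ ⟨_, hzA', rfl⟩, hF0 _ hzA'.1, hL1]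
    · rw [hH2 _ (Or.inl ⟨hx, h1I⟩), hL1]
  let Q' : Set E := (D \ V₁) ∪ (ball c r)ᶜ
  obtain ⟨H', hH'c, hH'1, hH'2⟩ := tietze_glue (Y₁ := Q) (Y₂ := Q')
    hQ.isClosed ((hD.diff hV₁).isClosed.union isOpen_ball.isClosed_compl) hG1c
    (continuous_id.sub continuous_const) (g := fun x => x - p) (by
      intro x hx hx'
      apply hG1AS
      rcases hx' with h | h
      · rcases hcov h.1 with h1 | h1 | h1
        · exact Or.inl h1
        · exact absurd h1 h.2
        · exact absurd h1 hx.2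
      · right
        have h1 : dist x c ≤ r := hx.1
        have h2 : ¬ dist x c < r := h
        exact le_antisymm h1 (not_lt.1 h2))
  obtain ⟨x, hx⟩ := nr_cont (fun x => H' (x + p)) (hH'c.comp (continuous_id.add continuous_const))
    (2 * r) (by
      intro x hx
      have : x + p ∈ Q' := by
        right
        intro hxb
        have h1 : dist (x + p) c < r := hxb
        have h2 : dist p c < r := hpb
        have h3 := dist_triangle_right (x + p) p c
        have h4 : dist (x + p) p = ‖x‖ := by simp [dist_eq_norm]
        linarith
      simp only [hH'2 _ this, add_sub_cancel_right])
  by_cases hxQ : x + p ∈ Q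
  · rw [hH'1 _ hxQ] at hx
    exact hG1Q _ hxQ hx
  · have hxQ' : x + p ∈ Q' := by
      by_cases hxD : x + p ∈ D
      · left
        refine ⟨hxD, fun h1 => hxQ ⟨hxD, fun h2 => Set.disjoint_left.1 hV h1 h2⟩⟩
      · right
        intro h; exact hxD (ball_subset_closedBall h)
    rw [hH'2 _ hxQ', add_sub_cancel_right] at hx
    rw [hx, zero_add] at hxQ'
    rcases hxQ' with h | h
    · exact h.2 hp
    · exact h hpb

end Top

section Sph
set_option linter.unusedSectionVars false
variable {E : Type} [NormedAddCommGroup E] [InnerProductSpace ℝ E] [FiniteDimensional ℝ E]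
variable {F : Type} [NormedAddCommGroup F] [InnerProductSpace ℝ F] [FiniteDimensional ℝ F]

/-- Radial projection to the unit sphere. -/
noncomputable def nu (x : E) : E := ‖x‖⁻¹ • x

lemma nu_contOn : ContinuousOn (nu : E → E) {x | x ≠ 0} := by
  unfold nu
  exact (continuous_norm.continuousOn.inv₀ (fun x hx => norm_ne_zero_iff.2 hx)).smul continuousOn_id

lemma nu_mem {x : E} (hx : x ≠ 0) : nu x ∈ sphere (0:E) 1 := by
  simp [nu, norm_smul, norm_ne_zero_iff.2 hx]

lemma nu_eq {x : E} (hx : x ∈ sphere (0:E) 1) : nu x = x := by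
  have : ‖x‖ = 1 := by simpa using hx
  simp [nu, this]

lemma nu_smul (x : E) : ‖x‖ • nu x = x := by
  by_cases h : x = 0
  · simp [h]
  · simp [nu, smul_smul, norm_ne_zero_iff.2 h]

lemma sph_ne {x : E} (hx : x ∈ sphere (0:E) 1) : x ≠ 0 := by
  rintro rfl
  simp at hx

lemma nu_preimage_open {V : Set E} (hV : IsOpen V) : IsOpen ({x : E | x ≠ 0} ∩ nu ⁻¹' V) :=
  nu_contOn.isOpen_inter_preimage isOpen_ne hV

lemma inj_open_sphere (hd : Module.finrank ℝ F + 1 = Module.finrank ℝ E) (U : Set F)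
    (hU : IsOpen U) (g : F → E) (hg : ContinuousOn g U) (hi : InjOn g U)
    (hS : ∀ x ∈ U, g x ∈ sphere (0:E) 1) :
    ∃ W : Set E, IsOpen W ∧ g '' U = W ∩ sphere (0:E) 1 := by
  have e : E ≃ₗ[ℝ] F × ℝ := LinearEquiv.ofFinrankEq _ _ (by simp [Module.finrank_prod, hd])
  have hec : Continuous e := e.toLinearMap.continuous_of_finiteDimensional
  have hn : ∀ x ∈ U, ‖g x‖ = 1 := fun x hx => by simpa using hS x hx
  refine ⟨(fun x => Real.exp (e x).2 • g (e x).1) '' {x | (e x).1 ∈ U}, ?_, ?_⟩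
  · apply inv_domain
    · exact hU.preimage (continuous_fst.comp hec)
    · refine ContinuousOn.smul (by fun_prop) ?_
      exact hg.comp (continuous_fst.comp hec).continuousOn (fun x hx => hx)
    · intro x hx y hy hxy
      simp only at hxy
      have h1 := congrArg norm hxy
      rw [norm_smul, norm_smul, hn _ hx, hn _ hy] at h1
      simp only [Real.norm_eq_abs, Real.abs_exp, mul_one] at h1
      have h2 := Real.exp_injective h1
      rw [h1] at hxy
      have h3 := hi hx hy (smul_right_injective E (Real.exp_pos _).ne' hxy)
      exact e.injective (Prod.ext h3 h2)
  · ext z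
    constructor
    · rintro ⟨x, hx, rfl⟩
      exact ⟨⟨e.symm (x, 0), by simpa using hx, by simp⟩, hS x hx⟩
    · rintro ⟨⟨x, hx, rfl⟩, hz⟩
      have hz : ‖Real.exp (e x).2 • g (e x).1‖ = 1 := by simpa using hz
      rw [norm_smul, hn _ hx, mul_one, Real.norm_eq_abs, Real.abs_exp] at hz
      exact ⟨(e x).1, hx, by simp [hz]⟩

lemma chart_open (hd : Module.finrank ℝ F + 1 ≤ Module.finrank ℝ E) (V : Set E)
    (hV : IsOpen V) (hne : (V ∩ sphere (0:E) 1).Nonempty) (h : E → F)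
    (hc : ContinuousOn h (V ∩ sphere 0 1)) (hi : InjOn h (V ∩ sphere 0 1)) :
    Module.finrank ℝ F + 1 = Module.finrank ℝ E ∧ IsOpen (h '' (V ∩ sphere 0 1)) := by
  obtain ⟨ι, hι⟩ : ∃ ι : F × ℝ →ₗ[ℝ] E, Function.Injective ι := by
    rcases hd.eq_or_lt with hd | hd
    · have e : (F × ℝ) ≃ₗ[ℝ] E := LinearEquiv.ofFinrankEq _ _ (by
        rw [Module.finrank_prod, Module.finrank_self, hd])
      exact ⟨e.toLinearMap, e.injective⟩
    · apply Module.Free.exists_linearMap_injective_of_rank_lt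
      rw [← Module.finrank_eq_rank, ← Module.finrank_eq_rank, Module.finrank_prod,
        Module.finrank_self]
      exact_mod_cast hd
  have hιc : Continuous ι := ι.continuous_of_finiteDimensional
  have hmaps : MapsTo nu ({x : E | x ≠ 0} ∩ nu ⁻¹' V) (V ∩ sphere 0 1) :=
    fun x hx => ⟨hx.2, nu_mem hx.1⟩
  have hopen : IsOpen ((fun x : E => ι (h (nu x), ‖x‖)) '' ({x : E | x ≠ 0} ∩ nu ⁻¹' V)) := by
    apply inv_domain _ _ (nu_preimage_open hV)
    · refine hιc.comp_continuousOn (ContinuousOn.prodMk ?_ continuous_norm.continuousOn)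
      exact hc.comp (nu_contOn.mono inter_subset_left) hmaps
    · intro x hx y hy hxy
      have h1 := hι hxy
      rw [Prod.mk.injEq] at h1
      have h2 := hi (hmaps hx) (hmaps hy) h1.1
      rw [← nu_smul x, ← nu_smul y, h2, h1.2]
  constructor
  · have htop : LinearMap.range ι = ⊤ := by
      apply Submodule.eq_top_of_nonempty_interior'
      obtain ⟨x, hx⟩ := hne
      refine ⟨ι (h (nu x), ‖x‖), ?_⟩
      refine mem_interior.2 ⟨_, ?_, hopen, ⟨x, ⟨sph_ne hx.2, ?_⟩, rfl⟩⟩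
      · rintro _ ⟨z, -, rfl⟩
        exact ⟨_, rfl⟩
      · simpa [nu_eq hx.2] using hx.1
    have h1 := LinearMap.finrank_range_of_inj hι
    rw [htop, finrank_top, Module.finrank_prod, Module.finrank_self] at h1
    exact h1.symm
  · have : h '' (V ∩ sphere 0 1) = (fun x => ι (x, 1)) ⁻¹'
        ((fun x : E => ι (h (nu x), ‖x‖)) '' ({x : E | x ≠ 0} ∩ nu ⁻¹' V)) := by
      ext z
      constructor
      · rintro ⟨x, hx, rfl⟩
        refine ⟨x, ⟨sph_ne hx.2, ?_⟩, ?_⟩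
        · simpa [nu_eq hx.2] using hx.1
        · have : ‖x‖ = 1 := by simpa using hx.2
          simp [nu_eq hx.2, this]
      · rintro ⟨x, hx, hxz⟩
        have h1 := hι hxz
        rw [Prod.mk.injEq] at h1
        exact ⟨nu x, hmaps hx, h1.1⟩
    rw [this]
    exact hopen.preimage (hιc.comp (by fun_prop))

lemma boundary_not_nhd (hd : Module.finrank ℝ F + 1 = Module.finrank ℝ E) (g : F → E)
    (hg : ContinuousOn g (closedBall 0 1)) (hi : InjOn g (closedBall 0 1))
    (b : F) (hb : b ∈ sphere (0:F) 1) (hbS : g b ∈ sphere (0:E) 1) (W : Set E) (hW : IsOpen W)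
    (hbW : g b ∈ W) (hsub : W ∩ sphere 0 1 ⊆ g '' closedBall 0 1) : False := by
  obtain ⟨G, hGc, hG⟩ := tietze_factor (isCompact_closedBall (0:F) 1) hg hi
    (l := fun x => x) continuousOn_id
  have hinj : InjOn G (W ∩ sphere 0 1) := by
    intro x hx y hy hxy
    obtain ⟨x', hx', rfl⟩ := hsub hx
    obtain ⟨y', hy', rfl⟩ := hsub hy
    rw [hG _ hx', hG _ hy'] at hxy
    rw [hxy]
  have h1 := (chart_open hd.le W hW ⟨g b, hbW, hbS⟩ G hGc.continuousOn hinj).2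
  have h2 : G '' (W ∩ sphere 0 1) ⊆ interior (closedBall 0 1) := by
    refine interior_maximal ?_ h1
    rintro _ ⟨x, hx, rfl⟩
    obtain ⟨x', hx', rfl⟩ := hsub hx
    rwa [hG _ hx']
  have h3 : b ∈ interior (closedBall (0:F) 1) :=
    h2 ⟨g b, ⟨hbW, hbS⟩, hG b (sphere_subset_closedBall hb)⟩
  rw [interior_closedBall _ one_ne_zero] at h3
  simp at h3 hb
  linarith

lemma two_sheets {F₂ : Type} [NormedAddCommGroup F₂] [InnerProductSpace ℝ F₂]
    [FiniteDimensional ℝ F₂] (hd : Module.finrank ℝ F + 1 = Module.finrank ℝ E)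
    (g₁ : F → E) (hg₁ : ContinuousOn g₁ (closedBall 0 1)) (hi₁ : InjOn g₁ (closedBall 0 1))
    (hS₁ : ∀ x ∈ closedBall (0:F) 1, g₁ x ∈ sphere (0:E) 1)
    (g₂ : F₂ → E) (hg₂ : ContinuousOn g₂ (closedBall 0 1)) (hi₂ : InjOn g₂ (closedBall 0 1))
    (hS₂ : ∀ x ∈ closedBall (0:F₂) 1, g₂ x ∈ sphere (0:E) 1)
    (hdis : ∀ x ∈ closedBall (0:F) 1, ∀ y ∈ ball (0:F₂) 1, g₁ x ≠ g₂ y)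
    (W : Set F) (hW : IsOpen W) (b : F) (hb : b ∈ sphere (0:F) 1) (hbW : b ∈ W)
    (hD : ∀ x ∈ W ∩ sphere (0:F) 1, ∃ y ∈ sphere (0:F₂) 1, g₂ y = g₁ x) :
    ∃ V : Set E, IsOpen V ∧ g₁ b ∈ V ∧
      V ∩ sphere 0 1 ⊆ g₁ '' closedBall 0 1 ∪ g₂ '' closedBall 0 1 := by
  classical
  obtain ⟨G, hGc, hG⟩ := tietze_factor (isCompact_closedBall (0:F₂) 1) hg₂ hi₂
    (l := fun x => x) continuousOn_id
  have hk : ∀ x ∈ W ∩ sphere (0:F) 1, G (g₁ x) ∈ sphere (0:F₂) 1 ∧ g₂ (G (g₁ x)) = g₁ x := by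
    intro x hx
    obtain ⟨y, hy, hyx⟩ := hD x hx
    rw [← hyx, hG _ (sphere_subset_closedBall hy)]
    exact ⟨hy, rfl⟩
  let U : Set F := ({x : F | x ≠ 0} ∩ nu ⁻¹' W) ∩ ball 0 2
  have hUo : IsOpen U := (nu_preimage_open hW).inter isOpen_ball
  have hUnu : ∀ x ∈ U, nu x ∈ W ∩ sphere (0:F) 1 := fun x hx => ⟨hx.1.2, nu_mem hx.1.1⟩
  have hU2 : ∀ x ∈ U, ‖x‖ < 2 := fun x hx => by simpa using hx.2
  let q : F → F₂ := fun x => (2 - ‖x‖) • G (g₁ (nu x))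
  have hqc : ContinuousOn q U := by
    refine ContinuousOn.smul (by fun_prop) (hGc.comp_continuousOn ?_)
    refine hg₁.comp (nu_contOn.mono (fun x hx => hx.1.1)) ?_
    exact fun x hx => sphere_subset_closedBall (hUnu x hx).2
  have hqn : ∀ x ∈ U, ‖q x‖ = 2 - ‖x‖ := by
    intro x hx
    have h1 : ‖G (g₁ (nu x))‖ = 1 := by simpa using (hk _ (hUnu x hx)).1
    simp only [q, norm_smul, h1, mul_one, Real.norm_eq_abs]
    exact abs_of_pos (by linarith [hU2 x hx])
  have hqm : ∀ x ∈ U, 1 ≤ ‖x‖ → q x ∈ closedBall (0:F₂) 1 := by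
    intro x hx h
    simp [hqn x hx]; linarith
  have hqi : ∀ x ∈ U, ∀ y ∈ U, q x = q y → x = y := by
    intro x hx y hy hxy
    have h1 : ‖x‖ = ‖y‖ := by
      have := congrArg norm hxy
      rw [hqn x hx, hqn y hy] at this
      linarith
    have h2 : G (g₁ (nu x)) = G (g₁ (nu y)) := by
      simp only [q, h1] at hxy
      exact smul_right_injective _ (by linarith [hU2 y hy] : (2 - ‖y‖) ≠ 0) hxy
    have h3 : g₁ (nu x) = g₁ (nu y) := by
      rw [← (hk _ (hUnu x hx)).2, h2, (hk _ (hUnu y hy)).2]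
    have h4 := hi₁ (sphere_subset_closedBall (hUnu x hx).2) (sphere_subset_closedBall (hUnu y hy).2) h3
    rw [← nu_smul x, ← nu_smul y, h4, h1]
  let Ψ : F → E := fun x => if ‖x‖ ≤ 1 then g₁ x else g₂ (q x)
  have hΨ1 : ∀ x, ‖x‖ ≤ 1 → Ψ x = g₁ x := fun x hx => by simp [Ψ, hx]
  have hΨ2 : ∀ x ∈ U, 1 ≤ ‖x‖ → Ψ x = g₂ (q x) := by
    intro x hx h
    rcases h.eq_or_lt with h | h
    · have hxs : x ∈ sphere (0:F) 1 := by simp [← h]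
      rw [hΨ1 x h.ge]
      have h5 := (hk _ (hUnu x hx)).2
      rw [nu_eq hxs] at h5
      simp only [q, ← h, nu_eq hxs]
      norm_num
      exact h5.symm
    · simp [Ψ, not_le.2 h]
  have hΨc : ContinuousOn Ψ U := by
    have c1 : ContinuousOn Ψ (U ∩ {x | ‖x‖ ≤ 1}) := by
      refine (hg₁.mono ?_).congr (fun x hx => hΨ1 x hx.2)
      intro x hx
      simpa using hx.2
    have c2 : ContinuousOn Ψ (U ∩ {x | 1 ≤ ‖x‖}) := by
      refine ContinuousOn.congr ?_ (fun x hx => hΨ2 x hx.1 hx.2)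
      exact hg₂.comp (hqc.mono inter_subset_left) (fun x hx => hqm x hx.1 hx.2)
    intro x hx
    have hcl1 : IsClosed {x : F | ‖x‖ ≤ 1} := isClosed_le continuous_norm continuous_const
    have hcl2 : IsClosed {x : F | 1 ≤ ‖x‖} := isClosed_le continuous_const continuous_norm
    have hU' : U = (U ∩ {x | ‖x‖ ≤ 1}) ∪ (U ∩ {x | 1 ≤ ‖x‖}) := by
      rw [← inter_union_distrib_left]
      refine (inter_eq_left.2 ?_).symm
      intro y _
      exact le_total ‖y‖ 1
    rw [hU']
    refine ContinuousWithinAt.union ?_ ?_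
    · by_cases h : ‖x‖ ≤ 1
      · exact c1 x ⟨hx, h⟩
      · apply continuousWithinAt_of_notMem_closure
        intro hh
        exact h (closure_minimal inter_subset_right hcl1 hh)
    · by_cases h : 1 ≤ ‖x‖
      · exact c2 x ⟨hx, h⟩
      · apply continuousWithinAt_of_notMem_closure
        intro hh
        exact h (closure_minimal inter_subset_right hcl2 hh)
  have hcross : ∀ x ∈ U, ∀ y ∈ U, ‖x‖ ≤ 1 → 1 < ‖y‖ → Ψ x ≠ Ψ y := by
    intro x hx y hy hx1 hy1
    rw [hΨ1 x hx1, hΨ2 y hy hy1.le]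
    refine hdis x (by simpa using hx1) _ ?_
    simp [hqn y hy]; linarith
  have hΨi : InjOn Ψ U := by
    intro x hx y hy hxy
    rcases le_or_gt ‖x‖ 1 with h1 | h1 <;> rcases le_or_gt ‖y‖ 1 with h2 | h2
    · rw [hΨ1 x h1, hΨ1 y h2] at hxy
      exact hi₁ (by simpa using h1) (by simpa using h2) hxy
    · exact absurd hxy (hcross x hx y hy h1 h2)
    · exact absurd hxy.symm (hcross y hy x hx h2 h1)
    · rw [hΨ2 x hx h1.le, hΨ2 y hy h2.le] at hxy
      exact hqi x hx y hy (hi₂ (hqm x hx h1.le) (hqm y hy h2.le) hxy)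
  have hΨm : ∀ x ∈ U, Ψ x ∈ g₁ '' closedBall 0 1 ∪ g₂ '' closedBall 0 1 := by
    intro x hx
    rcases le_total ‖x‖ 1 with h | h
    · left
      exact ⟨x, by simpa using h, (hΨ1 x h).symm⟩
    · right
      exact ⟨q x, hqm x hx h, (hΨ2 x hx h).symm⟩
  obtain ⟨V, hVo, hV⟩ := inj_open_sphere hd U hUo Ψ hΨc hΨi (by
    intro x hx
    rcases hΨm x hx with ⟨z, hz, h⟩ | ⟨z, hz, h⟩
    · rw [← h]; exact hS₁ z hz
    · rw [← h]; exact hS₂ z hz)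
  have hbn : ‖b‖ = 1 := by simpa using hb
  refine ⟨V, hVo, ?_, ?_⟩
  · have : Ψ b ∈ Ψ '' U := ⟨b, ⟨⟨sph_ne hb, by simpa [nu_eq hb] using hbW⟩, by simp [hbn]⟩, rfl⟩
    rw [hV, hΨ1 b hbn.le] at this
    exact this.1
  · rw [← hV]
    rintro _ ⟨x, hx, rfl⟩
    exact hΨm x hx

lemma sphere_nonsep (hdim : Module.finrank ℝ F + 3 ≤ Module.finrank ℝ E)
    (A : Set E) (hA : IsClosed A) (j : E → F) (hj : ContinuousOn j A)
    (hji : InjOn j A) (V₁ V₂ W : Set E) (hV₁ : IsOpen V₁) (hV₂ : IsOpen V₂) (hW : IsOpen W)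
    (hV : ∀ x ∈ sphere (0:E) 1, x ∈ V₁ → x ∉ V₂)
    (hcov : W ∩ sphere (0:E) 1 ⊆ A ∪ (V₁ ∪ V₂)) (y : E) (hy : y ∈ sphere (0:E) 1) (hyW : y ∈ W)
    (h1 : y ∈ closure ((V₁ ∩ sphere 0 1) \ A)) (h2 : y ∈ closure ((V₂ ∩ sphere 0 1) \ A)) :
    False := by
  have hyn : ‖y‖ = 1 := by simpa using hy
  obtain ⟨r, hr, hball⟩ := Metric.nhds_basis_closedBall.mem_iff.1
    ((nu_preimage_open hW).mem_nhds ⟨sph_ne hy, by simpa [nu_eq hy] using hyW⟩)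
  have hne : ∀ x ∈ closedBall y r, x ≠ 0 := fun x hx => (hball hx).1
  obtain ⟨p, hp, hpy⟩ := Metric.mem_closure_iff.1 h1 r hr
  obtain ⟨q, hq, hqy⟩ := Metric.mem_closure_iff.1 h2 r hr
  have hnuc : ContinuousOn nu (closedBall y r) := nu_contOn.mono hne
  refine local_nonsep (F := F × ℝ) (by simp [Module.finrank_prod]; omega) y r
    (closedBall y r ∩ nu ⁻¹' A) ?_ (fun x => (j (nu x), ‖x‖)) ?_ ?_
    ({x : E | x ≠ 0} ∩ nu ⁻¹' V₁) ({x : E | x ≠ 0} ∩ nu ⁻¹' V₂)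
    (nu_preimage_open hV₁) (nu_preimage_open hV₂) ?_ ?_ p q
    ⟨sph_ne hp.1.2, by simpa [nu_eq hp.1.2] using hp.1.1⟩
    ⟨sph_ne hq.1.2, by simpa [nu_eq hq.1.2] using hq.1.1⟩
    (by rwa [mem_ball']) (by rwa [mem_ball']) ?_ ?_
  · exact (isCompact_closedBall y r).of_isClosed_subset
      (hnuc.preimage_isClosed_of_isClosed isClosed_closedBall hA) inter_subset_left
  · exact ContinuousOn.prodMk (hj.comp (hnuc.mono inter_subset_left) (fun x hx => hx.2))
      continuous_norm.continuousOn
  · intro x hx z hz hxz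
    rw [Prod.mk.injEq] at hxz
    have := hji hx.2 hz.2 hxz.1
    rw [← nu_smul x, ← nu_smul z, this, hxz.2]
  · rw [Set.disjoint_left]
    intro x hx hx'
    exact hV _ (nu_mem hx.1) hx.2 hx'.2
  · intro x hx
    rcases hcov ⟨(hball hx).2, nu_mem (hne x hx)⟩ with h | h | h
    · exact Or.inl ⟨hx, h⟩
    · exact Or.inr (Or.inl ⟨hne x hx, h⟩)
    · exact Or.inr (Or.inr ⟨hne x hx, h⟩)
  · intro h
    have := h.2
    rw [mem_preimage, nu_eq hp.1.2] at this
    exact hp.2 this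
  · intro h
    have := h.2
    rw [mem_preimage, nu_eq hq.1.2] at this
    exact hq.2 this

end Sph
section CW

lemma cell_nonempty (K : FiniteCWComplex X) (α : K.ι) : (K.cell α).Nonempty := by
  rw [← K.image_interior α]
  exact ⟨_, 0, by simp, rfl⟩

lemma exists_cell (K : FiniteCWComplex X) (x : X) : ∃ α, x ∈ K.cell α := by
  have : x ∈ ⋃ α, K.cell α := by rw [K.cells_cover]; trivial
  simpa using this

lemma cell_unique (K : FiniteCWComplex X) {x : X} {α β : K.ι} (h : x ∈ K.cell α)
    (h' : x ∈ K.cell β) : α = β := by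
  by_contra hne
  exact Set.disjoint_left.1 (K.cells_disjoint α β hne) h h'

lemma f_mem_cell (K : FiniteCWComplex X) (α : K.ι) {x} (hx : x ∈ ball 0 1) :
    K.f α x ∈ K.cell α := by
  rw [← K.image_interior α]
  exact ⟨x, hx, rfl⟩

lemma f_mem_closure (K : FiniteCWComplex X) (α : K.ι) {x} (hx : x ∈ closedBall 0 1) :
    K.f α x ∈ closure (K.cell α) := by
  rw [← K.image_closedBall α]
  exact ⟨x, hx, rfl⟩

lemma f_sphere (K : FiniteCWComplex X) {α β : K.ι} {x} (hx : x ∈ sphere 0 1)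
    (h : K.f α x ∈ K.cell β) : cellLE K β α ∧ K.dim β < K.dim α := by
  obtain ⟨s, hs, hs'⟩ := K.boundary_cells α
  have h1 : K.f α x ∈ ⋃ β ∈ s, K.cell β := by rw [← hs']; exact ⟨x, hx, rfl⟩
  simp only [mem_iUnion, exists_prop] at h1
  obtain ⟨γ, hγ, hxγ⟩ := h1
  obtain rfl := cell_unique K h hxγ
  refine ⟨?_, hs _ hγ⟩
  intro z hz
  have h2 : z ∈ K.f α '' sphere 0 1 := by
    rw [hs']
    simp only [mem_iUnion, exists_prop]
    exact ⟨_, hγ, hz⟩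
  rw [← K.image_closedBall α]
  exact image_mono sphere_subset_closedBall h2

lemma cle_refl (K : FiniteCWComplex X) (α : K.ι) : cellLE K α α := subset_closure

lemma cle_trans (K : FiniteCWComplex X) {α β γ : K.ι} (h : cellLE K α β) (h' : cellLE K β γ) :
    cellLE K α γ := h.trans (closure_minimal h' isClosed_closure)

lemma ball_or_sphere {E : Type} [NormedAddCommGroup E] {x : E} (hx : x ∈ closedBall (0:E) 1) :
    x ∈ ball (0:E) 1 ∨ x ∈ sphere (0:E) 1 := by
  rw [← ball_union_sphere] at hx
  exact hx

lemma cle_of_meet (K : FiniteCWComplex X) {ρ α : K.ι} {x : X} (h : x ∈ K.cell ρ)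
    (h' : x ∈ closure (K.cell α)) : cellLE K ρ α := by
  rw [← K.image_closedBall α] at h'
  obtain ⟨z, hz, rfl⟩ := h'
  rcases ball_or_sphere hz with hz | hz
  · rw [cell_unique K h (f_mem_cell K α hz)]
    exact cle_refl K α
  · exact (f_sphere K hz h).1

lemma cle_exists (K : FiniteCWComplex X) {ρ α : K.ι} (h : cellLE K ρ α) (hne : ρ ≠ α) {z : X}
    (hz : z ∈ K.cell ρ) : ∃ x ∈ sphere 0 1, K.f α x = z := by
  have h' := h hz
  rw [← K.image_closedBall α] at h'
  obtain ⟨x, hx, rfl⟩ := h'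
  rcases ball_or_sphere hx with hx | hx
  · exact absurd (cell_unique K hz (f_mem_cell K α hx)) hne
  · exact ⟨x, hx, rfl⟩

lemma cle_dim (K : FiniteCWComplex X) {ρ α : K.ι} (h : cellLE K ρ α) (hne : ρ ≠ α) :
    K.dim ρ < K.dim α := by
  obtain ⟨z, hz⟩ := cell_nonempty K ρ
  obtain ⟨x, hx, rfl⟩ := cle_exists K h hne hz
  exact (f_sphere K hx hz).2

lemma cle_eq (K : FiniteCWComplex X) {ρ α : K.ι} (h : cellLE K ρ α) (hd : K.dim α ≤ K.dim ρ) :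
    ρ = α := by
  by_contra hne
  exact absurd (cle_dim K h hne) (not_lt.2 hd)

lemma cle_dimle (K : FiniteCWComplex X) {ρ α : K.ι} (h : cellLE K ρ α) : K.dim ρ ≤ K.dim α := by
  by_cases hne : ρ = α
  · rw [hne]
  · exact (cle_dim K h hne).le

/-- Open star of a cell. -/
def ostar (K : FiniteCWComplex X) (σ : K.ι) : Set X := {x | ∃ ρ, cellLE K σ ρ ∧ x ∈ K.cell ρ}

lemma ostar_open (K : FiniteCWComplex X) (σ : K.ι) : IsOpen (ostar K σ) := by
  have := K.finite_ι
  have h : ostar K σ = (⋃ ρ ∈ {ρ | ¬ cellLE K σ ρ}, closure (K.cell ρ))ᶜ := by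
    ext x
    simp only [ostar, mem_compl_iff, mem_iUnion, not_exists]
    constructor
    · rintro ⟨ρ, h, hx⟩ τ hτ hx'
      exact hτ (cle_trans K h (cle_of_meet K hx hx'))
    · intro h
      obtain ⟨ρ, hρ⟩ := exists_cell K x
      refine ⟨ρ, ?_, hρ⟩
      by_contra hn
      exact h ρ hn (subset_closure hρ)
  rw [h]
  exact ((Set.toFinite _).isClosed_biUnion (fun _ _ => isClosed_closure)).isOpen_compl

lemma cw_compact (K : FiniteCWComplex X) : CompactSpace X := by
  have := K.finite_ι
  constructor
  have : (univ : Set X) = ⋃ α, K.f α '' closedBall 0 1 := by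
    refine (eq_univ_of_forall fun x => ?_).symm
    obtain ⟨α, hα⟩ := exists_cell K x
    rw [mem_iUnion]
    refine ⟨α, ?_⟩
    rw [K.image_closedBall]
    exact subset_closure hα
  rw [this]
  exact isCompact_iUnion fun α => (isCompact_closedBall _ _).image_of_continuousOn (K.f_cont α)

/-- Relatively open preimages. -/
lemma pre_open (K : FiniteCWComplex X) (α : K.ι) {t : Set X} (ht : IsOpen t) :
    ∃ u, IsOpen u ∧ ∀ x ∈ closedBall 0 1, (x ∈ u ↔ K.f α x ∈ t) := by
  obtain ⟨u, hu, h⟩ := continuousOn_iff'.1 (K.f_cont α) t ht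
  refine ⟨u, hu, fun x hx => ?_⟩
  have := Set.ext_iff.1 h x
  simp only [mem_inter_iff, mem_preimage, hx, and_true] at this
  exact this.symm

lemma injOn_ball (K : FiniteCWComplex X) (α : K.ι) : InjOn (K.f α) (ball 0 1) :=
  Set.injOn_iff_injective.2 (K.interior_embedding α).injective

lemma injOn_closedBall (K : FiniteCWComplex X) (α : K.ι) (h : InjOn (K.f α) (sphere 0 1)) :
    InjOn (K.f α) (closedBall 0 1) := by
  have key : ∀ x ∈ ball 0 1, ∀ y ∈ sphere 0 1, K.f α x ≠ K.f α y := by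
    intro x hx y hy hxy
    have h1 := f_mem_cell K α hx
    rw [hxy] at h1
    exact absurd (f_sphere K hy h1).2 (lt_irrefl _)
  intro x hx y hy hxy
  rcases ball_or_sphere hx with hx | hx <;> rcases ball_or_sphere hy with hy | hy
  · exact injOn_ball K α hx hy hxy
  · exact absurd hxy (key x hx y hy)
  · exact absurd hxy.symm (key y hy x hx)
  · exact h hx hy hxy

/-- Maps of balls obtained from condition 5 land in the sphere. -/
lemma cond5_sphere (K : FiniteCWComplex X) (h5 : Cond5 K) {τ α : K.ι} (h : cellLE K τ α)
    (hne : τ ≠ α) :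
    ∃ g : EuclideanSpace ℝ (Fin (K.dim τ)) → EuclideanSpace ℝ (Fin (K.dim α)),
      ContinuousOn g (closedBall 0 1) ∧ InjOn g (closedBall 0 1) ∧
      (∀ x ∈ closedBall (0 : EuclideanSpace ℝ (Fin (K.dim τ))) 1, g x ∈ sphere 0 1) ∧
      ∀ x ∈ closedBall (0 : EuclideanSpace ℝ (Fin (K.dim τ))) 1, K.f τ x = K.f α (g x) := by
  obtain ⟨g, hc, hi, hm, hg⟩ := h5 τ α h
  refine ⟨g, hc, hi, fun x hx => ?_, hg⟩
  rcases ball_or_sphere (hm ⟨x, hx, rfl⟩) with h1 | h1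
  · exfalso
    have h2 := f_mem_cell K α h1
    rw [← hg x hx] at h2
    have h3 := cle_of_meet K h2 (f_mem_closure K τ hx)
    have := cle_dimle K h3
    have := cle_dim K h hne
    omega
  · exact h1

lemma coatom_near (K : FiniteCWComplex X) (h2 : Cond2 K) {σ α : K.ι} {y} (hy : y ∈ sphere 0 1)
    (hyσ : K.f α y ∈ K.cell σ) : ∃ τ, cellLE K σ τ ∧ cellLE K τ α ∧ K.dim τ + 1 = K.dim α := by
  obtain ⟨u, hu, hu'⟩ := pre_open K α (ostar_open K σ)
  have hyu : y ∈ u := (hu' y (sphere_subset_closedBall hy)).2 ⟨σ, cle_refl K σ, hyσ⟩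
  obtain ⟨x, hxu, hxS, hx⟩ := mem_closure_iff.1 (h2 α hy) u hu hyu
  simp only [mem_preimage, mem_iUnion, exists_prop] at hx
  obtain ⟨τ, hτ, hxτ⟩ := hx
  obtain ⟨ρ, hρ, hxρ⟩ := (hu' x (sphere_subset_closedBall hxS)).1 hxu
  obtain rfl := cell_unique K hxτ hxρ
  exact ⟨τ, hρ, (f_sphere K hxS hxτ).1, hτ⟩

lemma exists_coatom (K : FiniteCWComplex X) (h2 : Cond2 K) {σ α : K.ι} (h : cellLE K σ α)
    (hne : σ ≠ α) : ∃ τ, cellLE K σ τ ∧ cellLE K τ α ∧ K.dim τ + 1 = K.dim α := by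
  obtain ⟨z, hz⟩ := cell_nonempty K σ
  obtain ⟨y, hy, rfl⟩ := cle_exists K h hne hz
  exact coatom_near K h2 hy hz

end CW


section Rev

/-- Strong connectivity of the coatoms over a cell. -/
lemma strong_conn (K : FiniteCWComplex X) (h2 : Cond2 K) (h3 : Cond3 K) (α : K.ι)
    (P : K.ι → Prop) (n : ℕ) : ∀ σ : K.ι, K.dim α = K.dim σ + n → 2 ≤ n → 
    (∀ τ₁ τ₂ ρ, cellLE K τ₁ α → K.dim τ₁ + 1 = K.dim α → cellLE K τ₂ α →
      K.dim τ₂ + 1 = K.dim α → cellLE K σ ρ → K.dim ρ + 2 = K.dim α → cellLE K ρ τ₁ →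
      cellLE K ρ τ₂ → P τ₁ → P τ₂) →
    ∀ τ τ', cellLE K σ τ → cellLE K σ τ' → cellLE K τ α → cellLE K τ' α →
      K.dim τ + 1 = K.dim α → K.dim τ' + 1 = K.dim α → P τ → P τ' := by
  induction n using Nat.strong_induction_on with
  | _ n ih =>
  intro σ hn hn2 hP τ τ' hστ hστ' hτ hτ' hdτ hdτ' hPτ
  rcases hn2.eq_or_lt with hn2 | hn2
  · exact hP τ τ' σ hτ hdτ hτ' hdτ' (cle_refl K σ) (by omega) hστ hστ' hPτ
  have claim : ∀ β, cellLE K σ β → β ≠ σ → cellLE K β α → β ≠ α → ∀ τ₁ τ₂, cellLE K β τ₁ →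
      cellLE K β τ₂ → cellLE K τ₁ α → cellLE K τ₂ α → K.dim τ₁ + 1 = K.dim α →
      K.dim τ₂ + 1 = K.dim α → P τ₁ → P τ₂ := by
    intro β hσβ hβσ hβα hβα' τ₁ τ₂ h1 h2 h1' h2' hd1 hd2 hp
    have hd := cle_dim K hσβ hβσ.symm
    have hd' := cle_dim K hβα hβα'
    by_cases hc : K.dim β + 1 = K.dim α
    · have e1 := cle_eq K h1 (by omega)
      have e2 := cle_eq K h2 (by omega)
      rw [← e2, e1]; exact hp
    · refine ih (K.dim α - K.dim β) (by omega) β (by omega) (by omega) ?_ τ₁ τ₂ h1 h2 h1' h2'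
        hd1 hd2 hp
      intro t1 t2 ρ a1 a2 a3 a4 a5
      exact hP t1 t2 ρ a1 a2 a3 a4 (cle_trans K hσβ a5)
  let Q : Option K.ι → Prop := fun z => ∃ β, z = some β ∧
    ∃ t, cellLE K β t ∧ cellLE K t α ∧ K.dim t + 1 = K.dim α ∧ P t
  have hne : ∀ t, K.dim t + 1 = K.dim α → (some t : Option K.ι) ≠ some σ ∧ some t ≠ some α := by
    intro t ht
    constructor
    · rintro h; obtain rfl := Option.some.inj h; omega
    · rintro h; obtain rfl := Option.some.inj h; omega
  have hσα : cellLE K σ α := cle_trans K hστ hτ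
  have hconn := h3.2 (some σ) (some α) hσα (by simp only [posetRank]; omega) (some τ)
    ⟨hστ, hτ, (hne τ hdτ).1, (hne τ hdτ).2⟩ (some τ') ⟨hστ', hτ', (hne τ' hdτ').1, (hne τ' hdτ').2⟩
  have hQ : Q (some τ') := by
    refine Relation.ReflTransGen.rec (motive := fun z _ => Q z) ?_ ?_ hconn
    · exact ⟨τ, rfl, τ, cle_refl K τ, hτ, hdτ, hPτ⟩
    · rintro b c - ⟨hb, hc, hbc⟩ ⟨β, rfl, t, hβt, htα, hdt, hPt⟩
      obtain ⟨hb1, hb2, hb3, hb4⟩ := hb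
      obtain ⟨hc1, hc2, hc3, hc4⟩ := hc
      cases c with
      | none => exact absurd hc1 (by simp [posetLE])
      | some γ =>
        refine ⟨γ, rfl, ?_⟩
        rcases hbc with hbc | hbc
        · obtain ⟨t', ht1, ht2, ht3⟩ := exists_coatom K h2 (σ := γ) (α := α) hc2
            (fun h => hc4 (by rw [h]))
          refine ⟨t', ht1, ht2, ht3, ?_⟩
          exact claim β hb1 (fun h => hb3 (by rw [h])) hb2 (fun h => hb4 (by rw [h])) t t' hβt
            (cle_trans K hbc ht1) htα ht2 hdt ht3 hPt
        · exact ⟨t, cle_trans K hbc hβt, htα, hdt, hPt⟩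
  obtain ⟨β, hβ, t, hβt, htα, hdt, hPt⟩ := hQ
  obtain rfl := Option.some.inj hβ
  have := cle_eq K hβt (by omega)
  rw [this]; exact hPt

lemma thin_two (K : FiniteCWComplex X) (h3 : Cond3 K) {ρ α τ τ' τ'' : K.ι}
    (hd : K.dim ρ + 2 = K.dim α) (h1 : cellLE K ρ τ) (h1' : cellLE K τ α)
    (h2 : cellLE K ρ τ') (h2' : cellLE K τ' α) (h4 : cellLE K ρ τ'') (h4' : cellLE K τ'' α)
    (hd1 : K.dim τ + 1 = K.dim α) (hd2 : K.dim τ' + 1 = K.dim α) (hd3 : K.dim τ'' + 1 = K.dim α)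
    (hne : τ ≠ τ') : τ'' = τ ∨ τ'' = τ' := by
  classical
  have := K.finite_ι
  by_contra hcon
  push Not at hcon
  have hc := h3.1 (some ρ) (some α) (cle_trans K h1 h1') (by simp only [posetRank]; omega)
  have hsub : ((({ρ, α, τ, τ', τ''} : Finset K.ι).image some : Finset (Option K.ι)) :
      Set (Option K.ι)) ⊆ {z | posetLE K (some ρ) z ∧ posetLE K z (some α)} := by
    intro z hz
    simp only [Finset.coe_image, Finset.coe_insert, Finset.coe_singleton, mem_image,
      mem_insert_iff, mem_singleton_iff] at hz
    obtain ⟨t, ht, rfl⟩ := hz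
    rcases ht with rfl | rfl | rfl | rfl | rfl
    · exact ⟨cle_refl K _, cle_trans K h1 h1'⟩
    · exact ⟨cle_trans K h1 h1', cle_refl K _⟩
    · exact ⟨h1, h1'⟩
    · exact ⟨h2, h2'⟩
    · exact ⟨h4, h4'⟩
  have hle := Set.ncard_le_ncard hsub (Set.toFinite _)
  rw [hc, Set.ncard_coe_finset, Finset.card_image_of_injective _ (Option.some_injective _)] at hle
  have hN : ∀ a b : K.ι, K.dim a ≠ K.dim b → a ≠ b := fun a b h h' => h (by rw [h'])
  have hcard : ({ρ, α, τ, τ', τ''} : Finset K.ι).card = 5 := by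
    have n1 := hN ρ α (by omega)
    have n2 := hN ρ τ (by omega)
    have n3 := hN ρ τ' (by omega)
    have n4 := hN ρ τ'' (by omega)
    have n5 := hN α τ (by omega)
    have n6 := hN α τ' (by omega)
    have n7 := hN α τ'' (by omega)
    have n8 := hcon.1.symm
    have n9 := hcon.2.symm
    rw [Finset.card_insert_of_notMem, Finset.card_insert_of_notMem, Finset.card_insert_of_notMem,
      Finset.card_insert_of_notMem, Finset.card_singleton] <;> simp [*]
  omega

lemma rev_step (K : FiniteCWComplex X) (h2 : Cond2 K) (h3 : Cond3 K) (h4 : Cond4 K)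
    (h5 : Cond5 K) (α : K.ι)
    (ih : ∀ τ, K.dim τ < K.dim α → InjOn (K.f τ) (closedBall 0 1)) :
    InjOn (K.f α) (sphere 0 1) := by
  have hcs := cw_compact K
  have hfin := K.finite_ι
  have hex : ∀ τ : {τ : K.ι // cellLE K τ α ∧ K.dim τ + 1 = K.dim α}, ∃ g : _ → _, _ :=
    fun τ => cond5_sphere K h5 τ.2.1 (fun h => by have := τ.2.2; rw [h] at this; omega)
  choose g hgc hgi hgS hgf using hex
  have hξ : ∀ τ : {τ : K.ι // cellLE K τ α ∧ K.dim τ + 1 = K.dim α},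
      ∃ ξ : X → EuclideanSpace ℝ (Fin (K.dim α)), Continuous ξ ∧
        ∀ x ∈ closedBall 0 1, ξ (K.f τ.1 x) = g τ x := fun τ =>
    tietze_factor (isCompact_closedBall _ 1) (K.f_cont τ.1) (ih τ.1 (by have := τ.2.2; omega))
      (hgc τ)
  choose ξ hξc hξ using hξ
  have hb : ∀ τ : {τ : K.ι // cellLE K τ α ∧ K.dim τ + 1 = K.dim α}, ∀ z ∈ closure (K.cell τ.1),
      ∃ b ∈ closedBall 0 1, K.f τ.1 b = z ∧ g τ b = ξ τ z := by
    intro τ z hz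
    rw [← K.image_closedBall] at hz
    obtain ⟨b, hb, rfl⟩ := hz
    exact ⟨b, hb, rfl, (hξ τ b hb).symm⟩
  have hξS : ∀ τ, ∀ z ∈ closure (K.cell τ.1), ξ τ z ∈ sphere 0 1 ∧ K.f α (ξ τ z) = z := by
    intro τ z hz
    obtain ⟨b, hb, rfl, h⟩ := hb τ z hz
    rw [← h]
    exact ⟨hgS τ b hb, (hgf τ b hb).symm⟩
  have hMc : ∀ τ, IsClosed (ξ τ '' closure (K.cell τ.1)) := fun τ =>
    (isClosed_closure.isCompact.image (hξc τ)).isClosed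
  have cover : ∀ x ∈ sphere 0 1, ∃ τ, K.f α x ∈ closure (K.cell τ.1) ∧ ξ τ (K.f α x) = x := by
    intro x hx
    have hsub : closure (sphere 0 1 ∩ K.f α ⁻¹' (⋃ β ∈ {β | K.dim β + 1 = K.dim α}, K.cell β)) ⊆
        ⋃ τ, ξ τ '' closure (K.cell τ.1) := by
      refine closure_minimal ?_ (isClosed_iUnion_of_finite hMc)
      rintro z ⟨hzS, hz⟩
      have hz0 := hz
      simp only [mem_preimage, mem_iUnion, exists_prop] at hz
      obtain ⟨τ, hτ, hzτ⟩ := hz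
      let t : {τ : K.ι // cellLE K τ α ∧ K.dim τ + 1 = K.dim α} := ⟨τ, (f_sphere K hzS hzτ).1, hτ⟩
      have hzc : K.f α z ∈ closure (K.cell t.1) := subset_closure hzτ
      obtain ⟨ha, hb⟩ := hξS t _ hzc
      rw [mem_iUnion]
      refine ⟨t, K.f α z, hzc, ?_⟩
      refine h4 α ⟨sphere_subset_closedBall ha, ?_⟩ ⟨sphere_subset_closedBall hzS, hz0⟩ hb
      rw [mem_preimage, hb]; exact hz0
    have := hsub (h2 α hx)
    rw [mem_iUnion] at this
    obtain ⟨τ, z, hz, rfl⟩ := this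
    refine ⟨τ, ?_, ?_⟩
    · rw [(hξS τ z hz).2]; exact hz
    · rw [(hξS τ z hz).2]
  have link0 : ∀ τ τ' ρ, τ ≠ τ' → cellLE K ρ τ.1 → cellLE K ρ τ'.1 → K.dim ρ + 2 = K.dim α →
      ∀ w ∈ K.cell ρ, ξ τ w = ξ τ' w := by
    intro τ τ' ρ hne hρ hρ' hd w hw
    by_contra hcon
    obtain ⟨u, hu, hu'⟩ := pre_open K α (ostar_open K ρ)
    have hρne : ρ ≠ τ.1 := fun h => by have := τ.2.2; rw [← h] at this; omega
    obtain ⟨b, hbS, hbw⟩ := cle_exists K hρ hρne hw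
    have hbξ := hξ τ b (sphere_subset_closedBall hbS)
    rw [hbw] at hbξ
    have hx := hξS τ w (hρ hw)
    refine boundary_not_nhd (by simpa using τ.2.2) (g τ) (hgc τ) (hgi τ) b hbS (hbξ ▸ hx.1)
      (u ∩ (ξ τ' '' closure (K.cell τ'.1))ᶜ) (hu.inter (hMc τ').isOpen_compl) ?_ ?_
    · rw [← hbξ]
      refine ⟨(hu' _ (sphere_subset_closedBall hx.1)).2 ?_, ?_⟩
      · rw [hx.2]; exact ⟨ρ, cle_refl K ρ, hw⟩
      · rintro ⟨z, hz, hz'⟩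
        have h1 := (hξS τ' z hz).2
        rw [hz', hx.2] at h1
        rw [← h1] at hz'
        exact hcon hz'.symm
    · rintro x ⟨⟨hxu, hxM⟩, hxS⟩
      obtain ⟨t, ht, htx⟩ := cover x hxS
      obtain ⟨ρ', hρ', hxρ'⟩ := (hu' x (sphere_subset_closedBall hxS)).1 hxu
      have hρt := cle_trans K hρ' (cle_of_meet K hxρ' ht)
      rcases thin_two K h3 hd hρ τ.2.1 (by assumption : cellLE K ρ τ'.1) τ'.2.1 hρt t.2.1 τ.2.2
        τ'.2.2 t.2.2 (fun h => hne (Subtype.ext h)) with h | h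
      · obtain rfl := Subtype.ext h
        obtain ⟨b', hb', -, hb2⟩ := hb _ _ ht
        exact ⟨b', hb', hb2.trans htx⟩
      · obtain rfl := Subtype.ext h
        exact absurd ⟨_, ht, htx⟩ hxM
  have link : ∀ τ τ' ρ, cellLE K ρ τ.1 → cellLE K ρ τ'.1 → K.dim ρ + 2 = K.dim α →
      ∀ w ∈ closure (K.cell ρ), ξ τ w = ξ τ' w := by
    intro τ τ' ρ h h' hd w hw
    by_cases hne : τ = τ'
    · rw [hne]
    · have : EqOn (ξ τ) (ξ τ') (K.cell ρ) := link0 τ τ' ρ hne h h' hd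
      exact this.closure (hξc τ) (hξc τ') hw
  intro x hx y hy hxy
  obtain ⟨σ, hσ⟩ := exists_cell K (K.f α x)
  have hσ' := hσ
  rw [hxy] at hσ'
  obtain ⟨hσα, hdσ⟩ := f_sphere K hx hσ
  by_cases hc : K.dim σ + 1 = K.dim α
  · refine h4 α ⟨sphere_subset_closedBall hx, ?_⟩ ⟨sphere_subset_closedBall hy, ?_⟩ hxy
    · simp only [mem_preimage, mem_iUnion]
      exact ⟨σ, hc, hσ⟩
    · simp only [mem_preimage, mem_iUnion]
      exact ⟨σ, hc, hσ'⟩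
  obtain ⟨τ, hτ, hτx⟩ := cover x hx
  obtain ⟨τ', hτ', hτy⟩ := cover y hy
  have key := strong_conn K h2 h3 α
    (fun t => ∀ h : cellLE K t α ∧ K.dim t + 1 = K.dim α, ξ ⟨t, h⟩ (K.f α x) = x)
    (K.dim α - K.dim σ) σ (by omega) (by omega) ?_ τ.1 τ'.1 (cle_of_meet K hσ hτ)
    (cle_of_meet K hσ' hτ') τ.2.1 τ'.2.1 τ.2.2 τ'.2.2 (fun _ => hτx) τ'.2
  · rw [← hτy, ← hxy]; exact key.symm
  · intro t1 t2 ρ a1 a2 a3 a4 a5 a6 a7 a8 hP h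
    rw [← hP ⟨a1, a2⟩, hP ⟨a1, a2⟩]
    rw [← link ⟨t1, a1, a2⟩ ⟨t2, h⟩ ρ a7 a8 a6 _ (a5 hσ)]
    exact hP ⟨a1, a2⟩

lemma rev_dir (K : FiniteCWComplex X) (h2 : Cond2 K) (h3 : Cond3 K) (h4 : Cond4 K)
    (h5 : Cond5 K) : IsRegularCW K := by
  have : ∀ n, ∀ α : K.ι, K.dim α = n → InjOn (K.f α) (sphere 0 1) := by
    intro n
    induction n using Nat.strong_induction_on with
    | _ n ih =>
      intro α hα
      exact rev_step K h2 h3 h4 h5 α fun τ hτ =>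
        injOn_closedBall K τ (ih _ (hα ▸ hτ) τ rfl)
  exact fun α => this _ α rfl

end Rev

section Fwd

lemma reg_inj (K : FiniteCWComplex X) (hK : IsRegularCW K) (α : K.ι) :
    InjOn (K.f α) (closedBall 0 1) := injOn_closedBall K α (hK α)

lemma reg_cond1 (K : FiniteCWComplex X) : Cond1 K := by
  intro α
  refine ⟨{β | cellLE K β α}, ?_⟩
  rw [K.image_closedBall]
  ext x
  simp only [mem_iUnion, exists_prop]
  constructor
  · intro hx
    obtain ⟨β, hβ⟩ := exists_cell K x
    exact ⟨β, cle_of_meet K hβ hx, hβ⟩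
  · rintro ⟨β, h, hx⟩
    exact h hx

/-- Continuous left inverse of a characteristic map of a regular complex. -/
lemma reg_inv (K : FiniteCWComplex X) (hK : IsRegularCW K) (α : K.ι) :
    ∃ G : X → EuclideanSpace ℝ (Fin (K.dim α)), Continuous G ∧
      (∀ x ∈ closedBall 0 1, G (K.f α x) = x) ∧
      (∀ z ∈ closure (K.cell α), G z ∈ closedBall 0 1 ∧ K.f α (G z) = z) := by
  have := cw_compact K
  obtain ⟨G, hG, h⟩ := tietze_factor (isCompact_closedBall _ 1) (K.f_cont α) (reg_inj K hK α)
    (l := fun x => x) continuousOn_id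
  refine ⟨G, hG, h, ?_⟩
  intro z hz
  rw [← K.image_closedBall] at hz
  obtain ⟨x, hx, rfl⟩ := hz
  rw [h x hx]
  exact ⟨hx, rfl⟩

lemma reg_cond4 (K : FiniteCWComplex X) (hK : IsRegularCW K) : Cond4 K :=
  fun α => (reg_inj K hK α).mono inter_subset_left

lemma reg_cond5 (K : FiniteCWComplex X) (hK : IsRegularCW K) : Cond5 K := by
  intro σ α h
  obtain ⟨G, hGc, hG, hG'⟩ := reg_inv K hK α
  have hm : ∀ x ∈ closedBall 0 1, K.f σ x ∈ closure (K.cell α) := fun x hx =>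
    closure_minimal h isClosed_closure (f_mem_closure K σ hx)
  refine ⟨fun x => G (K.f σ x), hGc.comp_continuousOn (K.f_cont σ), ?_, ?_, ?_⟩
  · intro x hx y hy hxy
    apply reg_inj K hK σ hx hy
    rw [← (hG' _ (hm x hx)).2, ← (hG' _ (hm y hy)).2]
    exact congrArg _ hxy
  · rintro _ ⟨x, hx, rfl⟩
    exact (hG' _ (hm x hx)).1
  · intro x hx
    exact (hG' _ (hm x hx)).2.symm

lemma reg_cond2 (K : FiniteCWComplex X) (hK : IsRegularCW K) : Cond2 K := by
  intro α y hy
  have := K.finite_ι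
  rw [_root_.mem_closure_iff]
  intro N hN hyN
  let T : Set K.ι := {τ | ∃ z ∈ N ∩ sphere 0 1, K.f α z ∈ K.cell τ}
  have hT : T.Nonempty := by
    obtain ⟨τ, hτ⟩ := exists_cell K (K.f α y)
    exact ⟨τ, y, ⟨hyN, hy⟩, hτ⟩
  obtain ⟨τ, ⟨z, ⟨hzN, hzS⟩, hzτ⟩, hmax⟩ := Set.exists_max_image T K.dim (Set.toFinite _) hT
  obtain ⟨u, hu, hu'⟩ := pre_open K α (ostar_open K τ)
  obtain ⟨G, hGc, hG, hG'⟩ := reg_inv K hK τ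
  have hsub : ∀ w ∈ (N ∩ u) ∩ sphere 0 1, K.f α w ∈ K.cell τ := by
    rintro w ⟨⟨hwN, hwu⟩, hwS⟩
    obtain ⟨ρ, hρ, hwρ⟩ := (hu' w (sphere_subset_closedBall hwS)).1 hwu
    have := hmax ρ ⟨w, ⟨hwN, hwS⟩, hwρ⟩
    rwa [cle_eq K hρ this]
  obtain ⟨hτα, hd⟩ := f_sphere K hzS hzτ
  have hzu : z ∈ u := (hu' z (sphere_subset_closedBall hzS)).2 ⟨τ, cle_refl K τ, hzτ⟩
  have key := (chart_open (F := EuclideanSpace ℝ (Fin (K.dim τ))) (by simpa using hd) (N ∩ u)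
    (hN.inter hu) ⟨z, ⟨hzN, hzu⟩, hzS⟩
    (fun w => G (K.f α w)) (hGc.comp_continuousOn ((K.f_cont α).mono
      (inter_subset_right.trans sphere_subset_closedBall))) ?_).1
  · refine ⟨z, hzN, hzS, ?_⟩
    simp only [mem_preimage, mem_iUnion]
    exact ⟨τ, by simpa using key, hzτ⟩
  · intro x hx w hw hxw
    apply reg_inj K hK α (sphere_subset_closedBall hx.2) (sphere_subset_closedBall hw.2)
    rw [← (hG' _ (subset_closure (hsub x hx))).2, ← (hG' _ (subset_closure (hsub w hw))).2]
    exact congrArg _ hxw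

lemma sphere_dim_one {E : Type} [NormedAddCommGroup E] [InnerProductSpace ℝ E] [FiniteDimensional ℝ E]
    (h : Module.finrank ℝ E = 1) : ∃ e ∈ sphere (0:E) 1, -e ∈ sphere (0:E) 1 ∧ e ≠ -e ∧
      ∀ x ∈ sphere (0:E) 1, x = e ∨ x = -e := by
  obtain ⟨v, hv, h1⟩ := finrank_eq_one_iff'.1 h
  have he := nu_mem hv
  refine ⟨nu v, he, by simpa using he, ?_, ?_⟩
  · intro h
    have h2 : (2:ℝ) • nu v = 0 := by
      rw [two_smul]
      nth_rewrite 2 [h]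
      exact add_neg_cancel _
    exact sph_ne he ((smul_eq_zero.1 h2).resolve_left two_ne_zero)
  · intro x hx
    obtain ⟨c, rfl⟩ := h1 x
    have hc : |c| * ‖v‖ = 1 := by simpa [norm_smul] using hx
    have hv' : ‖v‖ ≠ 0 := norm_ne_zero_iff.2 hv
    have hc' : |c| = ‖v‖⁻¹ := eq_inv_of_mul_eq_one_left hc
    rcases abs_cases c with h | h
    · left; rw [nu, ← hc', h.1]
    · right; rw [nu, ← hc', h.1]; simp

lemma cell_dim_zero (K : FiniteCWComplex X) {β : K.ι} (h : K.dim β = 0) {x y : X}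
    (hx : x ∈ K.cell β) (hy : y ∈ K.cell β) : x = y := by
  rw [← K.image_interior] at hx hy
  obtain ⟨a, -, rfl⟩ := hx
  obtain ⟨b, -, rfl⟩ := hy
  have : Subsingleton (EuclideanSpace ℝ (Fin (K.dim β))) := by
    apply Module.finrank_zero_iff.1 (by simpa using h : Module.finrank ℝ _ = 0)
  rw [Subsingleton.elim a b]

lemma four_count {T : Type} [Finite T] (S : Set T) (a b c d : T) (hab : a ≠ b) (hac : a ≠ c)
    (had : a ≠ d) (hbc : b ≠ c) (hbd : b ≠ d) (hcd : c ≠ d)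
    (h : ∀ z, z ∈ S ↔ z = a ∨ z = b ∨ z = c ∨ z = d) : S.ncard = 4 := by
  classical
  have : S = (({a, b, c, d} : Finset T) : Set T) := by
    ext z
    simp [h z]
  rw [this, Set.ncard_coe_finset, Finset.card_insert_of_notMem, Finset.card_insert_of_notMem,
      Finset.card_insert_of_notMem, Finset.card_singleton] <;> simp [*]

lemma reg_thin_none (K : FiniteCWComplex X) (hK : IsRegularCW K) (α : K.ι) (hd : K.dim α = 1) :
    {z | posetLE K none z ∧ posetLE K z (some α)}.ncard = 4 := by
  have := K.finite_ι
  obtain ⟨e, he, he', hne, hall⟩ := sphere_dim_one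
    (E := EuclideanSpace ℝ (Fin (K.dim α))) (by simpa using hd)
  obtain ⟨β₁, h1⟩ := exists_cell K (K.f α e)
  obtain ⟨β₂, h2⟩ := exists_cell K (K.f α (-e))
  obtain ⟨hl1, hd1⟩ := f_sphere K he h1
  obtain ⟨hl2, hd2⟩ := f_sphere K he' h2
  have h12 : β₁ ≠ β₂ := by
    rintro rfl
    exact hne (hK α he he' (cell_dim_zero K (by omega) h1 h2))
  refine four_count _ none (some α) (some β₁) (some β₂) (by simp) (by simp) (by simp) ?_ ?_ ?_ ?_
  · intro h; obtain rfl := Option.some.inj h; omega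
  · intro h; obtain rfl := Option.some.inj h; omega
  · intro h; exact h12 (Option.some.inj h)
  · intro z
    cases z with
    | none => simp [posetLE]
    | some β =>
      simp only [posetLE, mem_ofPred_eq, true_and, reduceCtorEq, false_or, Option.some.injEq]
      constructor
      · intro h
        by_cases hβ : β = α
        · exact Or.inl hβ
        · obtain ⟨w, hw⟩ := cell_nonempty K β
          obtain ⟨x, hx, rfl⟩ := cle_exists K h hβ hw
          rcases hall x hx with rfl | rfl
          · exact Or.inr (Or.inl (cell_unique K hw h1))
          · exact Or.inr (Or.inr (cell_unique K hw h2))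
      · rintro (rfl | rfl | rfl)
        · exact cle_refl K _
        · exact hl1
        · exact hl2

/-- Approximating a boundary point of a cell. -/
lemma near_cell (K : FiniteCWComplex X) (hK : IsRegularCW K) {σ τ α : K.ι} (h : cellLE K σ τ)
    (h' : cellLE K τ α) (hne : τ ≠ α) {y} (hy : y ∈ sphere 0 1) (hyσ : K.f α y ∈ K.cell σ) :
    y ∈ closure (sphere 0 1 ∩ K.f α ⁻¹' K.cell τ) := by
  obtain ⟨g, hgc, hgi, hgS, hgf⟩ := cond5_sphere K (reg_cond5 K hK) h' hne
  have hz := h hyσ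
  rw [← K.image_closedBall] at hz
  obtain ⟨b, hb, hbz⟩ := hz
  have hgb : g b = y := by
    rw [hgf b hb] at hbz
    exact hK α (hgS b hb) hy hbz
  have h1 : closedBall (0 : EuclideanSpace ℝ (Fin (K.dim τ))) 1 = closure (ball 0 1) :=
    (closure_ball _ one_ne_zero).symm
  have h2 : g '' closure (ball 0 1) ⊆ closure (g '' ball 0 1) :=
    ContinuousOn.image_closure (by rw [← h1]; exact hgc)
  rw [← hgb]
  refine closure_mono ?_ (h2 ⟨b, by rw [← h1]; exact hb, rfl⟩)
  rintro _ ⟨x, hx, rfl⟩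
  refine ⟨hgS x (ball_subset_closedBall hx), ?_⟩
  rw [mem_preimage, ← hgf x (ball_subset_closedBall hx)]
  exact f_mem_cell K τ hx

lemma reg_thin_some (K : FiniteCWComplex X) (hK : IsRegularCW K) (σ α : K.ι)
    (hσα : cellLE K σ α) (hd : K.dim α = K.dim σ + 2) :
    {z | posetLE K (some σ) z ∧ posetLE K z (some α)}.ncard = 4 := by
  have := K.finite_ι
  have hσne : σ ≠ α := fun h => by rw [h] at hd; omega
  have hc2 := reg_cond2 K hK
  have hc5 := reg_cond5 K hK
  obtain ⟨z, hz⟩ := cell_nonempty K σ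
  obtain ⟨y, hy, rfl⟩ := cle_exists K hσα hσne hz
  obtain ⟨u, hu, hu'⟩ := pre_open K α (ostar_open K σ)
  have hyu : y ∈ u := (hu' y (sphere_subset_closedBall hy)).2 ⟨σ, cle_refl K σ, hz⟩
  have hmid : ∀ τ, cellLE K σ τ → cellLE K τ α → τ ≠ σ → τ ≠ α → K.dim τ = K.dim σ + 1 := by
    intro τ h1 h2 h3 h4
    have := cle_dim K h1 h3.symm
    have := cle_dim K h2 h4
    omega
  have hdne : ∀ a b : K.ι, K.dim a ≠ K.dim b → a ≠ b := fun a b h h' => h (by rw [h'])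
  obtain ⟨τ₁, h1σ, h1α, hd1⟩ := exists_coatom K hc2 hσα hσne
  obtain ⟨g₁, hg₁c, hg₁i, hg₁S, hg₁f⟩ := cond5_sphere K hc5 h1α (hdne _ _ (by omega))
  obtain ⟨b₁, hb₁, hb₁z⟩ := cle_exists K h1σ (hdne _ _ (by omega)) hz
  have hb₁y : g₁ b₁ = y := by
    rw [hg₁f b₁ (sphere_subset_closedBall hb₁)] at hb₁z
    exact hK α (hg₁S _ (sphere_subset_closedBall hb₁)) hy hb₁z
  obtain ⟨τ₂, h2σ, h2α, h2ne, hne12⟩ : ∃ τ₂, cellLE K σ τ₂ ∧ cellLE K τ₂ α ∧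
      (τ₂ ≠ σ ∧ τ₂ ≠ α) ∧ τ₂ ≠ τ₁ := by
    by_contra hcon
    push Not at hcon
    refine boundary_not_nhd (by simpa using hd1) g₁ hg₁c hg₁i b₁ hb₁
      (hg₁S _ (sphere_subset_closedBall hb₁)) u hu (hb₁y ▸ hyu) ?_
    rintro x ⟨hxu, hxS⟩
    obtain ⟨ρ, hρ, hxρ⟩ := (hu' x (sphere_subset_closedBall hxS)).1 hxu
    obtain ⟨hρα, hdρ⟩ := f_sphere K hxS hxρ
    have hx1 : K.f α x ∈ closure (K.cell τ₁) := by
      by_cases hρσ : ρ = σ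
      · rw [hρσ] at hxρ; exact h1σ hxρ
      · rw [hcon ρ hρ hρα ⟨hρσ, hdne _ _ (by omega)⟩] at hxρ
        exact subset_closure hxρ
    rw [← K.image_closedBall] at hx1
    obtain ⟨b, hb, hbx⟩ := hx1
    rw [hg₁f b hb] at hbx
    exact ⟨b, hb, hK α (hg₁S b hb) hxS hbx⟩
  have hd2 := hmid τ₂ h2σ h2α h2ne.1 h2ne.2
  have honly : ∀ τ₃, cellLE K σ τ₃ → cellLE K τ₃ α → τ₃ ≠ σ → τ₃ ≠ α → τ₃ = τ₁ ∨ τ₃ = τ₂ := by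
    intro τ₃ h3σ h3α h3n h3n'
    have hd3 := hmid τ₃ h3σ h3α h3n h3n'
    obtain ⟨g₂, hg₂c, hg₂i, hg₂S, hg₂f⟩ := cond5_sphere K hc5 h2α h2ne.2
    obtain ⟨W, hW, hW'⟩ := pre_open K τ₁ (ostar_open K σ)
    have hts := two_sheets (by simpa using hd1) g₁ hg₁c hg₁i hg₁S g₂ hg₂c hg₂i
      hg₂S ?_ W hW b₁ hb₁ ((hW' _ (sphere_subset_closedBall hb₁)).2
        ⟨σ, cle_refl K σ, hb₁z ▸ hz⟩) ?_
    · obtain ⟨V, hV, hyV, hVsub⟩ := hts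
      rw [hb₁y] at hyV
      obtain ⟨x, hxV, hxS, hx3⟩ := _root_.mem_closure_iff.1 (near_cell K hK h3σ h3α h3n' hy hz) V hV hyV
      rw [mem_preimage] at hx3
      rcases hVsub ⟨hxV, hxS⟩ with ⟨b, hb, rfl⟩ | ⟨b, hb, rfl⟩
      · left
        rw [← hg₁f b hb] at hx3
        exact cle_eq K (cle_of_meet K hx3 (f_mem_closure K τ₁ hb)) (by omega)
      · right
        rw [← hg₂f b hb] at hx3
        exact cle_eq K (cle_of_meet K hx3 (f_mem_closure K τ₂ hb)) (by omega)
    · intro a ha b hb hab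
      have h1 := f_mem_cell K τ₂ hb
      rw [hg₂f b (ball_subset_closedBall hb), ← hab, ← hg₁f a ha] at h1
      exact hne12 (cle_eq K (cle_of_meet K h1 (f_mem_closure K τ₁ ha)) (by omega))
    · rintro x ⟨hxW, hxS⟩
      obtain ⟨ρ, hρ, hxρ⟩ := (hW' x (sphere_subset_closedBall hxS)).1 hxW
      obtain ⟨-, hdρ⟩ := f_sphere K hxS hxρ
      obtain rfl := cle_eq K hρ (by omega)
      obtain ⟨b, hb, hbx⟩ := cle_exists K h2σ h2ne.1.symm hxρ
      refine ⟨b, hb, ?_⟩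
      rw [hg₂f b (sphere_subset_closedBall hb), hg₁f x (sphere_subset_closedBall hxS)] at hbx
      exact hK α (hg₂S b (sphere_subset_closedBall hb)) (hg₁S x (sphere_subset_closedBall hxS)) hbx
  have hs : ∀ a b : K.ι, a ≠ b → (some a : Option K.ι) ≠ some b :=
    fun a b h h' => h (Option.some.inj h')
  refine four_count _ (some σ) (some α) (some τ₁) (some τ₂) (hs _ _ hσne)
    (hs _ _ (hdne _ _ (by omega))) (hs _ _ h2ne.1.symm) (hs _ _ (hdne _ _ (by omega)))
    (hs _ _ h2ne.2.symm) (hs _ _ hne12.symm) ?_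
  intro z
  cases z with
  | none => simp [posetLE]
  | some β =>
    simp only [posetLE, mem_ofPred_eq, Option.some.injEq]
    constructor
    · rintro ⟨h1, h2⟩
      by_cases e1 : β = σ
      · exact Or.inl e1
      by_cases e2 : β = α
      · exact Or.inr (Or.inl e2)
      exact Or.inr (Or.inr (honly β h1 h2 e1 e2))
    · rintro (rfl | rfl | rfl | rfl)
      · exact ⟨cle_refl K _, hσα⟩
      · exact ⟨hσα, cle_refl K _⟩
      · exact ⟨h1σ, h1α⟩
      · exact ⟨h2σ, h2α⟩

lemma reg_conn_none (K : FiniteCWComplex X) (α : K.ι) (hd : 2 ≤ K.dim α)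
    (P : K.ι → Prop) (hP : ∀ a b, a ≠ α → b ≠ α → cellLE K a α → cellLE K b α → cellLE K a b →
      (P a ↔ P b)) (p q : K.ι) (hp : cellLE K p α) (hpn : p ≠ α) (hq : cellLE K q α) (hqn : q ≠ α)
    (hPp : P p) : P q := by
  have := K.finite_ι
  by_contra hPq
  have hcl : ∀ s : Set K.ι, IsClosed (closedBall 0 1 ∩ K.f α ⁻¹' (⋃ β ∈ s, closure (K.cell β))) :=
    fun s => (K.f_cont α).preimage_isClosed_of_isClosed isClosed_closedBall
      ((Set.toFinite s).isClosed_biUnion (fun _ _ => isClosed_closure))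
  have hconn : IsPreconnected (sphere (0 : EuclideanSpace ℝ (Fin (K.dim α))) 1) := by
    apply isPreconnected_sphere
    rw [← Module.finrank_eq_rank]
    simp
    omega
  have hmem : ∀ s : Set K.ι, ∀ r ∈ s, cellLE K r α → r ≠ α → (sphere 0 1 ∩ (closedBall 0 1 ∩ K.f α ⁻¹'
      (⋃ β ∈ s, closure (K.cell β)))).Nonempty := by
    intro s r hr hrα hrn
    obtain ⟨z, hz⟩ := cell_nonempty K r
    obtain ⟨x, hx, rfl⟩ := cle_exists K hrα hrn hz
    refine ⟨x, hx, sphere_subset_closedBall hx, ?_⟩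
    simp only [mem_preimage, mem_iUnion]
    exact ⟨r, hr, subset_closure hz⟩
  have hpc := isPreconnected_closed_iff.1 hconn _ _
    (hcl {β | cellLE K β α ∧ β ≠ α ∧ P β}) (hcl {β | cellLE K β α ∧ β ≠ α ∧ ¬ P β}) ?_
    (hmem _ p ⟨hp, hpn, hPp⟩ hp hpn) (hmem _ q ⟨hq, hqn, hPq⟩ hq hqn)
  · obtain ⟨x, hx, ⟨-, h1⟩, ⟨-, h2⟩⟩ := hpc
    simp only [mem_preimage, mem_iUnion, exists_prop] at h1 h2
    obtain ⟨β₁, ⟨a1, a2, a3⟩, a4⟩ := h1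
    obtain ⟨β₂, ⟨b1, b2, b3⟩, b4⟩ := h2
    obtain ⟨ρ, hρ⟩ := exists_cell K (K.f α x)
    obtain ⟨hρα, hdρ⟩ := f_sphere K hx hρ
    have hρn : ρ ≠ α := fun h => by rw [h] at hdρ; omega
    have e1 := hP ρ β₁ hρn a2 hρα a1 (cle_of_meet K hρ a4)
    have e2 := hP ρ β₂ hρn b2 hρα b1 (cle_of_meet K hρ b4)
    exact b3 (e2.1 (e1.2 a3))
  · intro x hx
    obtain ⟨ρ, hρ⟩ := exists_cell K (K.f α x)
    obtain ⟨hρα, hdρ⟩ := f_sphere K hx hρ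
    have hρn : ρ ≠ α := fun h => by rw [h] at hdρ; omega
    by_cases h : P ρ
    · left
      refine ⟨sphere_subset_closedBall hx, ?_⟩
      simp only [mem_preimage, mem_iUnion]
      exact ⟨ρ, ⟨hρα, hρn, h⟩, subset_closure hρ⟩
    · right
      refine ⟨sphere_subset_closedBall hx, ?_⟩
      simp only [mem_preimage, mem_iUnion]
      exact ⟨ρ, ⟨hρα, hρn, h⟩, subset_closure hρ⟩

lemma reg_conn_some (K : FiniteCWComplex X) (hK : IsRegularCW K) (σ α : K.ι)
    (hσα : cellLE K σ α) (hd : K.dim σ + 3 ≤ K.dim α)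
    (P : K.ι → Prop) (hP : ∀ a b, a ≠ σ → b ≠ σ → a ≠ α → b ≠ α → cellLE K σ a → cellLE K σ b →
      cellLE K a α → cellLE K b α → cellLE K a b → (P a ↔ P b)) (p q : K.ι)
    (hp : cellLE K p α) (hpn : p ≠ α) (hσp : cellLE K σ p) (hpn' : p ≠ σ)
    (hq : cellLE K q α) (hqn : q ≠ α) (hσq : cellLE K σ q) (hqn' : q ≠ σ)
    (hPp : P p) : P q := by
  by_contra hPq
  have hσne : σ ≠ α := fun h => by rw [h] at hd; omega
  obtain ⟨z, hz⟩ := cell_nonempty K σ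
  obtain ⟨y, hy, rfl⟩ := cle_exists K hσα hσne hz
  obtain ⟨G, hGc, hG, hG'⟩ := reg_inv K hK σ
  let I : Set K.ι := {β | cellLE K σ β ∧ cellLE K β α ∧ β ≠ σ ∧ β ≠ α}
  have hst : ∀ s : Set K.ι, IsOpen (⋃ β ∈ s, ostar K β) := fun s =>
    isOpen_biUnion fun β _ => ostar_open K β
  obtain ⟨W, hW, hW'⟩ := pre_open K α (ostar_open K σ)
  obtain ⟨V₁, hV₁, hV₁'⟩ := pre_open K α (hst {β | β ∈ I ∧ P β})
  obtain ⟨V₂, hV₂, hV₂'⟩ := pre_open K α (hst {β | β ∈ I ∧ ¬ P β})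
  simp only [mem_iUnion, exists_prop] at hV₁' hV₂'
  have hup : ∀ β ∈ I, ∀ ρ, cellLE K β ρ → cellLE K ρ α → K.dim ρ < K.dim α →
      ρ ∈ I ∧ (P β ↔ P ρ) := by
    rintro β ⟨b1, b2, b3, b4⟩ ρ h1 h2 h3
    have r1 : ρ ≠ σ := by
      rintro rfl
      have := cle_dim K b1 b3.symm
      have := cle_dimle K h1
      omega
    have r2 : ρ ≠ α := fun h => by rw [h] at h3; omega
    exact ⟨⟨cle_trans K b1 h1, h2, r1, r2⟩,
      hP β ρ b3 r1 b4 r2 b1 (cle_trans K b1 h1) b2 h2 h1⟩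
  have hnear : ∀ r, r ∈ I → ∀ V : Set (EuclideanSpace ℝ (Fin (K.dim α))),
      (∀ x ∈ sphere 0 1, K.f α x ∈ K.cell r → x ∈ V) →
      y ∈ closure ((V ∩ sphere 0 1) \ (closedBall 0 1 ∩ K.f α ⁻¹' closure (K.cell σ))) := by
    rintro r ⟨r1, r2, r3, r4⟩ V hV
    refine closure_mono ?_ (near_cell K hK r1 r2 r4 hy hz)
    rintro x ⟨hxS, hxr⟩
    refine ⟨⟨hV x hxS hxr, hxS⟩, ?_⟩
    rintro ⟨-, h⟩
    have h1 := cle_dimle K (cle_of_meet K hxr h)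
    have h2 := cle_dim K r1 r3.symm
    omega
  refine sphere_nonsep (F := EuclideanSpace ℝ (Fin (K.dim σ))) (by simpa using hd)
    (sphere 0 1 ∩ K.f α ⁻¹' closure (K.cell σ)) ?_ (fun x => G (K.f α x)) ?_ ?_ V₁ V₂ W hV₁ hV₂ hW
    ?_ ?_ y hy ?_ ?_ ?_
  · exact ((K.f_cont α).mono sphere_subset_closedBall).preimage_isClosed_of_isClosed
      isClosed_sphere isClosed_closure
  · exact hGc.comp_continuousOn ((K.f_cont α).mono
      (inter_subset_left.trans sphere_subset_closedBall))
  · intro x hx w hw hxw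
    apply hK α hx.1 hw.1
    rw [← (hG' _ hx.2).2, ← (hG' _ hw.2).2]
    exact congrArg _ hxw
  · intro x hx h1 h2
    obtain ⟨β₁, ⟨a1, a2⟩, ρ, a3, a4⟩ := (hV₁' x (sphere_subset_closedBall hx)).1 h1
    obtain ⟨β₂, ⟨b1, b2⟩, ρ', b3, b4⟩ := (hV₂' x (sphere_subset_closedBall hx)).1 h2
    obtain rfl := cell_unique K a4 b4
    obtain ⟨hρα, hdρ⟩ := f_sphere K hx a4
    exact b2 ((hup β₂ b1 ρ b3 hρα hdρ).2.2 ((hup β₁ a1 ρ a3 hρα hdρ).2.1 a2))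
  · rintro x ⟨hxW, hx⟩
    have hxc := sphere_subset_closedBall hx
    obtain ⟨ρ, hρ, hxρ⟩ := (hW' x hxc).1 hxW
    obtain ⟨hρα, hdρ⟩ := f_sphere K hx hxρ
    have r2 : ρ ≠ α := fun h => by rw [h] at hdρ; omega
    by_cases r1 : ρ = σ
    · left
      refine ⟨hx, ?_⟩
      rw [r1] at hxρ
      exact subset_closure hxρ
    · right
      by_cases h : P ρ
      · left
        exact (hV₁' x hxc).2 ⟨ρ, ⟨⟨hρ, hρα, r1, r2⟩, h⟩, ρ, cle_refl K ρ, hxρ⟩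
      · right
        exact (hV₂' x hxc).2 ⟨ρ, ⟨⟨hρ, hρα, r1, r2⟩, h⟩, ρ, cle_refl K ρ, hxρ⟩
  · exact (hW' y (sphere_subset_closedBall hy)).2 ⟨σ, cle_refl K σ, hz⟩
  · have hpI : p ∈ I := ⟨hσp, hp, hpn', hpn⟩
    refine closure_mono (sdiff_subset_sdiff_right ?_) (hnear p hpI V₁ ?_)
    · exact inter_subset_inter_left _ sphere_subset_closedBall
    · intro x hx hxp
      exact (hV₁' x (sphere_subset_closedBall hx)).2 ⟨p, ⟨hpI, hPp⟩, p, cle_refl K p, hxp⟩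
  · have hqI : q ∈ I := ⟨hσq, hq, hqn', hqn⟩
    refine closure_mono (sdiff_subset_sdiff_right ?_) (hnear q hqI V₂ ?_)
    · exact inter_subset_inter_left _ sphere_subset_closedBall
    · intro x hx hxp
      exact (hV₂' x (sphere_subset_closedBall hx)).2 ⟨q, ⟨hqI, hPq⟩, q, cle_refl K q, hxp⟩

lemma reg_cond3 (K : FiniteCWComplex X) (hK : IsRegularCW K) : Cond3 K := by
  refine ⟨?_, ?_⟩
  · intro u v huv hr
    cases v with
    | none => simp [posetRank] at hr
    | some α =>
      cases u with
      | none => exact reg_thin_none K hK α (by simp only [posetRank] at hr; omega)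
      | some σ => exact reg_thin_some K hK σ α huv (by simp only [posetRank] at hr; omega)
  · intro u v huv hr p hp q hq
    set R : Option K.ι → Option K.ι → Prop := fun a b =>
      a ∈ {z | posetLE K u z ∧ posetLE K z v ∧ z ≠ u ∧ z ≠ v} ∧
            b ∈ {z | posetLE K u z ∧ posetLE K z v ∧ z ≠ u ∧ z ≠ v} ∧
            (posetLE K a b ∨ posetLE K b a) with hR
    have hPR : ∀ a b, a ∈ {z | posetLE K u z ∧ posetLE K z v ∧ z ≠ u ∧ z ≠ v} →
        b ∈ {z | posetLE K u z ∧ posetLE K z v ∧ z ≠ u ∧ z ≠ v} → posetLE K a b →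
        (Relation.ReflTransGen R p a ↔ Relation.ReflTransGen R p b) := by
      intro a b ha hb hab
      exact ⟨fun h => h.tail ⟨ha, hb, Or.inl hab⟩, fun h => h.tail ⟨hb, ha, Or.inr hab⟩⟩
    cases v with
    | none => simp [posetRank] at hr
    | some α =>
      cases u with
      | none =>
        cases p with
        | none => exact absurd rfl hp.2.2.1
        | some p =>
        cases q with
        | none => exact absurd rfl hq.2.2.1
        | some q =>
        refine reg_conn_none K α (by simp only [posetRank] at hr; omega)
          (fun z => Relation.ReflTransGen R (some p) (some z)) ?_ p q hp.2.1
          (fun h => hp.2.2.2 (by rw [h])) hq.2.1 (fun h => hq.2.2.2 (by rw [h])) .refl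
        intro a b ha hb haα hbα hab
        exact hPR (some a) (some b) ⟨trivial, haα, by simp, by simpa using ha⟩
          ⟨trivial, hbα, by simp, by simpa using hb⟩ hab
      | some σ =>
        cases p with
        | none => exact absurd hp.1 (by simp [posetLE])
        | some p =>
        cases q with
        | none => exact absurd hq.1 (by simp [posetLE])
        | some q =>
        refine reg_conn_some K hK σ α huv (by simp only [posetRank] at hr; omega)
          (fun z => Relation.ReflTransGen R (some p) (some z)) ?_ p q hp.2.1
          (fun h => hp.2.2.2 (by rw [h])) hp.1 (fun h => hp.2.2.1 (by rw [h]))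
          hq.2.1 (fun h => hq.2.2.2 (by rw [h])) hq.1 (fun h => hq.2.2.1 (by rw [h])) .refl
        intro a b ha hb ha' hb' hσa hσb haα hbα hab
        exact hPR (some a) (some b) ⟨hσa, haα, by simpa using ha, by simpa using ha'⟩
          ⟨hσb, hbα, by simpa using hb, by simpa using hb'⟩ hab

end Fwd

/-- (Theorem 1.1 of the paper.)  A finite CW complex `K` is regular
with respect to its characteristic maps if and only if conditions 1–5 of the regularity
criterion hold. -/
theorem regular_iff_conditions (K : FiniteCWComplex X) :
    IsRegularCW K ↔ (Cond1 K ∧ Cond2 K ∧ Cond3 K ∧ Cond4 K ∧ Cond5 K) :=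
  ⟨fun h => ⟨reg_cond1 K, reg_cond2 K h, reg_cond3 K h, reg_cond4 K h, reg_cond5 K h⟩,
    fun ⟨_, h2, h3, h4, h5⟩ => rev_dir K h2 h3 h4 h5⟩
end

section
/- Every word s_{i_1} s_{i_2} ⋯ s_{i_d} in the simple reflections of a Coxeter group W can be transformed into a reduced expression for the same element of W by a finite sequence of nil-moves (deleting an adjacent equal pair s_i s_i) and braid-moves (replacing an alternating segment s_i s_j s_i ⋯ of length m(i,j) by s_j s_i s_j ⋯); moreover any two reduced expressions for the same element are connected by braid-moves alone. -/
variable {B : Type*}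

/-- A braid move on words: replace an alternating segment `i j i ⋯` of length `m(i,j)`
by the alternating segment `j i j ⋯` of the same length. -/
inductive BraidMove (M : CoxeterMatrix B) : List B → List B → Prop
  | braid (l r : List B) (i j : B) :
      BraidMove M (l ++ CoxeterSystem.alternatingWord i j (M i j) ++ r)
        (l ++ CoxeterSystem.alternatingWord j i (M i j) ++ r)

/-- A nil move on words: delete an adjacent equal pair `i i`. -/
inductive NilMove : List B → List B → Prop
  | nil (l r : List B) (i : B) : NilMove (l ++ [i, i] ++ r) (l ++ r)


namespace WordProp
open CoxeterSystem Module Polynomial.Chebyshev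

variable {B : Type*} {W : Type*} [Group W] {M : CoxeterMatrix B}

/-! ### The geometric representation and the order of `s i * s j` -/

/-- The (doubled) bilinear form coefficients. -/
noncomputable def cf (M : CoxeterMatrix B) (i j : B) : ℝ := -2 * Real.cos (Real.pi / M i j)

lemma cf_self (i : B) : cf M i i = 2 := by simp [cf]

lemma cf_comm (i j : B) : cf M i j = cf M j i := by simp [cf, M.symmetric i j]

/-- The simple coroot. -/
noncomputable def coroot (M : CoxeterMatrix B) (i : B) : Dual ℝ (B →₀ ℝ) :=
  Finsupp.linearCombination ℝ (fun j => cf M i j)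

/-- The simple root. -/
noncomputable def root (i : B) : B →₀ ℝ := Finsupp.single i 1

lemma coroot_root (i j : B) : coroot M i (root j) = cf M i j := by
  simp [coroot, root]

lemma coroot_root_self (i : B) : coroot M i (root i) = 2 := by
  rw [coroot_root, cf_self]

/-- The simple reflection in the geometric representation. -/
noncomputable def refl (M : CoxeterMatrix B) (i : B) : (B →₀ ℝ) ≃ₗ[ℝ] (B →₀ ℝ) :=
  Module.reflection (coroot_root_self (M := M) i)

lemma tval (i j : B) : coroot M i (root j) * coroot M j (root i) - 2
    = 2 * Real.cos (2 * Real.pi / M i j) := by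
  rw [coroot_root, coroot_root, cf_comm j i, cf, mul_div_assoc, Real.cos_two_mul]
  ring

lemma sin_pos_aux {m : ℕ} (hm : 3 ≤ m) : 0 < Real.sin (2 * Real.pi / m) := by
  have h3 : (3 : ℝ) ≤ m := by exact_mod_cast hm
  apply Real.sin_pos_of_pos_of_lt_pi
  · have := Real.pi_pos; positivity
  · rw [div_lt_iff₀ (by linarith)]; nlinarith [Real.pi_pos]

lemma refl_pow (i j : B) : (refl M i * refl M j) ^ M i j = 1 := by
  by_cases hij : i = j
  · subst hij
    rw [M.diagonal, pow_one]
    apply LinearEquiv.ext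
    intro z
    exact Module.involutive_reflection (coroot_root_self (M := M) i) z
  have h1 : M i j ≠ 1 := M.off_diagonal i j hij
  apply LinearEquiv.ext
  intro z
  have key := reflection_mul_reflection_pow_apply (coroot_root_self (M := M) i)
    (coroot_root_self (M := M) j) (M i j) z _ (tval i j).symm
  have hcc : coroot M i (root j) = coroot M j (root i) := by
    rw [coroot_root, coroot_root, cf_comm]
  change ((refl M i * refl M j) ^ M i j) z = _ at key
  rw [key, hcc, coroot_root]
  unfold cf
  rw [M.symmetric j i]
  clear key
  generalize M i j = m at *
  rcases (by omega : m = 0 ∨ m = 2 ∨ 3 ≤ m) with rfl | rfl | hm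
  · simp
  · simp
    module
  · have hs := sin_pos_aux hm
    have hS := fun n => S_two_mul_real_cos (2 * Real.pi / m) n
    set θ := 2 * Real.pi / (m : ℝ) with hθ
    have hmθ : (m : ℝ) * θ = 2 * Real.pi := by
      have : (m : ℝ) ≠ 0 := by positivity
      rw [hθ]; field_simp
    obtain ⟨h, rfl | rfl⟩ := Nat.even_or_odd' m
    · have e1 : (((2 * h : ℕ) : ℤ) - 2) / 2 = (h : ℤ) - 1 := by omega
      have e2 : (((2 * h : ℕ) : ℤ) - 1) / 2 = (h : ℤ) - 1 := by omega
      have : (S ℝ ((h : ℤ) - 1)).eval (2 * Real.cos θ) = 0 := by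
        have := hS ((h : ℤ) - 1)
        have h2 : (((h : ℤ) - 1 : ℤ) + 1 : ℝ) * θ = Real.pi := by
          push_cast at hmθ ⊢; linarith
        rw [h2, Real.sin_pi] at this
        exact (mul_eq_zero.1 this).resolve_right hs.ne'
      rw [e1, e2, this]
      simp
    · have e1 : (((2 * h + 1 : ℕ) : ℤ) - 2) / 2 = (h : ℤ) - 1 := by omega
      have e2 : (((2 * h + 1 : ℕ) : ℤ) - 1) / 2 = (h : ℤ) := by omega
      have e3 : (((2 * h + 1 : ℕ) : ℤ) - 3) / 2 = (h : ℤ) - 1 := by omega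
      have e4 : (((2 * h + 1 : ℕ) : ℤ)) / 2 = (h : ℤ) := by omega
      have : (S ℝ (h : ℤ)).eval (2 * Real.cos θ) + (S ℝ ((h : ℤ) - 1)).eval (2 * Real.cos θ)
          = 0 := by
        have a := hS ((h : ℤ) - 1)
        have b := hS (h : ℤ)
        have h2 : (((h : ℤ) : ℝ) + 1) * θ = 2 * Real.pi - (((h : ℤ) - 1 : ℤ) + 1 : ℝ) * θ := by
          push_cast at hmθ ⊢; linarith
        rw [h2, Real.sin_two_pi_sub, ← a] at b
        have : ((S ℝ (h : ℤ)).eval (2 * Real.cos θ) + (S ℝ ((h : ℤ) - 1)).eval (2 * Real.cos θ))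
          * Real.sin θ = 0 := by linarith
        exact (mul_eq_zero.1 this).resolve_right hs.ne'
      rw [e1, e2, e3, e4, this]
      simp

lemma refl_order {i j : B} (hij : i ≠ j) {n : ℕ} (hn : 0 < n)
    (h : (refl M i * refl M j) ^ n = 1) : M i j ≠ 0 ∧ M i j ≤ n := by
  have key := reflection_mul_reflection_pow_apply_self (coroot_root_self (M := M) i)
    (coroot_root_self (M := M) j) n _ (tval i j).symm
  change ((refl M i * refl M j) ^ n) (root i) = _ at key
  rw [h] at key
  have k1 := congrArg (fun v : B →₀ ℝ => v i) key
  have k2 := congrArg (fun v : B →₀ ℝ => v j) key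
  simp [root, hij, hij.symm] at k1 k2
  change (S ℝ ((n : ℤ) - 1)).eval _ = 0 ∨ coroot M j (root i) = 0 at k2
  rw [coroot_root] at k2
  unfold cf at k2
  rw [M.symmetric j i] at k2
  have h1 : M i j ≠ 1 := M.off_diagonal i j hij
  generalize M i j = m at *
  rcases (by omega : m = 0 ∨ m = 2 ∨ 3 ≤ m) with rfl | rfl | hm
  · simp [S_eval_two] at k2
    omega
  · refine ⟨by norm_num, ?_⟩
    by_contra hlt
    obtain rfl : n = 1 := by omega
    simp at k1
    try norm_num at k1
  · refine ⟨by omega, ?_⟩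
    by_contra hlt
    have hs := sin_pos_aux hm
    have h3 : (3 : ℝ) ≤ m := by exact_mod_cast hm
    have hc : 0 < Real.cos (Real.pi / m) := by
      apply Real.cos_pos_of_mem_Ioo
      constructor
      · have : 0 < Real.pi / m := by have := Real.pi_pos; positivity
        linarith [Real.pi_pos]
      · rw [div_lt_iff₀ (by linarith)]; nlinarith [Real.pi_pos]
    have k2 := k2.resolve_right (by nlinarith)
    rw [k2, add_zero] at k1
    have a := S_two_mul_real_cos (2 * Real.pi / m) ((n : ℤ) - 1)
    have b := S_two_mul_real_cos (2 * Real.pi / m) (n : ℤ)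
    rw [k2, zero_mul] at a
    rw [← k1, one_mul] at b
    push_cast at a b
    rw [sub_add_cancel] at a
    rw [add_mul, one_mul, Real.sin_add, ← a, zero_mul, zero_add] at b
    have hcos : Real.cos (n * (2 * Real.pi / m)) = 1 := by
      have : (Real.cos (n * (2 * Real.pi / m)) - 1) * Real.sin (2 * Real.pi / m) = 0 := by linarith
      linarith [(mul_eq_zero.1 this).resolve_right hs.ne']
    rw [Real.cos_eq_one_iff_of_lt_of_lt] at hcos
    · have := Real.pi_pos
      have : 0 < (n : ℝ) * (2 * Real.pi / m) := by positivity
      linarith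
    · have := Real.pi_pos
      have : 0 < (n : ℝ) * (2 * Real.pi / m) := by positivity
      linarith
    · have hnm : (n : ℝ) < m := by exact_mod_cast (by omega : n < m)
      rw [← mul_div_assoc, div_lt_iff₀ (by linarith)]
      nlinarith [Real.pi_pos]

lemma order_le (cs : CoxeterSystem M W) {i j : B} (hij : i ≠ j) {n : ℕ} (hn : 0 < n)
    (h : (cs.simple i * cs.simple j) ^ n = 1) : M i j ≠ 0 ∧ M i j ≤ n := by
  have hl : M.IsLiftable (refl M) := fun i j => refl_pow i j
  apply refl_order hij hn
  have := congrArg (cs.lift ⟨refl M, hl⟩) h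
  simpa using this

end WordProp
namespace WordProp
open CoxeterSystem

variable {B : Type*} {W : Type*} [Group W] {M : CoxeterMatrix B}

/-! ### The exchange property -/

open Classical in
/-- The action of a simple reflection on (reflection, sign) pairs. -/
noncomputable def act (cs : CoxeterSystem M W) (i : B) : Function.End (W × ZMod 2) :=
  fun p => (cs.simple i * p.1 * cs.simple i, p.2 + if p.1 = cs.simple i then 1 else 0)

lemma simple_mul_pow (cs : CoxeterSystem M W) (i j : B) (n : ℕ) :
    cs.simple j * (cs.simple i * cs.simple j) ^ n
      = ((cs.simple i * cs.simple j) ^ n)⁻¹ * cs.simple j := by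
  induction n with
  | zero => simp
  | succ n ih =>
    rw [pow_succ, ← mul_assoc, ih, mul_inv_rev]
    have : ((cs.simple i * cs.simple j) ^ n)⁻¹ * (cs.simple i * cs.simple j)⁻¹
        = (cs.simple i * cs.simple j)⁻¹ * ((cs.simple i * cs.simple j) ^ n)⁻¹ := by
      rw [← mul_inv_rev, ← mul_inv_rev, ← pow_succ, ← pow_succ']
    rw [← this]
    simp [mul_assoc]

open Classical in
lemma act_pow (cs : CoxeterSystem M W) (i j : B) (n : ℕ) (t : W) (e : ZMod 2) :
    ((act cs i * act cs j) ^ n) (t, e) =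
      ((cs.simple i * cs.simple j) ^ n * t * ((cs.simple i * cs.simple j) ^ n)⁻¹,
       e + ∑ k ∈ Finset.range (2 * n),
        if t = cs.simple j * (cs.simple i * cs.simple j) ^ k then 1 else 0) := by
  induction n with
  | zero => simp; rfl
  | succ n ih =>
    rw [pow_succ' (act cs i * act cs j)]
    change act cs i (act cs j (((act cs i * act cs j) ^ n) (t, e))) = _
    rw [ih]
    have hpow := simple_mul_pow cs i j n
    rw [show 2 * (n + 1) = 2 * n + 1 + 1 by ring, Finset.sum_range_succ, Finset.sum_range_succ]
    set u := (cs.simple i * cs.simple j) ^ n with hu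
    have hc : u * (cs.simple i * cs.simple j) = (cs.simple i * cs.simple j) * u := by
      rw [hu, ← pow_succ, ← pow_succ']
    have h2n : (cs.simple i * cs.simple j) ^ (2 * n) = u * u := by rw [two_mul, pow_add]
    have E1 : (u * t * u⁻¹ = cs.simple j) ↔
        t = cs.simple j * (cs.simple i * cs.simple j) ^ (2 * n) := by
      rw [h2n, ← mul_assoc, hpow, mul_inv_eq_iff_eq_mul, mul_assoc, eq_inv_mul_iff_mul_eq]
    have E2 : (cs.simple j * (u * t * u⁻¹) * cs.simple j = cs.simple i) ↔
        t = cs.simple j * (cs.simple i * cs.simple j) ^ (2 * n + 1) := by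
      rw [pow_succ, h2n, mul_assoc u u, hc, ← mul_assoc (cs.simple j) u, hpow]
      constructor
      · intro h
        rw [← h]
        simp [mul_assoc]
      · intro h
        rw [h]
        simp [mul_assoc]
    simp only [act, E1, E2]
    ext
    · rw [pow_succ' _ n, ← hu]; simp [mul_assoc]
    · simp [add_assoc]

lemma act_liftable (cs : CoxeterSystem M W) : M.IsLiftable (act cs) := by
  classical
  intro i j
  funext ⟨t, e⟩
  rw [act_pow]
  have : ∀ k, (cs.simple i * cs.simple j) ^ (M i j + k) = (cs.simple i * cs.simple j) ^ k := by
    intro k; rw [pow_add]; simp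
  rw [two_mul, Finset.sum_range_add]
  simp only [this, CharTwo.add_self_eq_zero]
  simp
  rfl

open Classical in
lemma act_word (cs : CoxeterSystem M W) (ω : List B) (t : W) (e : ZMod 2) :
    cs.lift ⟨act cs, act_liftable cs⟩ (cs.wordProd ω) (t, e) =
      (cs.wordProd ω * t * (cs.wordProd ω)⁻¹, e + ((cs.rightInvSeq ω).count t : ℕ)) := by
  induction ω with
  | nil => simp; rfl
  | cons i ω ih =>
    rw [wordProd_cons, map_mul, lift_apply_simple]
    change act cs i (cs.lift ⟨act cs, act_liftable cs⟩ (cs.wordProd ω) (t, e)) = _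
    rw [ih, rightInvSeq, List.count_cons]
    have E : (cs.wordProd ω * t * (cs.wordProd ω)⁻¹ = cs.simple i) ↔
        ((cs.wordProd ω)⁻¹ * cs.simple i * cs.wordProd ω = t) := by
      rw [mul_inv_eq_iff_eq_mul, mul_assoc, inv_mul_eq_iff_eq_mul, eq_comm]
    simp only [act, E]
    ext
    · simp [mul_assoc]
    · simp [add_assoc]

lemma mem_ris_split (cs : CoxeterSystem M W) (c a : List B) (t : W)
    (h : t ∈ cs.rightInvSeq (c ++ a)) : t ∈ cs.rightInvSeq a ∨
      ∃ c' : List B, c'.length + 1 = c.length ∧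
        cs.wordProd (c ++ a) * t = cs.wordProd (c' ++ a) := by
  induction c with
  | nil => exact Or.inl h
  | cons x c ih =>
    rw [List.cons_append, rightInvSeq, List.mem_cons] at h
    rcases h with rfl | h
    · right
      refine ⟨c, rfl, ?_⟩
      rw [List.cons_append, wordProd_cons]
      simp [mul_assoc]
    · rcases ih h with h | ⟨c', h1, h2⟩
      · exact Or.inl h
      · right
        refine ⟨x :: c', by simp [h1], ?_⟩
        rw [List.cons_append, List.cons_append, wordProd_cons, wordProd_cons, mul_assoc, h2]

lemma exchange (cs : CoxeterSystem M W) (ω : List B) (i : B)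
    (h : cs.IsRightDescent (cs.wordProd ω) i) : cs.simple i ∈ cs.rightInvSeq ω := by
  classical
  obtain ⟨v, hv, hvw⟩ := cs.exists_isReduced (cs.wordProd ω * cs.simple i)
  have hnot : cs.simple i ∉ cs.rightInvSeq v := by
    intro hmem
    have := (cs.isRightInversion_of_mem_rightInvSeq hv hmem).2
    rw [← hvw] at this
    unfold IsRightDescent at h
    simp at this
    omega
  have e1 := act_word cs ω (cs.simple i) 0
  have e2 : cs.wordProd ω = cs.wordProd (v ++ [i]) := by
    rw [wordProd_append, ← hvw]; simp
  have e3 := act_word cs v (cs.simple i) 1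
  rw [e2, wordProd_append, map_mul, wordProd_singleton, lift_apply_simple] at e1
  change cs.lift ⟨act cs, act_liftable cs⟩ (cs.wordProd v) (act cs i (cs.simple i, 0)) = _ at e1
  have e4 : act cs i (cs.simple i, 0) = (cs.simple i, 1) := by simp [act]
  rw [e4, e3, List.count_eq_zero_of_not_mem hnot] at e1
  have e5 := congrArg Prod.snd e1
  simp at e5
  by_contra hc
  rw [List.count_eq_zero_of_not_mem hc] at e5
  simp at e5

/-! ### Matsumoto's theorem -/

lemma alt_inv_mul (cs : CoxeterSystem M W) (p q : B) (r : ℕ) :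
    (cs.wordProd (alternatingWord p q r))⁻¹ * cs.wordProd (alternatingWord p q (r + 1)) =
      cs.simple q * (cs.simple p * cs.simple q) ^ r := by
  rw [prod_alternatingWord_eq_mul_pow, prod_alternatingWord_eq_mul_pow]
  obtain ⟨h, rfl | rfl⟩ := Nat.even_or_odd' r
  · have a1 : ¬ Even (2 * h + 1) := by simp
    have a2 : (2 * h + 1) / 2 = h := by omega
    have a3 : (2 * h) / 2 = h := by omega
    rw [if_pos (by simp), if_neg a1, a2, a3, one_mul, ← mul_assoc, ← simple_mul_pow, two_mul,
      pow_add, mul_assoc]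
  · have a1 : ¬ Even (2 * h + 1) := by simp
    have a2 : (2 * h + 1) / 2 = h := by omega
    have a3 : (2 * h + 1 + 1) / 2 = h + 1 := by omega
    rw [if_neg a1, if_pos (by simp [parity_simps]), a2, a3, one_mul, mul_inv_rev, inv_simple,
      ← simple_mul_pow, mul_assoc, ← pow_add]
    congr 2
    ring

lemma mem_ris_alt (cs : CoxeterSystem M W) (p q : B) (k : ℕ) (t : W)
    (h : t ∈ cs.rightInvSeq (alternatingWord p q k)) :
    ∃ r < k, t = cs.simple q * (cs.simple p * cs.simple q) ^ r := by
  induction k with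
  | zero => simp [alternatingWord] at h
  | succ k ih =>
    have key := alt_inv_mul cs p q k
    rw [alternatingWord_succ'] at h key
    rw [rightInvSeq, List.mem_cons] at h
    rw [wordProd_cons, ← mul_assoc] at key
    rcases h with h | h
    · exact ⟨k, by omega, h.trans key⟩
    · obtain ⟨r, hr, h⟩ := ih h
      exact ⟨r, by omega, h⟩

lemma exists_alt (cs : CoxeterSystem M W) {i j : B} (hij : i ≠ j) (w : W)
    (hi : cs.IsRightDescent w i) (hj : cs.IsRightDescent w j) (k : ℕ)
    (hk : M i j = 0 ∨ k ≤ M i j) :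
    ∃ (c : List B) (p q : B), ((p = i ∧ q = j) ∨ (p = j ∧ q = i)) ∧
      c.length + k = cs.length w ∧ cs.wordProd (c ++ alternatingWord p q k) = w := by
  induction k with
  | zero =>
    obtain ⟨v, hv, rfl⟩ := cs.exists_isReduced w
    exact ⟨v, i, j, Or.inl ⟨rfl, rfl⟩, by simp [hv.eq], by simp [alternatingWord]⟩
  | succ k ih =>
    obtain ⟨c, p, q, hpq, hlen, hprod⟩ := ih (by omega)
    have hp : cs.IsRightDescent w p := by
      rcases hpq with ⟨rfl, rfl⟩ | ⟨rfl, rfl⟩ <;> assumption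
    have hne : p ≠ q := by
      rcases hpq with ⟨rfl, rfl⟩ | ⟨rfl, rfl⟩
      · exact hij
      · exact hij.symm
    have hM : M p q = M i j := by
      rcases hpq with ⟨rfl, rfl⟩ | ⟨rfl, rfl⟩
      · rfl
      · exact M.symmetric _ _
    rw [← hprod] at hp
    rcases mem_ris_split cs _ _ _ (exchange cs _ _ hp) with h | ⟨c', h1, h2⟩
    · exfalso
      obtain ⟨r, hr, h⟩ := mem_ris_alt cs p q k _ h
      have : (cs.simple p * cs.simple q) ^ (r + 1) = 1 := by
        rw [pow_succ', mul_assoc, ← h]; simp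
      have := order_le cs hne (by omega) this
      omega
    · refine ⟨c', q, p, by tauto, by omega, ?_⟩
      rw [alternatingWord_succ, List.concat_eq_append, ← List.append_assoc, wordProd_append,
        ← h2, wordProd_singleton, hprod]
      simp

lemma braid_append_right {a b : List B} (c : List B)
    (h : Relation.ReflTransGen (BraidMove M) a b) :
    Relation.ReflTransGen (BraidMove M) (a ++ c) (b ++ c) := by
  refine Relation.ReflTransGen.lift (· ++ c) ?_ _ _ h
  rintro _ _ ⟨l, r, i, j⟩
  simpa [Function.onFun] using BraidMove.braid (M := M) l (r ++ c) i j

lemma wordProd_braid (cs : CoxeterSystem M W) (c : List B) (i j : B) :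
    cs.wordProd (c ++ alternatingWord i j (M i j)) =
      cs.wordProd (c ++ alternatingWord j i (M i j)) := by
  rw [wordProd_append, wordProd_append, cs.wordProd_braidWord_eq i j, braidWord, M.symmetric]

lemma isReduced_left {cs : CoxeterSystem M W} {a b : List B} (h : cs.IsReduced (a ++ b)) :
    cs.IsReduced a := by
  simpa using h.take a.length

lemma descent_of_reduced {cs : CoxeterSystem M W} {a : List B} {i : B}
    (h : cs.IsReduced (a ++ [i])) : cs.IsRightDescent (cs.wordProd (a ++ [i])) i := by
  have h1 := h.eq
  have h2 := (isReduced_left h).eq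
  unfold IsRightDescent
  rw [h1, wordProd_append]
  simp [h2]

theorem matsumoto (cs : CoxeterSystem M W) (n : ℕ) : ∀ ω₁ ω₂ : List B, ω₁.length = n →
    cs.IsReduced ω₁ → cs.IsReduced ω₂ → cs.wordProd ω₁ = cs.wordProd ω₂ →
      Relation.ReflTransGen (BraidMove M) ω₁ ω₂ := by
  induction n with
  | zero =>
    intro ω₁ ω₂ hl h1 h2 h
    have : ω₂.length = 0 := by rw [← h2.eq, ← h, h1.eq, hl]
    rw [List.length_eq_zero_iff] at hl this
    rw [hl, this]
  | succ n ih =>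
    intro ω₁ ω₂ hl h1 h2 h
    have hl2 : ω₂.length = n + 1 := by rw [← h2.eq, ← h, h1.eq, hl]
    -- words with the same last letter
    have same : ∀ (a b : List B) (i : B), a.length = n → cs.IsReduced (a ++ [i]) →
        cs.IsReduced (b ++ [i]) → cs.wordProd (a ++ [i]) = cs.wordProd (b ++ [i]) →
        Relation.ReflTransGen (BraidMove M) (a ++ [i]) (b ++ [i]) := by
      intro a b i hla ha hb hab
      apply braid_append_right
      apply ih a b hla (isReduced_left ha) (isReduced_left hb)
      simpa [wordProd_append] using hab
    rcases List.eq_nil_or_concat ω₁ with rfl | ⟨a, i, rfl⟩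
    · simp at hl
    rcases List.eq_nil_or_concat ω₂ with rfl | ⟨b, j, rfl⟩
    · simp at hl2
    simp only [List.concat_eq_append, List.length_append, List.length_singleton] at *
    have hla : a.length = n := by omega
    by_cases hij : i = j
    · subst hij
      exact same a b i hla h1 h2 h
    have di := descent_of_reduced h1
    have dj := descent_of_reduced h2
    rw [← h] at dj
    have hM0 : M i j ≠ 0 := by
      intro h0
      obtain ⟨c, p, q, -, hc, -⟩ := exists_alt cs hij _ di dj
        (cs.length (cs.wordProd (a ++ [i])) + 1) (Or.inl h0)
      omega
    obtain ⟨c, p, q, hpq, hlen, hprod⟩ := exists_alt cs hij _ di dj (M i j) (Or.inr le_rfl)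
    have pij : cs.wordProd (c ++ alternatingWord i j (M i j)) = cs.wordProd (a ++ [i]) := by
      rcases hpq with ⟨rfl, rfl⟩ | ⟨rfl, rfl⟩
      · exact hprod
      · rw [wordProd_braid]; exact hprod
    have pji : cs.wordProd (c ++ alternatingWord j i (M i j)) = cs.wordProd (a ++ [i]) := by
      rw [← wordProd_braid]; exact pij
    have rij : cs.IsReduced (c ++ alternatingWord i j (M i j)) := by
      unfold CoxeterSystem.IsReduced; rw [pij, ← hlen]; simp
    have rji : cs.IsReduced (c ++ alternatingWord j i (M i j)) := by
      unfold CoxeterSystem.IsReduced; rw [pji, ← hlen]; simp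
    have step : BraidMove M (c ++ alternatingWord j i (M i j))
        (c ++ alternatingWord i j (M i j)) := by
      have := BraidMove.braid (M := M) c [] j i
      rw [M.symmetric j i] at this
      simpa using this
    rw [h1.eq] at hlen
    obtain ⟨m, hm⟩ := Nat.exists_eq_succ_of_ne_zero hM0
    rw [hm] at hlen pij pji rij rji step
    simp only [Nat.succ_eq_add_one, alternatingWord_succ, List.concat_eq_append,
      ← List.append_assoc] at hlen pij pji rij rji step
    refine (same _ _ i hla h1 rji pji.symm).trans (Relation.ReflTransGen.head step ?_)
    refine same _ _ j ?_ rij h2 (pij.trans h)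
    simp at hlen ⊢
    omega

theorem reduce (cs : CoxeterSystem M W) (ω : List B) : ∃ ω' : List B,
      Relation.ReflTransGen (fun a b => BraidMove M a b ∨ NilMove a b) ω ω' ∧
      cs.IsReduced ω' ∧ cs.wordProd ω' = cs.wordProd ω := by
  induction ω using List.reverseRecOn with
  | nil => exact ⟨[], .refl, by simp [CoxeterSystem.IsReduced], rfl⟩
  | append_singleton a i ih =>
    obtain ⟨a', h1, h2, h3⟩ := ih
    have h1' : Relation.ReflTransGen (fun a b => BraidMove M a b ∨ NilMove a b)
        (a ++ [i]) (a' ++ [i]) := by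
      refine Relation.ReflTransGen.lift (· ++ [i]) ?_ _ _ h1
      rintro _ _ (⟨l, r, x, y⟩ | ⟨l, r, x⟩)
      · left; simpa [Function.onFun] using BraidMove.braid (M := M) l (r ++ [i]) x y
      · right; simpa [Function.onFun] using NilMove.nil l (r ++ [i]) x
    have h3' : cs.wordProd (a' ++ [i]) = cs.wordProd (a ++ [i]) := by
      simp [wordProd_append, h3]
    rcases cs.length_mul_simple (cs.wordProd a') i with h | h
    · refine ⟨a' ++ [i], h1', ?_, h3'⟩
      unfold CoxeterSystem.IsReduced
      rw [wordProd_append, wordProd_singleton, h, h2.eq]; simp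
    · obtain ⟨b, hb, hbw⟩ := cs.exists_isReduced (cs.wordProd a' * cs.simple i)
      have hbp : cs.wordProd a' = cs.wordProd (b ++ [i]) := by
        rw [wordProd_append, ← hbw]; simp
      have hbr : cs.IsReduced (b ++ [i]) := by
        unfold CoxeterSystem.IsReduced
        rw [← hbp, ← h, hbw, hb.eq]; simp
      have hm := braid_append_right [i] (matsumoto cs _ a' _ rfl h2 hbr hbp)
      have hm' : Relation.ReflTransGen (fun a b => BraidMove M a b ∨ NilMove a b)
          (a' ++ [i]) (b ++ [i] ++ [i]) := 
        Relation.ReflTransGen.mono (fun _ _ h => Or.inl h) _ _ hm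
      refine ⟨b, (h1'.trans hm').tail (Or.inr ?_), hb, ?_⟩
      · simpa using NilMove.nil b [] i
      · rw [← hbw, ← h3', wordProd_append, wordProd_singleton]

end WordProp

/-- Tits' theorem / the word property.  Every word in the simple
reflections of a Coxeter group can be transformed into a reduced expression for the same
element by a finite sequence of nil-moves and braid-moves; moreover any two reduced
expressions for the same element are connected by braid-moves alone. -/
theorem word_property {W : Type*} [Group W] {M : CoxeterMatrix B}
    (cs : CoxeterSystem M W) :
    (∀ ω : List B, ∃ ω' : List B,
      Relation.ReflTransGen (fun a b => BraidMove M a b ∨ NilMove a b) ω ω' ∧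
      cs.IsReduced ω' ∧ cs.wordProd ω' = cs.wordProd ω) ∧
    (∀ ω₁ ω₂ : List B, cs.IsReduced ω₁ → cs.IsReduced ω₂ →
      cs.wordProd ω₁ = cs.wordProd ω₂ →
      Relation.ReflTransGen (BraidMove M) ω₁ ω₂) := by
  exact ⟨WordProp.reduce cs, fun ω₁ ω₂ h1 h2 h => WordProp.matsumoto cs _ ω₁ ω₂ rfl h1 h2 h⟩
end
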